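/- arXiv:1202.5627 — 7 statements merged into one kernel-verified Lean document; each statement's English description precedes it below -/
import Mathlib

section
/- Let B be a real (D+1)×(D+1) tridiagonal matrix (D ≥ 2) with nonnegative entries, positive superdiagonal entries β₀,…,β_{D−1} and positive subdiagonal entries γ₁,…,γ_D, satisfying α₀ = 0, γ₁ = 1, and α_i + β_i + γ_i = κ for all i (with γ₀ = 0, β_D = 0), where α_i are the diagonal entries. If θ₀ > θ₁ > ⋯ > θ_D are the (distinct, real) eigenvalues of B, then θ₀ = κ and (θ₁ + 1)(θ_D + 1) ≤ −β₁. -/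
open Polynomial

/-- If all eigenvalues of a real symmetric matrix `A` lie in `[b, a]`, then the diagonal entries of
`(A - a) (A - b)` are nonpositive. -/
theorem Matrix.IsHermitian.diag_quadratic_nonpos {ι : Type*} [Fintype ι] [DecidableEq ι]
    {A : Matrix ι ι ℝ} (hA : A.IsHermitian) {a b : ℝ}
    (h : ∀ (μ : ℝ) (u : ι → ℝ), u ≠ 0 → A.mulVec u = μ • u → b ≤ μ ∧ μ ≤ a) (i : ι) :
    (A * A) i i - (a + b) * A i i + a * b ≤ 0 := by
  have hev : ∀ j, b ≤ hA.eigenvalues j ∧ hA.eigenvalues j ≤ a := by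
    intro j
    refine h _ (hA.eigenvectorBasis j) ?_ (hA.mulVec_eigenvectorBasis j)
    intro h0
    apply hA.eigenvectorBasis.orthonormal.ne_zero j
    ext k
    exact congrFun h0 k
  set U : Matrix ι ι ℝ := (hA.eigenvectorUnitary : Matrix ι ι ℝ) with hU
  set L : Matrix ι ι ℝ := Matrix.diagonal hA.eigenvalues with hL
  have hUU : star U * U = 1 := Unitary.coe_star_mul_self hA.eigenvectorUnitary
  have hUU' : U * star U = 1 := Unitary.coe_mul_star_self hA.eigenvectorUnitary
  have hspec : A = U * L * star U := by
    have := hA.spectral_theorem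
    simpa [Unitary.conjStarAlgAut_apply, hU, hL, Function.comp_def] using this
  have hsq : A * A = U * (L * L) * star U := by
    calc A * A = U * L * (star U * U) * L * star U := by
          conv_lhs => rw [hspec]
          simp only [mul_assoc]
      _ = U * (L * L) * star U := by rw [hUU]; simp only [mul_assoc, one_mul]
  have hd : ∀ d : ι → ℝ, (U * Matrix.diagonal d * star U) i i = ∑ j, d j * U i j ^ 2 := by
    intro d
    rw [Matrix.mul_apply]
    refine Finset.sum_congr rfl fun j _ => ?_
    rw [Matrix.mul_diagonal, Matrix.star_apply, star_trivial]
    ring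
  have h1 : (1 : ℝ) = ∑ j, U i j ^ 2 := by
    have := hd fun _ => 1
    simpa [hUU'] using this
  have h2 : A i i = ∑ j, hA.eigenvalues j * U i j ^ 2 := by
    rw [← hd, ← hL, ← hspec]
  have h3 : (A * A) i i = ∑ j, (hA.eigenvalues j * hA.eigenvalues j) * U i j ^ 2 := by
    rw [← hd, ← Matrix.diagonal_mul_diagonal, ← hL, ← hsq]
  have h4 : (A * A) i i - (a + b) * A i i + a * b
      = ∑ j, (hA.eigenvalues j - a) * (hA.eigenvalues j - b) * U i j ^ 2 := by
    have : a * b = a * b * ∑ j, U i j ^ 2 := by rw [← h1, mul_one]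
    rw [this, h2, h3, Finset.mul_sum, Finset.mul_sum, ← Finset.sum_sub_distrib,
      ← Finset.sum_add_distrib]
    exact Finset.sum_congr rfl fun j _ => by ring
  rw [h4]
  refine Finset.sum_nonpos fun j _ => ?_
  obtain ⟨hb, ha⟩ := hev j
  exact mul_nonpos_of_nonpos_of_nonneg
    (mul_nonpos_of_nonpos_of_nonneg (by linarith) (by linarith)) (sq_nonneg _)

/-- If `T` is symmetric with respect to positive weights `w` and all its real eigenvalues lie in
`[b, a]`, then the diagonal entries of `(T - a) (T - b)` are nonpositive. -/
theorem Matrix.diag_quadratic_nonpos_of_symmetrizable {ι : Type*} [Fintype ι] [DecidableEq ι]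
    {T : Matrix ι ι ℝ} {w : ι → ℝ} (hw : ∀ i, 0 < w i) (hT : ∀ i j, w i * T i j = w j * T j i)
    {a b : ℝ} (h : ∀ (μ : ℝ) (u : ι → ℝ), u ≠ 0 → T.mulVec u = μ • u → b ≤ μ ∧ μ ≤ a) (i : ι) :
    (T * T) i i - (a + b) * T i i + a * b ≤ 0 := by
  obtain ⟨s, hs, hsw⟩ : ∃ s : ι → ℝ, (∀ i, 0 < s i) ∧ ∀ i, w i = s i * s i :=
    ⟨fun i => √(w i), fun i => Real.sqrt_pos.2 (hw i),
      fun i => (Real.mul_self_sqrt (hw i).le).symm⟩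
  have hs0 : ∀ i, s i ≠ 0 := fun i => (hs i).ne'
  set A : Matrix ι ι ℝ := Matrix.of fun i j => s i * T i j / s j with hAdef
  have hAij : ∀ i j, A i j = s i * T i j / s j := fun i j => rfl
  have hA : A.IsHermitian := by
    ext p q
    rw [Matrix.conjTranspose_apply, star_trivial, hAij, hAij, div_eq_div_iff (hs0 p) (hs0 q)]
    have := hT p q
    rw [hsw, hsw] at this
    linarith
  have hdiag : A i i = T i i := by
    rw [hAij]
    field_simp [hs0 i]
  have hsq : (A * A) i i = (T * T) i i := by
    simp only [Matrix.mul_apply]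
    refine Finset.sum_congr rfl fun j _ => ?_
    rw [hAij, hAij]
    field_simp [hs0 i, hs0 j]
  rw [← hdiag, ← hsq]
  refine hA.diag_quadratic_nonpos (fun μ v hv hAv => ?_) i
  refine h μ (fun j => v j / s j) (fun h0 => hv ?_) ?_
  · ext j
    have := congrFun h0 j
    simpa [hs0 j] using this
  · ext p
    have hp := congrFun hAv p
    simp only [Matrix.mulVec, dotProduct, hAij, Pi.smul_apply, smul_eq_mul] at hp ⊢
    rw [mul_div_assoc', ← hp, Finset.sum_div]
    refine Finset.sum_congr rfl fun j _ => ?_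
    field_simp [hs0 p, hs0 j]

/-- A tridiagonal matrix with positive off-diagonals is symmetric for suitable positive weights. -/
theorem Matrix.exists_pos_weights_of_tridiagonal {n : ℕ} {T : Matrix (Fin (n + 1)) (Fin (n + 1)) ℝ}
    (htri : ∀ i j : Fin (n + 1), ((i : ℕ) + 1 < j ∨ (j : ℕ) + 1 < i) → T i j = 0)
    (hsuper : ∀ i : Fin n, 0 < T i.castSucc i.succ)
    (hsub : ∀ i : Fin n, 0 < T i.succ i.castSucc) :
    ∃ w : Fin (n + 1) → ℝ, (∀ i, 0 < w i) ∧ ∀ i j, w i * T i j = w j * T j i := by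
  obtain ⟨w, hw0, hws⟩ : ∃ w : Fin (n + 1) → ℝ, w 0 = 1 ∧
      ∀ k : Fin n, w k.succ = w k.castSucc * (T k.castSucc k.succ / T k.succ k.castSucc) :=
    ⟨fun i => Fin.induction (motive := fun _ => ℝ) 1
      (fun k x => x * (T k.castSucc k.succ / T k.succ k.castSucc)) i, rfl, fun k => rfl⟩
  have hstep : ∀ k : Fin n, w k.castSucc * T k.castSucc k.succ = w k.succ * T k.succ k.castSucc := by
    intro k
    rw [hws]
    field_simp [(hsub k).ne']
  have hlt : ∀ i j : Fin (n + 1), i < j → w i * T i j = w j * T j i := by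
    intro i j hij
    by_cases h : (i : ℕ) + 1 < j
    · rw [htri i j (Or.inl h), htri j i (Or.inr h), mul_zero, mul_zero]
    · have hij' : (i : ℕ) < j := hij
      have hi : (i : ℕ) < n := by omega
      have e1 : i = (⟨i, hi⟩ : Fin n).castSucc := rfl
      have e2 : j = (⟨i, hi⟩ : Fin n).succ := Fin.ext (by simp; omega)
      rw [e2]
      exact hstep ⟨i, hi⟩
  refine ⟨w, fun i => ?_, fun i j => ?_⟩
  · induction i using Fin.induction with
    | zero => rw [hw0]; exact one_pos
    | succ k ih => rw [hws]; exact mul_pos ih (div_pos (hsuper k) (hsub k))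
  · rcases lt_trichotomy i j with h | rfl | h
    · exact hlt i j h
    · rfl
    · exact (hlt j i h).symm

/-- Partial row sums of a matrix. -/
def partialRowSum {n : ℕ} (B : Matrix (Fin (n + 1)) (Fin (n + 1)) ℝ) (i : Fin (n + 1)) (j : Fin n) :
    ℝ :=
  ∑ l with l ≤ j.castSucc, B i l

/-- The matrix describing the action of `B` on consecutive differences of a vector, when `B` has
constant row sums. -/
def differenceMatrix {n : ℕ} (B : Matrix (Fin (n + 1)) (Fin (n + 1)) ℝ) :
    Matrix (Fin n) (Fin n) ℝ :=
  Matrix.of fun i j => partialRowSum B i.castSucc j - partialRowSum B i.succ j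

section PartialRowSum

variable {n : ℕ} {B : Matrix (Fin (n + 1)) (Fin (n + 1)) ℝ} {κ : ℝ}

theorem partialRowSum_add (hrow : ∀ i, ∑ j, B i j = κ) (i : Fin (n + 1)) (j : Fin n) :
    partialRowSum B i j + ∑ l with ¬ l ≤ j.castSucc, B i l = κ := by
  rw [partialRowSum, Finset.sum_filter_add_sum_filter_not, hrow]

theorem partialRowSum_eq_zero
    (htri : ∀ i j : Fin (n + 1), ((i : ℕ) + 1 < j ∨ (j : ℕ) + 1 < i) → B i j = 0)
    {i : Fin (n + 1)} {j : Fin n} (h : (j : ℕ) + 1 < i) : partialRowSum B i j = 0 := by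
  refine Finset.sum_eq_zero fun l hl => htri i l (Or.inr ?_)
  have : (l : ℕ) ≤ j := (Finset.mem_filter.1 hl).2
  omega

theorem partialRowSum_eq_total (hrow : ∀ i, ∑ j, B i j = κ)
    (htri : ∀ i j : Fin (n + 1), ((i : ℕ) + 1 < j ∨ (j : ℕ) + 1 < i) → B i j = 0)
    {i : Fin (n + 1)} {j : Fin n} (h : (i : ℕ) < j) : partialRowSum B i j = κ := by
  rw [← partialRowSum_add hrow i j, left_eq_add]
  refine Finset.sum_eq_zero fun l hl => htri i l (Or.inl ?_)
  have : ¬ (l : ℕ) ≤ j := (Finset.mem_filter.1 hl).2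
  omega

theorem partialRowSum_succ
    (htri : ∀ i j : Fin (n + 1), ((i : ℕ) + 1 < j ∨ (j : ℕ) + 1 < i) → B i j = 0) (j : Fin n) :
    partialRowSum B j.succ j = B j.succ j.castSucc := by
  refine Finset.sum_eq_single_of_mem _ (by simp) fun l hl hne => htri _ l (Or.inr ?_)
  have h1 : (l : ℕ) ≤ j := (Finset.mem_filter.1 hl).2
  have h2 : (l : ℕ) ≠ j := fun h => hne (Fin.ext h)
  simp only [Fin.val_succ]
  omega

theorem partialRowSum_castSucc (hrow : ∀ i, ∑ j, B i j = κ)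
    (htri : ∀ i j : Fin (n + 1), ((i : ℕ) + 1 < j ∨ (j : ℕ) + 1 < i) → B i j = 0) (j : Fin n) :
    partialRowSum B j.castSucc j = κ - B j.castSucc j.succ := by
  rw [eq_sub_iff_add_eq, ← partialRowSum_add hrow j.castSucc j, add_right_inj]
  symm
  refine Finset.sum_eq_single_of_mem _ (by simp) fun l hl hne => htri _ l (Or.inl ?_)
  have h1 : ¬ (l : ℕ) ≤ j := (Finset.mem_filter.1 hl).2
  have h2 : (l : ℕ) ≠ j + 1 := fun h => hne (Fin.ext h)
  simp only [Fin.val_castSucc]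
  omega

theorem differenceMatrix_eq_zero (hrow : ∀ i, ∑ j, B i j = κ)
    (htri : ∀ i j : Fin (n + 1), ((i : ℕ) + 1 < j ∨ (j : ℕ) + 1 < i) → B i j = 0)
    (i j : Fin n) (h : (i : ℕ) + 1 < j ∨ (j : ℕ) + 1 < i) : differenceMatrix B i j = 0 := by
  rw [differenceMatrix, Matrix.of_apply]
  rcases h with h | h
  · rw [partialRowSum_eq_total hrow htri (i := i.castSucc) (by simp; omega),
      partialRowSum_eq_total hrow htri (i := i.succ) (by simp; omega), sub_self]
  · rw [partialRowSum_eq_zero htri (i := i.castSucc) (by simp; omega),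
      partialRowSum_eq_zero htri (i := i.succ) (by simp; omega), sub_self]

end PartialRowSum

theorem differenceMatrix_castSucc_succ {n : ℕ} {B : Matrix (Fin (n + 2)) (Fin (n + 2)) ℝ} {κ : ℝ}
    (hrow : ∀ i, ∑ j, B i j = κ)
    (htri : ∀ i j : Fin (n + 2), ((i : ℕ) + 1 < j ∨ (j : ℕ) + 1 < i) → B i j = 0) (k : Fin n) :
    differenceMatrix B k.castSucc k.succ = B k.succ.castSucc k.succ.succ := by
  rw [differenceMatrix, Matrix.of_apply, partialRowSum_eq_total hrow htri (by simp),
    Fin.succ_castSucc, partialRowSum_castSucc hrow htri, sub_sub_cancel]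

theorem differenceMatrix_succ_castSucc {n : ℕ} {B : Matrix (Fin (n + 2)) (Fin (n + 2)) ℝ}
    (htri : ∀ i j : Fin (n + 2), ((i : ℕ) + 1 < j ∨ (j : ℕ) + 1 < i) → B i j = 0) (k : Fin n) :
    differenceMatrix B k.succ k.castSucc = B k.castSucc.succ k.castSucc.castSucc := by
  rw [differenceMatrix, Matrix.of_apply, partialRowSum_eq_zero htri (i := k.succ.succ) (by simp),
    ← Fin.succ_castSucc, partialRowSum_succ htri, sub_zero]

/-- An eigenvector `d` of the difference matrix is the difference vector of some `v` with
`B v - μ v` constant. -/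
theorem exists_mulVec_eq_of_differenceMatrix {n : ℕ} {B : Matrix (Fin (n + 1)) (Fin (n + 1)) ℝ}
    {μ : ℝ} {d : Fin n → ℝ} (hd : (differenceMatrix B).mulVec d = μ • d) :
    ∃ (v : Fin (n + 1) → ℝ) (c : ℝ), (∀ i : Fin n, v i.castSucc - v i.succ = d i) ∧
      ∀ i, B.mulVec v i = μ * v i + c := by
  set v : Fin (n + 1) → ℝ := fun l => ∑ j with l ≤ Fin.castSucc j, d j with hv
  have hdiff : ∀ i : Fin n, v i.castSucc - v i.succ = d i := by
    intro i
    simp only [hv, Finset.sum_filter]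
    rw [← Finset.sum_sub_distrib, Finset.sum_eq_single i]
    · simp
    · intro j _ hne
      have : (j : ℕ) ≠ i := fun h => hne (Fin.ext h)
      by_cases h : (i : ℕ) ≤ j
      · have h1 : i.castSucc ≤ j.castSucc := h
        have h2 : i.succ ≤ j.castSucc := show (i : ℕ) + 1 ≤ j by omega
        rw [if_pos h1, if_pos h2, sub_self]
      · have h1 : ¬ i.castSucc ≤ j.castSucc := h
        have h2 : ¬ i.succ ≤ j.castSucc := show ¬ (i : ℕ) + 1 ≤ j by omega
        rw [if_neg h1, if_neg h2, sub_self]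
    · simp
  have hBv : ∀ i, B.mulVec v i = ∑ j, partialRowSum B i j * d j := by
    intro i
    simp only [Matrix.mulVec, dotProduct, hv, partialRowSum, Finset.sum_filter, Finset.mul_sum,
      Finset.sum_mul]
    rw [Finset.sum_comm]
    refine Finset.sum_congr rfl fun j _ => Finset.sum_congr rfl fun l _ => ?_
    split_ifs <;> simp
  refine ⟨v, B.mulVec v 0 - μ * v 0, hdiff, fun i => ?_⟩
  induction i using Fin.induction with
  | zero => ring
  | succ k ih =>
    have h1 : B.mulVec v k.castSucc - B.mulVec v k.succ = μ * d k := by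
      rw [hBv, hBv, ← Finset.sum_sub_distrib]
      have := congrFun hd k
      simp only [Matrix.mulVec, dotProduct, differenceMatrix, Matrix.of_apply, Pi.smul_apply,
        smul_eq_mul] at this
      rw [← this]
      exact Finset.sum_congr rfl fun j _ => by ring
    rw [← hdiff k] at h1
    linarith

section NonnegRowSum

variable {n : ℕ} {B : Matrix (Fin (n + 1)) (Fin (n + 1)) ℝ} {κ : ℝ}

theorem nonpos_of_mulVec_eq_add (hnonneg : ∀ i j, 0 ≤ B i j) (hrow : ∀ i, ∑ j, B i j = κ)
    {v : Fin (n + 1) → ℝ} {c : ℝ} (h : ∀ i, B.mulVec v i = κ * v i + c) : c ≤ 0 := by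
  obtain ⟨i, hi⟩ := Finite.exists_max v
  have h1 : B.mulVec v i ≤ κ * v i := by
    rw [← hrow i, Finset.sum_mul, Matrix.mulVec, dotProduct]
    exact Finset.sum_le_sum fun j _ => mul_le_mul_of_nonneg_left (hi j) (hnonneg i j)
  linarith [h i]

theorem eigenvalue_le_rowSum (hnonneg : ∀ i j, 0 ≤ B i j) (hrow : ∀ i, ∑ j, B i j = κ)
    {v : Fin (n + 1) → ℝ} (hv : v ≠ 0) {μ : ℝ} (h : B.mulVec v = μ • v) : μ ≤ κ := by
  obtain ⟨i, hi⟩ := Finite.exists_max fun i => |v i|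
  have hpos : 0 < |v i| := by
    obtain ⟨j, hj⟩ := Function.ne_iff.1 hv
    exact (abs_pos.2 hj).trans_le (hi j)
  have h1 : |B.mulVec v i| ≤ κ * |v i| := by
    rw [← hrow i, Finset.sum_mul, Matrix.mulVec, dotProduct]
    refine (Finset.abs_sum_le_sum_abs _ _).trans (Finset.sum_le_sum fun j _ => ?_)
    rw [abs_mul, abs_of_nonneg (hnonneg i j)]
    exact mul_le_mul_of_nonneg_left (hi j) (hnonneg i j)
  rw [h, Pi.smul_apply, smul_eq_mul, abs_mul] at h1
  exact (le_abs_self μ).trans (le_of_mul_le_mul_right h1 hpos)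

theorem mulVec_const (hrow : ∀ i, ∑ j, B i j = κ) (t : ℝ) (i : Fin (n + 1)) :
    B.mulVec (fun _ => t) i = κ * t := by
  rw [← hrow i, Finset.sum_mul]
  rfl

theorem eq_zero_of_tridiagonal_mulVec
    (htri : ∀ i j : Fin (n + 1), ((i : ℕ) + 1 < j ∨ (j : ℕ) + 1 < i) → B i j = 0)
    (hsuper : ∀ i : Fin n, 0 < B i.castSucc i.succ)
    {u : Fin (n + 1) → ℝ} {μ : ℝ} (h : B.mulVec u = μ • u) (h0 : u 0 = 0) : u = 0 := by
  have key : ∀ i j : Fin (n + 1), j ≤ i → u j = 0 := by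
    intro i
    induction i using Fin.induction with
    | zero =>
      intro j hj
      rw [Fin.le_zero_iff.1 hj, h0]
    | succ k ih =>
      intro j hj
      rcases hj.lt_or_eq with hlt | rfl
      · exact ih j (Fin.le_castSucc_iff.2 hlt)
      · have hk := congrFun h k.castSucc
        rw [Pi.smul_apply, ih _ le_rfl, smul_zero, Matrix.mulVec, dotProduct,
          Finset.sum_eq_single k.succ] at hk
        · exact (mul_eq_zero.1 hk).resolve_left (hsuper k).ne'
        · intro l _ hne
          by_cases hl : l ≤ k.castSucc
          · rw [ih l hl, mul_zero]
          · have h1 : ¬ (l : ℕ) ≤ k := hl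
            have h2 : (l : ℕ) ≠ k + 1 := fun h => hne (Fin.ext h)
            rw [htri _ l (Or.inl (by simp only [Fin.val_castSucc]; omega)), zero_mul]
        · simp
  exact funext fun i => key i i le_rfl

end NonnegRowSum

/-- The eigenvalues of the difference matrix are eigenvalues of `B` other than the row sum. -/
theorem ne_and_exists_of_differenceMatrix_mulVec {n : ℕ}
    {B : Matrix (Fin (n + 1)) (Fin (n + 1)) ℝ} {κ : ℝ} (hnonneg : ∀ i j, 0 ≤ B i j)
    (htri : ∀ i j : Fin (n + 1), ((i : ℕ) + 1 < j ∨ (j : ℕ) + 1 < i) → B i j = 0)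
    (hsuper : ∀ i : Fin n, 0 < B i.castSucc i.succ) (hrow : ∀ i, ∑ j, B i j = κ)
    {d : Fin n → ℝ} (hd0 : d ≠ 0) {μ : ℝ} (hd : (differenceMatrix B).mulVec d = μ • d) :
    μ ≠ κ ∧ ∃ u : Fin (n + 1) → ℝ, u ≠ 0 ∧ B.mulVec u = μ • u := by
  obtain ⟨v, c, hv, hc⟩ := exists_mulVec_eq_of_differenceMatrix hd
  have hconst : ∀ t : ℝ, v - (fun _ => t) ≠ 0 := by
    intro t h
    apply hd0
    ext i
    have h1 := congrFun h i.castSucc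
    have h2 := congrFun h i.succ
    simp only [Pi.sub_apply, Pi.zero_apply] at h1 h2
    rw [← hv i, Pi.zero_apply]
    linarith
  have hne : μ ≠ κ := by
    rintro rfl
    have hc0 : c = 0 := by
      refine le_antisymm (nonpos_of_mulVec_eq_add hnonneg hrow hc) ?_
      have : -c ≤ 0 := nonpos_of_mulVec_eq_add hnonneg hrow (v := -v) fun i => by
        rw [Matrix.mulVec_neg, Pi.neg_apply, hc, Pi.neg_apply]
        ring
      linarith
    refine hconst (v 0) (eq_zero_of_tridiagonal_mulVec htri hsuper (μ := μ) ?_ (by simp))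
    ext i
    rw [Matrix.mulVec_sub, Pi.sub_apply, hc, mulVec_const hrow, hc0, Pi.smul_apply, Pi.sub_apply,
      smul_eq_mul]
    ring
  refine ⟨hne, v - (fun _ => c / (κ - μ)), hconst _, ?_⟩
  ext i
  rw [Matrix.mulVec_sub, Pi.sub_apply, hc, mulVec_const hrow, Pi.smul_apply, Pi.sub_apply,
    smul_eq_mul]
  have : κ - μ ≠ 0 := sub_ne_zero.2 hne.symm
  field_simp
  ring

theorem Matrix.isRoot_charpoly_iff_exists_mulVec {ι : Type*} [Fintype ι] [DecidableEq ι]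
    {B : Matrix ι ι ℝ} {μ : ℝ} :
    B.charpoly.IsRoot μ ↔ ∃ u : ι → ℝ, u ≠ 0 ∧ B.mulVec u = μ • u := by
  rw [IsRoot, Matrix.eval_charpoly, ← Matrix.exists_mulVec_eq_zero_iff]
  refine exists_congr fun u => and_congr_right fun _ => ?_
  rw [Matrix.sub_mulVec, sub_eq_zero, eq_comm, Matrix.scalar_apply,
    ← Matrix.smul_one_eq_diagonal, Matrix.smul_mulVec, Matrix.one_mulVec]

theorem stmt_5 (D : ℕ) (hD : 2 ≤ D) (B : Matrix (Fin (D+1)) (Fin (D+1)) ℝ) (κ : ℝ)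
    (hnonneg : ∀ i j, 0 ≤ B i j)
    (htri : ∀ i j : Fin (D+1), ((i : ℕ) + 1 < (j : ℕ) ∨ (j : ℕ) + 1 < (i : ℕ)) → B i j = 0)
    (hsuper : ∀ i : Fin D, 0 < B i.castSucc i.succ)
    (hsub : ∀ i : Fin D, 0 < B i.succ i.castSucc)
    (hα0 : B 0 0 = 0)
    (hγ1 : B 1 0 = 1)
    (hrow : ∀ i, ∑ j, B i j = κ)
    (θ : Fin (D+1) → ℝ) (hθ : StrictAnti θ)
    (hchar : B.charpoly = ∏ i, (X - C (θ i))) :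
    θ 0 = κ ∧ (θ 1 + 1) * (θ (Fin.last D) + 1) ≤ - B 1 2 := by
  obtain ⟨m, rfl⟩ : ∃ m, D = m + 2 := ⟨D - 2, by omega⟩
  have hroot : ∀ μ : ℝ, (∃ u : Fin (m + 2 + 1) → ℝ, u ≠ 0 ∧ B.mulVec u = μ • u) ↔
      ∃ i, θ i = μ := by
    intro μ
    rw [← Matrix.isRoot_charpoly_iff_exists_mulVec, hchar, IsRoot, eval_prod,
      Finset.prod_eq_zero_iff]
    simp [sub_eq_zero, eq_comm]
  have hθ0 : θ 0 = κ := by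
    apply le_antisymm
    · obtain ⟨u, hu, hBu⟩ := (hroot (θ 0)).2 ⟨0, rfl⟩
      exact eigenvalue_le_rowSum hnonneg hrow hu hBu
    · obtain ⟨i, rfl⟩ := (hroot κ).1 ⟨fun _ => 1, fun h => one_ne_zero (congrFun h 0),
        funext fun i => mulVec_const hrow 1 i⟩
      exact hθ.antitone (Fin.zero_le i)
  refine ⟨hθ0, ?_⟩
  have hTtri := differenceMatrix_eq_zero hrow htri
  obtain ⟨w, hw, hsymm⟩ := Matrix.exists_pos_weights_of_tridiagonal (T := differenceMatrix B) hTtri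
    (fun k => by rw [differenceMatrix_castSucc_succ hrow htri]; exact hsuper _)
    (fun k => by rw [differenceMatrix_succ_castSucc htri]; exact hsub _)
  have key := Matrix.diag_quadratic_nonpos_of_symmetrizable hw hsymm (a := θ 1)
    (b := θ (Fin.last _)) (fun μ u hu hTu => by
      obtain ⟨hne, hex⟩ :=
        ne_and_exists_of_differenceMatrix_mulVec hnonneg htri hsuper hrow hu hTu
      obtain ⟨i, rfl⟩ := (hroot μ).1 hex
      refine ⟨hθ.antitone (Fin.le_last i), hθ.antitone (Fin.one_le_of_ne_zero ?_)⟩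
      intro hi
      exact hne (by rw [hi, hθ0])) 0
  have h01 : differenceMatrix B 0 1 = B 1 2 := differenceMatrix_castSucc_succ hrow htri 0
  have h10 : differenceMatrix B 1 0 = 1 :=
    (differenceMatrix_succ_castSucc htri 0).trans hγ1
  have h00 : differenceMatrix B 0 0 = -1 := by
    have h1 : partialRowSum B (Fin.succ 0) (0 : Fin (m + 2)) = 1 :=
      (partialRowSum_succ htri 0).trans hγ1
    have h2 : partialRowSum B (Fin.castSucc 0) (0 : Fin (m + 2)) = 0 := by
      refine (Finset.sum_eq_single_of_mem 0 (by simp) fun l hl hne => ?_).trans hα0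
      exact absurd (Fin.le_zero_iff.1 (Finset.mem_filter.1 hl).2) hne
    rw [differenceMatrix, Matrix.of_apply, h1, h2, zero_sub]
  have hsq : (differenceMatrix B * differenceMatrix B) 0 0 = 1 + B 1 2 := by
    rw [Matrix.mul_apply, Fin.sum_univ_succ, Fin.sum_univ_succ, Finset.sum_eq_zero]
    · rw [Fin.succ_zero_eq_one, h00, h01, h10]
      ring
    · intro k _
      rw [hTtri 0 k.succ.succ (Or.inl (by simp)), zero_mul]
  rw [hsq, h00] at key
  linarith
end

section
/- Let B be a (D+1)×(D+1) tridiagonal matrix as above with D ≥ 3 and eigenvalues κ > θ₁ > ⋯ > θ_D. If β₂ + γ₃ ≥ κ + 1, then (θ₁+1)(θ_{D−1}+1)(θ_D+1) ≥ −β₁(κ + 1 − β₂ − γ₃). -/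
open Polynomial

namespace Matrix

/-- A real symmetric matrix with a full set of distinct eigenvalues is orthogonally diagonalizable
with these eigenvalues, in the given order. -/
lemma IsSymm.exists_orthogonal_diagonalization {n : Type*} [Fintype n] [DecidableEq n]
    {S : Matrix n n ℝ} (hS : S.IsSymm) {μ : n → ℝ} (hμ : Function.Injective μ)
    (h : ∀ k, ∃ v : n → ℝ, v ≠ 0 ∧ S *ᵥ v = μ k • v) :
    ∃ U : Matrix n n ℝ, Uᵀ * U = 1 ∧ Uᵀ * diagonal μ * U = S := by
  choose v hv hSv using h
  have horth : ∀ i j, i ≠ j → v i ⬝ᵥ v j = 0 := by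
    intro i j hij
    have h1 : v i ⬝ᵥ S *ᵥ v j = S *ᵥ v i ⬝ᵥ v j := by
      rw [dotProduct_mulVec, ← mulVec_transpose, hS.eq]
    rw [hSv, hSv, dotProduct_smul, smul_dotProduct, smul_eq_mul, smul_eq_mul] at h1
    have h2 : (μ j - μ i) * (v i ⬝ᵥ v j) = 0 := by linarith
    exact (mul_eq_zero.1 h2).resolve_left (sub_ne_zero.2 fun e => hij (hμ e.symm))
  have hpos : ∀ i, 0 < v i ⬝ᵥ v i := fun i =>
    lt_of_le_of_ne (Finset.sum_nonneg fun _ _ => mul_self_nonneg _)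
      (Ne.symm fun e => hv i (dotProduct_self_eq_zero.1 e))
  let U : Matrix n n ℝ := of fun i => (√(v i ⬝ᵥ v i))⁻¹ • v i
  have hUU : U * Uᵀ = 1 := by
    ext i j
    have : (U * Uᵀ) i j = (√(v i ⬝ᵥ v i))⁻¹ * ((√(v j ⬝ᵥ v j))⁻¹ * (v i ⬝ᵥ v j)) := by
      change ((√(v i ⬝ᵥ v i))⁻¹ • v i) ⬝ᵥ ((√(v j ⬝ᵥ v j))⁻¹ • v j) = _
      rw [smul_dotProduct, dotProduct_smul, smul_eq_mul, smul_eq_mul]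
    rw [this]
    obtain rfl | hij := eq_or_ne i j
    · have h3 := Real.sqrt_pos.2 (hpos i)
      rw [one_apply_eq]
      nth_rewrite 3 [← Real.mul_self_sqrt (hpos i).le]
      field_simp
    · rw [horth i j hij, one_apply_ne hij, mul_zero, mul_zero]
  have hUU' : Uᵀ * U = 1 := mul_eq_one_comm.1 hUU
  refine ⟨U, hUU', ?_⟩
  have hSU : S * Uᵀ = Uᵀ * diagonal μ := by
    ext i j
    rw [mul_diagonal]
    have h4 : S *ᵥ U j = μ j • U j := by
      change S *ᵥ ((√(v j ⬝ᵥ v j))⁻¹ • v j) = μ j • ((√(v j ⬝ᵥ v j))⁻¹ • v j)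
      rw [mulVec_smul, hSv, smul_comm]
    have h5 := congrFun h4 i
    rw [Pi.smul_apply, smul_eq_mul, mul_comm] at h5
    exact h5
  rw [← hSU, Matrix.mul_assoc, hUU', Matrix.mul_one]

/-- A real symmetric matrix is orthogonally diagonalizable with weakly decreasing eigenvalues. -/
lemma IsSymm.exists_antitone_diagonalization {n : ℕ} {S : Matrix (Fin n) (Fin n) ℝ}
    (hS : S.IsSymm) :
    ∃ (e : Fin n → ℝ) (U : Matrix (Fin n) (Fin n) ℝ),
      Antitone e ∧ Uᵀ * U = 1 ∧ Uᵀ * diagonal e * U = S := by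
  have hH : S.IsHermitian := by rw [IsHermitian, conjTranspose_eq_transpose_of_trivial, hS.eq]
  let σ := Tuple.sort (fun i => -hH.eigenvalues i)
  let P : Matrix (Fin n) (Fin n) ℝ := hH.eigenvectorUnitary
  have hP : P * Pᵀ = 1 := by
    have := Unitary.mul_star_self_of_mem hH.eigenvectorUnitary.2
    rwa [star_eq_conjTranspose, conjTranspose_eq_transpose_of_trivial] at this
  have hPS : P * diagonal hH.eigenvalues * Pᵀ = S := by
    have := hH.spectral_theorem
    rw [Unitary.conjStarAlgAut_apply, star_eq_conjTranspose,
      conjTranspose_eq_transpose_of_trivial] at this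
    exact this.symm
  refine ⟨hH.eigenvalues ∘ σ, Pᵀ.submatrix σ id, ?_, ?_, ?_⟩
  · intro i j hij
    have := Tuple.monotone_sort (fun i => -hH.eigenvalues i) hij
    simpa using this
  · rw [transpose_submatrix, transpose_transpose, submatrix_mul_equiv, hP]
    simp
  · rw [← submatrix_diagonal_equiv, transpose_submatrix, transpose_transpose, submatrix_mul_equiv,
      submatrix_mul_equiv, hPS]
    simp

/-- The part of Cauchy interlacing for a principal `3 × 3` submatrix which concerns the largest
and the two smallest eigenvalues. -/
lemma interlacing_fin_three {n : ℕ} {S : Matrix (Fin (n + 3)) (Fin (n + 3)) ℝ}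
    {μ : Fin (n + 3) → ℝ} (hμ : Antitone μ) {U : Matrix (Fin (n + 3)) (Fin (n + 3)) ℝ}
    (hU : Uᵀ * U = 1) (hUS : Uᵀ * diagonal μ * U = S)
    {c : Fin 3 → Fin (n + 3)} (hc : Function.Injective c)
    {e : Fin 3 → ℝ} (he : Antitone e) {W : Matrix (Fin 3) (Fin 3) ℝ}
    (hW : Wᵀ * W = 1) (hWS : Wᵀ * diagonal e * W = S.submatrix c c) :
    e 0 ≤ μ 0 ∧ μ ⟨n + 1, by omega⟩ ≤ e 1 ∧ μ ⟨n + 2, by omega⟩ ≤ e 2 := by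
  have hW' : W * Wᵀ = 1 := mul_eq_one_comm.1 hW
  let V : Matrix (Fin (n + 3)) (Fin 3) ℝ := U.submatrix id c * Wᵀ
  have hV : Vᵀ * V = 1 := by
    have h1 : (U.submatrix id c)ᵀ * U.submatrix id c = 1 := by
      rw [transpose_submatrix, ← submatrix_mul _ _ c id c Function.bijective_id, hU,
        submatrix_one _ hc]
    calc Vᵀ * V = W * ((U.submatrix id c)ᵀ * U.submatrix id c) * Wᵀ := by
          simp only [V, transpose_mul, transpose_transpose, Matrix.mul_assoc]
      _ = 1 := by rw [h1, Matrix.mul_one, hW']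
  have hVe : Vᵀ * diagonal μ * V = diagonal e := by
    have h1 : (U.submatrix id c)ᵀ * diagonal μ * U.submatrix id c = Wᵀ * diagonal e * W := by
      rw [hWS, ← hUS, submatrix_mul _ _ c id c Function.bijective_id,
        submatrix_mul _ _ c id id Function.bijective_id, transpose_submatrix, submatrix_id_id]
    calc Vᵀ * diagonal μ * V
        = W * ((U.submatrix id c)ᵀ * diagonal μ * U.submatrix id c) * Wᵀ := by
          simp only [V, transpose_mul, transpose_transpose, Matrix.mul_assoc]
      _ = (W * Wᵀ) * diagonal e * (W * Wᵀ) := by rw [h1]; simp only [Matrix.mul_assoc]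
      _ = diagonal e := by rw [hW', Matrix.mul_one, Matrix.one_mul]
  have hV2 : ∀ a b, ∑ j, V j a * V j b = (1 : Matrix (Fin 3) (Fin 3) ℝ) a b := fun a b => by
    rw [← hV]; rfl
  have hVe2 : ∀ a b, ∑ j, μ j * (V j a * V j b) = diagonal e a b := fun a b => by
    rw [← hVe, mul_apply]
    refine Finset.sum_congr rfl fun j _ => ?_
    rw [mul_diagonal, transpose_apply]; ring
  have hlast : ∀ j, μ ⟨n + 2, by omega⟩ ≤ μ j := fun j => hμ (Fin.le_def.2 (by simp; omega))
  refine ⟨?_, ?_, ?_⟩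
  · have h1 := hVe2 0 0
    have h2 := hV2 0 0
    rw [diagonal_apply_eq] at h1
    rw [one_apply_eq] at h2
    rw [← h1, ← mul_one (μ 0), ← h2, Finset.mul_sum]
    exact Finset.sum_le_sum fun j _ =>
      mul_le_mul_of_nonneg_right (hμ (Fin.zero_le j)) (mul_self_nonneg _)
  · obtain ⟨s, t, hst, h0⟩ : ∃ s t : ℝ, 0 < s ^ 2 + t ^ 2 ∧
        s * V ⟨n + 2, by omega⟩ 1 + t * V ⟨n + 2, by omega⟩ 2 = 0 := by
      by_cases h : V ⟨n + 2, by omega⟩ 1 = 0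
      · exact ⟨1, 0, by norm_num, by rw [h]; ring⟩
      · refine ⟨-V ⟨n + 2, by omega⟩ 2, V ⟨n + 2, by omega⟩ 1, ?_, by ring⟩
        have := pow_pos (abs_pos.2 h) 2
        rw [sq_abs] at this
        linarith [sq_nonneg (-V ⟨n + 2, by omega⟩ 2)]
    have hN : ∑ j, (s * V j 1 + t * V j 2) ^ 2 = s ^ 2 + t ^ 2 := by
      calc _ = s ^ 2 * (∑ j, V j 1 * V j 1) + 2 * s * t * (∑ j, V j 1 * V j 2)
            + t ^ 2 * ∑ j, V j 2 * V j 2 := by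
            simp only [Finset.mul_sum, ← Finset.sum_add_distrib]
            exact Finset.sum_congr rfl fun j _ => by ring
        _ = _ := by
          rw [hV2, hV2, hV2, one_apply_eq, one_apply_eq, one_apply_ne (by decide)]; ring
    have hQ : ∑ j, μ j * (s * V j 1 + t * V j 2) ^ 2 = s ^ 2 * e 1 + t ^ 2 * e 2 := by
      calc _ = s ^ 2 * (∑ j, μ j * (V j 1 * V j 1)) + 2 * s * t * (∑ j, μ j * (V j 1 * V j 2))
            + t ^ 2 * ∑ j, μ j * (V j 2 * V j 2) := by
            simp only [Finset.mul_sum, ← Finset.sum_add_distrib]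
            exact Finset.sum_congr rfl fun j _ => by ring
        _ = _ := by
          rw [hVe2, hVe2, hVe2, diagonal_apply_eq, diagonal_apply_eq,
            diagonal_apply_ne _ (by decide)]
          ring
    have hle : μ ⟨n + 1, by omega⟩ * (s ^ 2 + t ^ 2) ≤ s ^ 2 * e 1 + t ^ 2 * e 2 := by
      rw [← hN, ← hQ, Finset.mul_sum]
      refine Finset.sum_le_sum fun j _ => ?_
      by_cases hj : j = ⟨n + 2, by omega⟩
      · rw [hj, h0]; simp
      · refine mul_le_mul_of_nonneg_right (hμ (Fin.le_def.2 ?_)) (sq_nonneg _)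
        have := Fin.val_ne_of_ne hj
        simp only at this ⊢
        omega
    have he21 : e 2 ≤ e 1 := he (by decide)
    refine le_of_mul_le_mul_right (hle.trans ?_) hst
    nlinarith [mul_le_mul_of_nonneg_left he21 (sq_nonneg t)]
  · have h1 := hVe2 2 2
    have h2 := hV2 2 2
    rw [diagonal_apply_eq] at h1
    rw [one_apply_eq] at h2
    rw [← h1, ← mul_one (μ _), ← h2, Finset.mul_sum]
    exact Finset.sum_le_sum fun j _ =>
      mul_le_mul_of_nonneg_right (hlast j) (mul_self_nonneg _)

/-- A symmetric matrix with a vanishing diagonal entry in a nonzero row has eigenvalues of both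
signs. -/
lemma exists_neg_and_pos_of_diag_eq_zero {n : Type*} [Fintype n] [DecidableEq n]
    {M W : Matrix n n ℝ} {e : n → ℝ} (hM : Wᵀ * diagonal e * W = M) {i j : n}
    (hi : M i i = 0) (hij : M i j ≠ 0) : (∃ k, e k < 0) ∧ ∃ k, 0 < e k := by
  have hent : ∀ a b, M a b = ∑ k, e k * (W k a * W k b) := fun a b => by
    rw [← hM, mul_apply]
    refine Finset.sum_congr rfl fun k _ => ?_
    rw [mul_diagonal, transpose_apply]; ring
  have key : ¬ ∀ k, e k * (W k i * W k i) = 0 := fun h => by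
    refine hij ((hent i j).trans (Finset.sum_eq_zero fun k _ => ?_))
    rcases mul_eq_zero.1 (h k) with h | h
    · rw [h, zero_mul]
    · rw [mul_self_eq_zero.1 h, zero_mul, mul_zero]
  rw [hent] at hi
  constructor
  · by_contra! h
    exact key fun k => (Finset.sum_eq_zero_iff_of_nonneg fun k _ =>
      mul_nonneg (h k) (mul_self_nonneg _)).1 hi k (Finset.mem_univ k)
  · by_contra! h
    exact key fun k => (Finset.sum_eq_zero_iff_of_nonpos fun k _ =>
      mul_nonpos_of_nonpos_of_nonneg (h k) (mul_self_nonneg _)).1 hi k (Finset.mem_univ k)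

/-- A tridiagonal matrix with constant row sums `κ` acts as `κ` plus a combination of differences
of consecutive coordinates. -/
lemma tridiagonal_mulVec_apply {D : ℕ} {B : Matrix (Fin (D + 1)) (Fin (D + 1)) ℝ} {κ : ℝ}
    (htri : ∀ i j : Fin (D + 1),
      ((i : ℕ) + 1 < (j : ℕ) ∨ (j : ℕ) + 1 < (i : ℕ)) → B i j = 0)
    (hrow : ∀ i, ∑ j, B i j = κ) (x : Fin (D + 1) → ℝ) (i : Fin (D + 1)) :
    (B *ᵥ x) i = κ * x i + ∑ k : Fin D,
      ((if i = k.castSucc then B k.castSucc k.succ * (x k.succ - x k.castSucc) else 0)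
        - if i = k.succ then B k.succ k.castSucc * (x k.succ - x k.castSucc) else 0) := by
  have hsplit : ∀ j, B i j * (x j - x i) =
      (if (j : ℕ) = i + 1 then B i j * (x j - x i) else 0)
        + if (i : ℕ) = j + 1 then B i j * (x j - x i) else 0 := fun j => by
    by_cases h1 : (j : ℕ) = i + 1
    · rw [if_pos h1, if_neg (by omega), add_zero]
    by_cases h2 : (i : ℕ) = j + 1
    · rw [if_neg h1, if_pos h2, zero_add]
    rw [if_neg h1, if_neg h2, add_zero]
    by_cases h3 : j = i
    · rw [h3, sub_self, mul_zero]
    · have := Fin.val_ne_of_ne h3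
      rw [htri i j (by omega), zero_mul]
  have hdiff : (B *ᵥ x) i = κ * x i + ∑ j, B i j * (x j - x i) := by
    rw [← hrow i, Finset.sum_mul, ← Finset.sum_add_distrib, mulVec, dotProduct]
    exact Finset.sum_congr rfl fun j _ => by ring
  rw [hdiff, Finset.sum_congr rfl fun j _ => hsplit j, Finset.sum_add_distrib,
    Fin.sum_univ_succ, Fin.sum_univ_castSucc (n := D) (fun j : Fin (D + 1) =>
      if (i : ℕ) = j + 1 then B i j * (x j - x i) else 0),
    if_neg (by simp), if_neg (by simp; omega), zero_add, add_zero, ← Finset.sum_add_distrib]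
  congr 1
  refine Finset.sum_congr rfl fun k _ => ?_
  by_cases h1 : i = k.castSucc
  · subst h1
    simp [Fin.ext_iff]
  by_cases h2 : i = k.succ
  · subst h2
    simp [Fin.ext_iff]
    ring
  have h1' := Fin.val_ne_of_ne h1
  have h2' := Fin.val_ne_of_ne h2
  simp only [Fin.val_castSucc, Fin.val_succ] at h1' h2' ⊢
  rw [if_neg h1, if_neg h2, if_neg (by omega), if_neg (by omega)]
  ring

/-- The weighted difference matrix `F` of a tridiagonal matrix `B`, normalized so that
`κ - Fᵀ F` is a diagonal conjugate of `B` when the row sums of `B` are `κ`. -/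
noncomputable def weightedDifference {D : ℕ} (B : Matrix (Fin (D + 1)) (Fin (D + 1)) ℝ) :
    Matrix (Fin D) (Fin (D + 1)) ℝ :=
  of fun k l => (if l = k.succ then √(B k.succ k.castSucc) else 0)
    - if l = k.castSucc then √(B k.castSucc k.succ) else 0

lemma weightedDifference_apply {D : ℕ} (B : Matrix (Fin (D + 1)) (Fin (D + 1)) ℝ)
    (k : Fin D) (l : Fin (D + 1)) :
    weightedDifference B k l = (if l = k.succ then √(B k.succ k.castSucc) else 0)
      - if l = k.castSucc then √(B k.castSucc k.succ) else 0 := rfl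

lemma sum_weightedDifference_mul {D : ℕ} (B : Matrix (Fin (D + 1)) (Fin (D + 1)) ℝ)
    (k : Fin D) (z : Fin (D + 1) → ℝ) :
    ∑ l, weightedDifference B k l * z l =
      √(B k.succ k.castSucc) * z k.succ - √(B k.castSucc k.succ) * z k.castSucc := by
  simp [weightedDifference_apply, sub_mul, Finset.sum_sub_distrib, ite_mul]

lemma weightedDifference_mul_transpose_apply {D : ℕ}
    (B : Matrix (Fin (D + 1)) (Fin (D + 1)) ℝ) (i j : Fin D) :
    (weightedDifference B * (weightedDifference B)ᵀ) i j =
      √(B i.succ i.castSucc) * weightedDifference B j i.succ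
        - √(B i.castSucc i.succ) * weightedDifference B j i.castSucc :=
  sum_weightedDifference_mul B i fun l => weightedDifference B j l

/-- An eigenvalue `θ ≠ κ` of a tridiagonal matrix `B` with positive off-diagonal entries and row
sums `κ` gives the eigenvalue `κ - θ` of `F Fᵀ`. -/
lemma exists_eigenvector_weightedDifference {D : ℕ}
    {B : Matrix (Fin (D + 1)) (Fin (D + 1)) ℝ} {κ : ℝ}
    (htri : ∀ i j : Fin (D + 1),
      ((i : ℕ) + 1 < (j : ℕ) ∨ (j : ℕ) + 1 < (i : ℕ)) → B i j = 0)
    (hsuper : ∀ i : Fin D, 0 < B i.castSucc i.succ)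
    (hsub : ∀ i : Fin D, 0 < B i.succ i.castSucc)
    (hrow : ∀ i, ∑ j, B i j = κ) {θ : ℝ} (hθ : θ ≠ κ) {x : Fin (D + 1) → ℝ} (hx : x ≠ 0)
    (hBx : B *ᵥ x = θ • x) :
    ∃ v : Fin D → ℝ, v ≠ 0 ∧
      (weightedDifference B * (weightedDifference B)ᵀ) *ᵥ v = (κ - θ) • v := by
  let F := weightedDifference B
  obtain ⟨d, hd, hdk⟩ : ∃ d : Fin (D + 1) → ℝ, (∀ i, 0 < d i) ∧ ∀ k : Fin D,
      √(B k.succ k.castSucc) * d k.succ = √(B k.castSucc k.succ) * d k.castSucc := by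
    let d : Fin (D + 1) → ℝ := fun i => Fin.induction (motive := fun _ => ℝ) 1
      (fun k r => √(B k.castSucc k.succ) / √(B k.succ k.castSucc) * r) i
    have hds : ∀ k : Fin D,
        d k.succ = √(B k.castSucc k.succ) / √(B k.succ k.castSucc) * d k.castSucc :=
      fun k => Fin.induction_succ _ _ _
    refine ⟨d, fun i => ?_, fun k => ?_⟩
    · induction i using Fin.induction with
      | zero => exact one_pos
      | succ k ih =>
        rw [hds]
        exact mul_pos (div_pos (Real.sqrt_pos.2 (hsuper k)) (Real.sqrt_pos.2 (hsub k))) ih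
    · have := Real.sqrt_pos.2 (hsub k)
      rw [hds]
      field_simp
  let z : Fin (D + 1) → ℝ := fun i => d i * x i
  have hz : z ≠ 0 := fun h => hx (funext fun i =>
    (mul_eq_zero.1 (congrFun h i)).resolve_left (hd i).ne')
  have hFz : ∀ k, (F *ᵥ z) k =
      √(B k.castSucc k.succ) * d k.castSucc * (x k.succ - x k.castSucc) := fun k => by
    rw [mul_sub, ← hdk k, mul_assoc, hdk k, mul_assoc]
    exact sum_weightedDifference_mul B k z
  have hFFz : Fᵀ *ᵥ (F *ᵥ z) = (κ - θ) • z := by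
    ext i
    have h1 := tridiagonal_mulVec_apply htri hrow x i
    rw [hBx, Pi.smul_apply, smul_eq_mul] at h1
    have h2 : (Fᵀ *ᵥ (F *ᵥ z)) i = -(d i * ∑ k : Fin D,
        ((if i = k.castSucc then B k.castSucc k.succ * (x k.succ - x k.castSucc) else 0)
        - if i = k.succ then B k.succ k.castSucc * (x k.succ - x k.castSucc) else 0)) := by
      rw [Finset.mul_sum, ← Finset.sum_neg_distrib, mulVec, dotProduct]
      refine Finset.sum_congr rfl fun k _ => ?_
      rw [hFz, transpose_apply, show F k i = _ from weightedDifference_apply B k i]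
      have hb := Real.mul_self_sqrt (hsuper k).le
      have hg := Real.mul_self_sqrt (hsub k).le
      by_cases h1 : i = k.castSucc
      · subst h1
        rw [if_pos rfl, if_pos rfl, if_neg Fin.castSucc_lt_succ.ne,
          if_neg Fin.castSucc_lt_succ.ne]
        nth_rewrite 3 [← hb]
        ring
      by_cases h2 : i = k.succ
      · subst h2
        rw [if_pos rfl, if_pos rfl, if_neg h1, if_neg h1, ← hdk k]
        nth_rewrite 3 [← hg]
        ring
      rw [if_neg h1, if_neg h1, if_neg h2, if_neg h2]
      ring
    rw [h2, Pi.smul_apply, smul_eq_mul]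
    change _ = (κ - θ) * (d i * x i)
    linear_combination d i * h1
  refine ⟨F *ᵥ z, fun h => ?_, ?_⟩
  · rw [h, mulVec_zero] at hFFz
    exact (smul_ne_zero (sub_ne_zero.2 hθ.symm) hz) hFFz.symm
  · rw [← mulVec_mulVec, hFFz, mulVec_smul]

lemma exists_mulVec_eq_smul_of_isRoot_charpoly {n : Type*} [Fintype n] [DecidableEq n]
    {B : Matrix n n ℝ} {θ : ℝ} (h : B.charpoly.IsRoot θ) :
    ∃ x : n → ℝ, x ≠ 0 ∧ B *ᵥ x = θ • x := by
  rw [IsRoot, eval_charpoly] at h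
  obtain ⟨x, hx, h0⟩ := exists_mulVec_eq_zero_iff.2 h
  refine ⟨x, hx, ?_⟩
  rw [sub_mulVec, sub_eq_zero] at h0
  rw [← h0]
  simp [scalar_apply, ← smul_one_eq_diagonal, smul_mulVec]

end Matrix

open Matrix in
theorem stmt_7 (D : ℕ) (hD : 3 ≤ D) (B : Matrix (Fin (D+1)) (Fin (D+1)) ℝ) (κ : ℝ)
    (hnonneg : ∀ i j, 0 ≤ B i j)
    (htri : ∀ i j : Fin (D+1), ((i : ℕ) + 1 < (j : ℕ) ∨ (j : ℕ) + 1 < (i : ℕ)) → B i j = 0)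
    (hsuper : ∀ i : Fin D, 0 < B i.castSucc i.succ)
    (hsub : ∀ i : Fin D, 0 < B i.succ i.castSucc)
    (hα0 : B 0 0 = 0)
    (hγ1 : B 1 0 = 1)
    (hrow : ∀ i, ∑ j, B i j = κ)
    (θ : Fin (D+1) → ℝ) (hθ : StrictAnti θ) (hθ0 : θ 0 = κ)
    (hchar : B.charpoly = ∏ i, (X - C (θ i)))
    (hcond : κ + 1 ≤ B 2 3 + B 3 2) :
    (θ 1 + 1) * (θ ⟨D - 1, by omega⟩ + 1) * (θ (Fin.last D) + 1) ≥
      - B 1 2 * (κ + 1 - B 2 3 - B 3 2) := by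
  obtain ⟨n, rfl⟩ : ∃ n, D = n + 3 := ⟨D - 3, by omega⟩
  let F := weightedDifference B
  let S : Matrix (Fin (n + 3)) (Fin (n + 3)) ℝ := (κ + 1) • 1 - F * Fᵀ
  let μ : Fin (n + 3) → ℝ := fun k => θ k.succ + 1
  have hμ : StrictAnti μ := fun i j hij => by
    have := hθ (Fin.succ_lt_succ_iff.2 hij)
    simp only [μ]; linarith
  have hS : S.IsSymm := by
    simp [S, IsSymm, transpose_sub, transpose_mul]
  have hSμ : ∀ k, ∃ v : Fin (n + 3) → ℝ, v ≠ 0 ∧ S *ᵥ v = μ k • v := fun k => by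
    have hroot : B.charpoly.IsRoot (θ k.succ) := by
      rw [hchar, IsRoot, eval_prod]
      exact Finset.prod_eq_zero (Finset.mem_univ k.succ) (by simp)
    obtain ⟨x, hx, hBx⟩ := exists_mulVec_eq_smul_of_isRoot_charpoly hroot
    have hne : θ k.succ ≠ κ := hθ0 ▸ (hθ (Fin.succ_pos k)).ne
    obtain ⟨v, hv, hFv⟩ :=
      exists_eigenvector_weightedDifference htri hsuper hsub hrow hne hx hBx
    refine ⟨v, hv, ?_⟩
    rw [sub_mulVec, hFv, smul_mulVec, one_mulVec, ← sub_smul]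
    congr 1
    simp only [μ]; ring
  obtain ⟨U, hU, hUS⟩ := hS.exists_orthogonal_diagonalization hμ.injective hSμ
  let c : Fin 3 → Fin (n + 3) := Fin.castLE (by omega)
  have hc : Function.Injective c := Fin.castLE_injective _
  obtain ⟨e, W, he, hW, hWS⟩ := (hS.submatrix c).exists_antitone_diagonalization
  obtain ⟨h0, h1, h2⟩ := interlacing_fin_three hμ.antitone hU hUS hc he hW hWS
  have hβ0 : B 0 1 = κ := by
    have h := hrow 0
    rw [Fin.sum_univ_succ, Fin.sum_univ_succ, hα0, zero_add,
      Finset.sum_eq_zero fun j _ => htri _ _ (Or.inl (by simp)), add_zero] at h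
    exact h
  have hSc : ∀ i j, S (c i) (c j) = (κ + 1) * (1 : Matrix (Fin 3) (Fin 3) ℝ) i j
      - (√(B (c i).succ (c i).castSucc) * F (c j) (c i).succ
        - √(B (c i).castSucc (c i).succ) * F (c j) (c i).castSucc) := fun i j => by
    rw [← submatrix_one c hc]
    change (κ + 1) * _ - (F * Fᵀ) (c i) (c j) = _
    rw [weightedDifference_mul_transpose_apply]
    rfl
  have hFc : ∀ i : Fin 3, ∀ l : Fin (n + 4), F (c i) l =
      (if (l : ℕ) = i + 1 then √(B (c i).succ (c i).castSucc) else 0)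
        - if (l : ℕ) = i then √(B (c i).castSucc (c i).succ) else 0 := fun i l => by
    simp [F, weightedDifference_apply, Fin.ext_iff, c]
  have hdiag : ∀ i, S (c i) (c i) =
      κ + 1 - B (c i).castSucc (c i).succ - B (c i).succ (c i).castSucc := fun i => by
    rw [hSc, hFc, hFc]
    simp [c, Real.mul_self_sqrt (hnonneg _ _)]
    ring
  have h01 : (c 0).castSucc = 0 := rfl
  have h11 : (c 0).succ = 1 := rfl
  have h12 : (c 1).castSucc = 1 := rfl
  have h22 : (c 1).succ = 2 :=
    Fin.ext (Nat.mod_eq_of_lt (by omega)).symm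
  have h23 : (c 2).castSucc = 2 :=
    Fin.ext (Nat.mod_eq_of_lt (by omega)).symm
  have h33 : (c 2).succ = 3 :=
    Fin.ext (Nat.mod_eq_of_lt (by omega)).symm
  have hS00 : S (c 0) (c 0) = 0 := by
    rw [hdiag, h01, h11, hβ0, hγ1]
    ring
  have hS22 : S (c 2) (c 2) = κ + 1 - B 2 3 - B 3 2 := by
    rw [hdiag, h23, h33]
  have hS02 : S (c 0) (c 2) = 0 := by
    rw [hSc, hFc, hFc]
    simp [c]
  have hS01 : S (c 0) (c 1) = √(B 1 2) := by
    rw [hSc, hFc, hFc, h01, h11, h12, h22, hγ1]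
    simp
  have hβ1 : 0 < B 1 2 := hsuper ⟨1, by omega⟩
  have hdet : e 0 * e 1 * e 2 = - B 1 2 * (κ + 1 - B 2 3 - B 3 2) := by
    have h3 : (S.submatrix c c).det = e 0 * e 1 * e 2 := by
      rw [← hWS, det_mul, det_mul, mul_right_comm, ← det_mul, hW, det_one, det_diagonal,
        Fin.prod_univ_three, one_mul]
    have hs := Real.mul_self_sqrt hβ1.le
    rw [← h3, det_fin_three]
    simp only [submatrix_apply, hS.apply (c 0) (c 1), hS.apply (c 0) (c 2), hS00, hS01, hS02, hS22]
    linear_combination (-(κ + 1 - B 2 3 - B 3 2)) * hs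
  obtain ⟨⟨k, hk⟩, l, hl⟩ := exists_neg_and_pos_of_diag_eq_zero hWS (i := 0) (j := 1) hS00
    (by rw [submatrix_apply, hS01]; exact (Real.sqrt_pos.2 hβ1).ne')
  have he0 : 0 < e 0 := hl.trans_le (he (Fin.zero_le l))
  have he2 : e 2 < 0 := (he (Fin.le_last k)).trans_lt hk
  have he012 : 0 ≤ e 0 * e 1 * e 2 := by
    rw [hdet]
    nlinarith
  have he1 : e 1 ≤ 0 := by
    by_contra! h
    exact absurd he012 (not_le.2 (mul_neg_of_pos_of_neg (mul_pos he0 h) he2))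
  change μ 0 * μ ⟨n + 1, by omega⟩ * μ ⟨n + 2, by omega⟩ ≥ _
  rw [← hdet, ge_iff_le, mul_assoc, mul_assoc]
  have h_le : e 1 * e 2 ≤ μ ⟨n + 1, by omega⟩ * μ ⟨n + 2, by omega⟩ := by
    rw [← neg_mul_neg (e 1), ← neg_mul_neg (μ _)]
    exact mul_le_mul (neg_le_neg h1) (neg_le_neg h2) (by linarith) (by linarith)
  exact mul_le_mul h0 h_le (mul_nonneg_of_nonpos_of_nonpos he1 he2.le) (he0.le.trans h0)
end

section
/- Let B be a (D+1)×(D+1) tridiagonal matrix as above with D ≥ 3 and eigenvalues κ > θ₁ > ⋯ > θ_D. If β₂ + γ₃ ≤ κ + 1, then (θ₁+1)(θ₂+1)(θ_D+1) ≤ −β₁(κ + 1 − β₂ − γ₃). -/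
open Polynomial

/-- The characteristic polynomial of a `3 × 3` tridiagonal matrix with diagonal `0, a₂, a₃`,
`0 ≤ a₃`, and positive products `b₁, b₂` of opposite off-diagonal entries splits over `ℝ`,
with one negative, one nonnegative and one positive root. -/
theorem exists_roots_tridiagonal_three {a₂ a₃ b₁ b₂ : ℝ} (ha₃ : 0 ≤ a₃) (hb₁ : 0 < b₁)
    (hb₂ : 0 < b₂) :
    ∃ x y z : ℝ, x < 0 ∧ 0 ≤ y ∧ y ≤ z ∧ 0 < z ∧
      ∀ t, (t - a₃) * ((t - a₂) * t - b₁) - b₂ * t = (t - x) * (t - y) * (t - z) := by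
  obtain ⟨y, ⟨hy0, hya⟩, hy⟩ : ∃ y ∈ Set.Icc 0 a₃,
      (y - a₃) * ((y - a₂) * y - b₁) - b₂ * y = 0 := by
    have h := intermediate_value_Icc' (f := fun t : ℝ =>
      (t - a₃) * ((t - a₂) * t - b₁) - b₂ * t) ha₃ (by fun_prop)
    refine h ⟨?_, ?_⟩
    · simp only [sub_self]; nlinarith
    · simp only [zero_sub, mul_zero]; nlinarith
  obtain ⟨s, hs⟩ : ∃ s, s = y - a₂ - a₃ := ⟨_, rfl⟩
  obtain ⟨p, hp⟩ : ∃ p, p = y ^ 2 - (a₂ + a₃) * y + (a₂ * a₃ - b₁ - b₂) := ⟨_, rfl⟩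
  have hfac : ∀ t, (t - a₃) * ((t - a₂) * t - b₁) - b₂ * t
      = (t - y) * (t ^ 2 + s * t + p) := fun t => by
    rw [hs, hp]; linear_combination hy
  have hp0 : p < 0 := by
    rcases hy0.eq_or_lt with h | h
    · subst h
      have : a₃ * b₁ = 0 := by linear_combination hy
      have h3 : a₃ = 0 := by
        rcases mul_eq_zero.1 this with h | h
        · exact h
        · exact absurd h hb₁.ne'
      subst h3
      rw [hp]; linarith
    · have h0 := hfac 0
      have : y * p = - (a₃ * b₁) := by linear_combination h0
      have : 0 < a₃ * b₁ := mul_pos (h.trans_le hya) hb₁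
      by_contra hcon
      have := mul_nonneg hy0 (not_lt.1 hcon)
      linarith
  have hdisc : 0 ≤ s ^ 2 - 4 * p := by nlinarith [sq_nonneg s]
  set d := √(s ^ 2 - 4 * p)
  have hd : d ^ 2 = s ^ 2 - 4 * p := Real.sq_sqrt hdisc
  have hd0 : 0 ≤ d := Real.sqrt_nonneg _
  have hsd : |s| < d := abs_lt.2 (abs_lt_of_sq_lt_sq' (by linarith) hd0)
  obtain ⟨hsd1, hsd2⟩ := abs_lt.1 hsd
  have hfac' : ∀ t, (t - a₃) * ((t - a₂) * t - b₁) - b₂ * t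
      = (t - (-s - d) / 2) * (t - y) * (t - (-s + d) / 2) := fun t => by
    rw [hfac]; linear_combination (t - y) / 4 * hd
  refine ⟨(-s - d) / 2, y, (-s + d) / 2, by linarith, hy0, ?_, by linarith, hfac'⟩
  by_contra! hz
  have h3 := hfac' a₃
  have hx : 0 < a₃ - (-s - d) / 2 := by linarith
  have h1 := mul_nonneg (mul_nonneg hx.le (sub_nonneg.2 hya))
    (by linarith : 0 ≤ a₃ - (-s + d) / 2)
  have : 0 < b₂ * a₃ := mul_pos hb₂ (by linarith)
  linarith

/-- Interlacing for the zeros `z ≥ y ≥ x` of a cubic that is orthogonal to all polynomials of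
degree at most two for the discrete measure with masses `c i * (φ 0 - φ i)` at `φ i`. -/
theorem interlacing_of_orthogonal {n : ℕ} {φ c : Fin (n + 3 + 1) → ℝ} (hφ : StrictAnti φ)
    (hc : ∀ i, 0 < c i) {x y z : ℝ} (hyz : y ≤ z)
    (horth : ∀ e f g : ℝ, ∑ i, c i * ((φ 0 - φ i) * ((φ i - x) * (φ i - y) * (φ i - z))) *
      (e * φ i ^ 2 + f * φ i + g) = 0) :
    z ≤ φ 1 ∧ y ≤ φ 2 ∧ φ (Fin.last (n + 3)) ≤ x := by
  have val0 : ((0 : Fin (n + 3 + 1)) : ℕ) = 0 := by simp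
  have val1 : ((1 : Fin (n + 3 + 1)) : ℕ) = 1 := by simp
  have val2 : ((2 : Fin (n + 3 + 1)) : ℕ) = 2 := by simp [Nat.mod_eq_of_lt]
  have val3 : ((3 : Fin (n + 3 + 1)) : ℕ) = 3 := by simp [Nat.mod_eq_of_lt]
  have h12 : φ 2 < φ 1 := hφ (by rw [Fin.lt_def]; omega)
  have h23 : φ 3 < φ 2 := hφ (by rw [Fin.lt_def]; omega)
  have h01 : φ 1 < φ 0 := hφ (by rw [Fin.lt_def]; omega)
  have hpos : ∀ i, 0 ≤ c i * (φ 0 - φ i) := fun i =>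
    mul_nonneg (hc i).le (sub_nonneg.2 (hφ.antitone (Fin.zero_le i)))
  have hvanish : ∀ (e f g : ℝ), (∀ i, i ≠ 0 →
      0 ≤ (φ i - x) * (φ i - y) * (φ i - z) * (e * φ i ^ 2 + f * φ i + g)) →
      ∀ i, φ i < φ 0 → (φ i - x) * (φ i - y) * (φ i - z) * (e * φ i ^ 2 + f * φ i + g) = 0 := by
    intro e f g hnn i hi
    have h := horth e f g
    rw [Finset.sum_eq_zero_iff_of_nonneg] at h
    · have := h i (Finset.mem_univ i)
      have hne : c i * (φ 0 - φ i) ≠ 0 := (mul_pos (hc i) (sub_pos.2 hi)).ne'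
      refine (mul_eq_zero.1 (?_ : c i * (φ 0 - φ i) * _ = 0)).resolve_left hne
      linear_combination this
    · intro j _
      rcases eq_or_ne j 0 with rfl | hj
      · simp
      · have := mul_nonneg (hpos j) (hnn j hj)
        linarith
  have hle1 : ∀ i, i ≠ 0 → φ i ≤ φ 1 := fun i hi => hφ.antitone (by
    rw [Fin.le_def]; have := Fin.val_ne_of_ne hi; omega)
  have hz : z ≤ φ 1 := by
    by_contra! hlt
    have key := hvanish (-1) (x + y) (-(x * y)) (fun i hi => by
      have h1 := hle1 i hi
      have := mul_nonneg (sq_nonneg ((φ i - x) * (φ i - y))) (by linarith : 0 ≤ z - φ i)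
      linarith)
    have key' : ∀ i, φ i < φ 0 → φ i ≤ φ 1 → φ i = x ∨ φ i = y := fun i h0 h1 => by
      have h : ((φ i - x) * (φ i - y)) ^ 2 * (z - φ i) = 0 := by
        linear_combination key i h0
      rcases mul_eq_zero.1 h with h | h
      · rcases mul_eq_zero.1 (pow_eq_zero_iff two_ne_zero |>.1 h) with h | h
        · exact Or.inl (by linarith)
        · exact Or.inr (by linarith)
      · linarith
    rcases key' 1 h01 le_rfl with h | h <;> rcases key' 2 (by linarith) (by linarith) with h' | h' <;>
      rcases key' 3 (by linarith) (by linarith) with h'' | h'' <;> linarith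
  refine ⟨hz, ?_, ?_⟩
  · by_contra! hlt
    have hle2 : ∀ i, i ≠ 0 → i ≠ 1 → φ i ≤ φ 2 := fun i hi hi' => hφ.antitone (by
      rw [Fin.le_def]
      have h0 := Fin.val_ne_of_ne hi
      have h1 := Fin.val_ne_of_ne hi'
      omega)
    have key := hvanish 0 1 (-x) (fun i hi => by
      have : 0 ≤ (φ i - y) * (φ i - z) := by
        rcases eq_or_ne i 1 with rfl | hi'
        · exact mul_nonneg (by linarith) (by linarith)
        · have := hle2 i hi hi'
          exact mul_nonneg_of_nonpos_of_nonpos (by linarith) (by linarith)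
      have := mul_nonneg (sq_nonneg (φ i - x)) this
      linarith)
    have key' : ∀ i, φ i ≤ φ 2 → φ i = x := fun i h2 => by
      have h : (φ i - x) ^ 2 * ((φ i - y) * (φ i - z)) = 0 := by
        linear_combination key i (by linarith)
      rcases mul_eq_zero.1 h with h | h
      · linarith [pow_eq_zero_iff two_ne_zero |>.1 h]
      · rcases mul_eq_zero.1 h with h | h <;> linarith
    linarith [key' 2 le_rfl, key' 3 h23.le]
  · by_contra! hlt
    have hlast : ∀ i, φ (Fin.last (n + 3)) ≤ φ i := fun i => hφ.antitone (Fin.le_last i)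
    have key := hvanish 1 (-(y + z)) (y * z) (fun i hi => by
      have := mul_nonneg (sq_nonneg ((φ i - y) * (φ i - z)))
        (by linarith [hlast i] : 0 ≤ φ i - x)
      linarith)
    have key' : ∀ i, φ i < φ 0 → φ i = y ∨ φ i = z := fun i h0 => by
      have h : ((φ i - y) * (φ i - z)) ^ 2 * (φ i - x) = 0 := by
        linear_combination key i h0
      rcases mul_eq_zero.1 h with h | h
      · rcases mul_eq_zero.1 (pow_eq_zero_iff two_ne_zero |>.1 h) with h | h
        · exact Or.inl (by linarith)
        · exact Or.inr (by linarith)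
      · linarith [hlast i]
    rcases key' 1 h01 with h | h <;> rcases key' 2 (by linarith) with h' | h' <;>
      rcases key' 3 (by linarith) with h'' | h'' <;> linarith

section Tridiagonal

variable {D : ℕ} {B : Matrix (Fin (D + 1)) (Fin (D + 1)) ℝ}

/-- A tridiagonal matrix with positive off-diagonal entries is symmetrizable. -/
theorem exists_symmetrizer_of_tridiagonal
    (htri : ∀ i j : Fin (D + 1), ((i : ℕ) + 1 < (j : ℕ) ∨ (j : ℕ) + 1 < (i : ℕ)) → B i j = 0)
    (hsuper : ∀ i : Fin D, 0 < B i.castSucc i.succ)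
    (hsub : ∀ i : Fin D, 0 < B i.succ i.castSucc) :
    ∃ k : Fin (D + 1) → ℝ, (∀ i, 0 < k i) ∧ ∀ i j, k i * B i j = k j * B j i := by
  let k : Fin (D + 1) → ℝ := fun i => Fin.induction (motive := fun _ => ℝ) 1
    (fun i r => r * B i.castSucc i.succ / B i.succ i.castSucc) i
  have hk : ∀ i : Fin D, k i.succ = k i.castSucc * B i.castSucc i.succ / B i.succ i.castSucc :=
    fun i => Fin.induction_succ _ _ _
  have hstep : ∀ i j : Fin (D + 1), (i : ℕ) + 1 = j → k i * B i j = k j * B j i := by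
    intro i j hij
    have hi : (i : ℕ) < D := by omega
    obtain ⟨m, rfl⟩ : ∃ m : Fin D, m.castSucc = i := ⟨⟨i, hi⟩, rfl⟩
    obtain rfl : j = m.succ := Fin.ext hij.symm
    rw [hk]
    exact (div_mul_cancel₀ _ (hsub _).ne').symm
  refine ⟨k, fun i => ?_, fun i j => ?_⟩
  · induction i using Fin.induction with
    | zero => exact one_pos
    | succ i ih => rw [hk]; exact div_pos (mul_pos ih (hsuper i)) (hsub i)
  · rcases lt_trichotomy (i : ℕ) j with h | h | h
    · rcases Nat.lt_or_ge ((i : ℕ) + 1) j with h' | h'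
      · rw [htri i j (Or.inl h'), htri j i (Or.inr h'), mul_zero, mul_zero]
      · exact hstep i j (by omega)
    · rw [Fin.ext h]
    · rcases Nat.lt_or_ge ((j : ℕ) + 1) i with h' | h'
      · rw [htri i j (Or.inr h'), htri j i (Or.inl h'), mul_zero, mul_zero]
      · exact (hstep j i (by omega)).symm

/-- An eigenvector of a tridiagonal matrix with nonzero superdiagonal does not vanish at `0`. -/
theorem eigenvector_zero_ne_zero_of_tridiagonal
    (htri : ∀ i j : Fin (D + 1), (i : ℕ) + 1 < (j : ℕ) → B i j = 0)
    (hsuper : ∀ i : Fin D, B i.castSucc i.succ ≠ 0) {t : ℝ} {v : Fin (D + 1) → ℝ}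
    (hv : v ≠ 0) (hBv : B.mulVec v = t • v) : v 0 ≠ 0 := by
  intro h0
  apply hv
  have h : ∀ m : ℕ, ∀ j : Fin (D + 1), (j : ℕ) ≤ m → v j = 0 := by
    intro m
    induction m with
    | zero =>
      intro j hj
      rwa [show j = 0 from Fin.ext (by simpa using hj)]
    | succ m ih =>
      intro j hj
      rcases Nat.lt_or_ge m j with hm | hm
      · have hmD : m < D := by omega
        obtain rfl : j = Fin.succ ⟨m, hmD⟩ := Fin.ext (by simp; omega)
        have hrow := congrFun hBv (Fin.castSucc ⟨m, hmD⟩)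
        rw [Pi.smul_apply, ih (Fin.castSucc ⟨m, hmD⟩) (by simp), smul_zero, Matrix.mulVec,
          dotProduct, Finset.sum_eq_single (Fin.succ ⟨m, hmD⟩)] at hrow
        · exact (mul_eq_zero.1 hrow).resolve_left (hsuper _)
        · intro l _ hl
          rcases Nat.lt_or_ge m l with hl' | hl'
          · have := Fin.val_ne_of_ne hl
            rw [htri _ _ (by simp at this ⊢; omega), zero_mul]
          · rw [ih l hl', mul_zero]
        · simp
      · exact ih j hm
  exact funext fun j => h j j le_rfl

/-- A tridiagonal matrix with positive off-diagonal entries and distinct real eigenvalues `θ i`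
has eigenvectors `v i` normalized at `0`, and the first unit vector is a combination of
them with positive coefficients. -/
theorem exists_eigenvectors_of_tridiagonal
    (htri : ∀ i j : Fin (D + 1), ((i : ℕ) + 1 < (j : ℕ) ∨ (j : ℕ) + 1 < (i : ℕ)) → B i j = 0)
    (hsuper : ∀ i : Fin D, 0 < B i.castSucc i.succ)
    (hsub : ∀ i : Fin D, 0 < B i.succ i.castSucc)
    {θ : Fin (D + 1) → ℝ} (hθ : Function.Injective θ)
    (hchar : B.charpoly = ∏ i, (X - C (θ i))) :
    ∃ (v : Fin (D + 1) → Fin (D + 1) → ℝ) (c : Fin (D + 1) → ℝ),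
      (∀ i, v i 0 = 1) ∧ (∀ i, B.mulVec (v i) = θ i • v i) ∧ (∀ i, 0 < c i) ∧
      ∑ i, c i • v i = Pi.single 0 1 := by
  have hex : ∀ i, ∃ v : Fin (D + 1) → ℝ, v 0 = 1 ∧ B.mulVec v = θ i • v := by
    intro i
    have hdet : (Matrix.scalar (Fin (D + 1)) (θ i) - B).det = 0 := by
      rw [← Matrix.eval_charpoly, hchar, eval_prod]
      exact Finset.prod_eq_zero (Finset.mem_univ i) (by simp)
    obtain ⟨v, hv, hv'⟩ := Matrix.exists_mulVec_eq_zero_iff.2 hdet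
    have hBv : B.mulVec v = θ i • v := by
      rw [Matrix.sub_mulVec, sub_eq_zero] at hv'
      rw [← hv']
      ext j
      simp [Matrix.scalar_apply, Matrix.mulVec_diagonal]
    have h0 := eigenvector_zero_ne_zero_of_tridiagonal (fun i j h => htri i j (Or.inl h))
      (fun i => (hsuper i).ne') hv hBv
    refine ⟨(v 0)⁻¹ • v, by simp [h0], ?_⟩
    rw [Matrix.mulVec_smul, hBv, smul_comm]
  choose v hv0 hBv using hex
  obtain ⟨k, hk, hsymm⟩ := exists_symmetrizer_of_tridiagonal htri hsuper hsub
  have hvne : ∀ i, v i ≠ 0 := fun i h => by simpa [h] using hv0 i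
  have horth : ∀ i l, i ≠ l → ∑ a, k a * v i a * v l a = 0 := by
    intro i l hil
    have h1 : ∀ i l, θ i * ∑ a, k a * v i a * v l a
        = ∑ a, ∑ b, k a * B a b * v i b * v l a := by
      intro i l
      rw [Finset.mul_sum]
      refine Finset.sum_congr rfl fun a _ => ?_
      have h := congrFun (hBv i) a
      simp only [Matrix.mulVec, dotProduct, Pi.smul_apply, smul_eq_mul] at h
      calc θ i * (k a * v i a * v l a) = k a * v l a * (θ i * v i a) := by ring
        _ = _ := by
          rw [← h, Finset.mul_sum]
          exact Finset.sum_congr rfl fun b _ => by ring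
    have h2 : θ i * ∑ a, k a * v i a * v l a = θ l * ∑ a, k a * v i a * v l a := by
      rw [h1 i l, show ∑ a, k a * v i a * v l a = ∑ a, k a * v l a * v i a from
        Finset.sum_congr rfl fun a _ => by ring, h1 l i, Finset.sum_comm]
      refine Finset.sum_congr rfl fun a _ => Finset.sum_congr rfl fun b _ => ?_
      rw [hsymm b a]; ring
    exact (mul_eq_mul_right_iff.1 h2).resolve_left (hθ.ne hil)
  have hli : LinearIndependent ℝ v :=
    Module.End.eigenvectors_linearIndependent' (Matrix.toLin' B) θ hθ v fun i =>
      Module.End.hasEigenvector_iff.2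
        ⟨Module.End.mem_eigenspace_iff.2 (by rw [Matrix.toLin'_apply, hBv]), hvne i⟩
  obtain ⟨c, hc⟩ : ∃ c : Fin (D + 1) → ℝ, ∑ i, c i • v i = Pi.single 0 1 := by
    have hspan := hli.span_eq_top_of_card_eq_finrank' (by simp)
    have hmem : (Pi.single 0 1 : Fin (D + 1) → ℝ) ∈ Submodule.span ℝ (Set.range v) := by
      rw [hspan]; trivial
    exact (Submodule.mem_span_range_iff_exists_fun ℝ).1 hmem
  refine ⟨v, c, hv0, hBv, fun i => ?_, hc⟩
  have hpair : k 0 = c i * ∑ a, k a * v i a * v i a := by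
    have h : ∑ a, k a * (∑ l, c l • v l) a * v i a = k 0 := by
      rw [hc, Finset.sum_eq_single 0]
      · simp [hv0]
      · intro a _ ha; simp [ha]
      · simp
    rw [← h]
    calc ∑ a, k a * (∑ l, c l • v l) a * v i a
        = ∑ a, ∑ l, c l * (k a * v l a * v i a) := by
          refine Finset.sum_congr rfl fun a _ => ?_
          rw [Finset.sum_apply, Finset.mul_sum, Finset.sum_mul]
          refine Finset.sum_congr rfl fun l _ => ?_
          simp only [Pi.smul_apply, smul_eq_mul]; ring
      _ = ∑ l, c l * ∑ a, k a * v l a * v i a := by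
          rw [Finset.sum_comm]
          exact Finset.sum_congr rfl fun l _ => (Finset.mul_sum _ _ _).symm
      _ = _ := by
          rw [Finset.sum_eq_single i]
          · intro l _ hl; rw [horth l i hl, mul_zero]
          · simp
  have hnorm : 0 ≤ ∑ a, k a * v i a * v i a := Finset.sum_nonneg fun a _ => by
    rw [mul_assoc]; exact mul_nonneg (hk a).le (mul_self_nonneg _)
  by_contra! hci
  linarith [hk 0, mul_nonpos_of_nonpos_of_nonneg hci hnorm]

end Tridiagonal

/-- The moments `∑ i, c i * θ i ^ p * v i j` of the spectral measure of the first unit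
vector vanish when the row `j` is not reachable from `0` in `p` steps. -/
theorem sum_pow_eigenvalue_eq_zero_of_lt {D : ℕ} {B : Matrix (Fin (D + 1)) (Fin (D + 1)) ℝ}
    (htri : ∀ i j : Fin (D + 1), (j : ℕ) + 1 < (i : ℕ) → B i j = 0)
    {v : Fin (D + 1) → Fin (D + 1) → ℝ} {θ c : Fin (D + 1) → ℝ}
    (hBv : ∀ i, B.mulVec (v i) = θ i • v i) (hc : ∑ i, c i • v i = Pi.single 0 1)
    (p : ℕ) (j : Fin (D + 1)) (hj : p < (j : ℕ)) : ∑ i, c i * θ i ^ p * v i j = 0 := by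
  induction p generalizing j with
  | zero =>
    have h := congrFun hc j
    rw [Pi.single_eq_of_ne (fun h => by simp [h] at hj), Finset.sum_apply] at h
    simpa using h
  | succ p ih =>
    have h : ∀ i, c i * θ i ^ (p + 1) * v i j = ∑ l, B j l * (c i * θ i ^ p * v i l) := by
      intro i
      have h := congrFun (hBv i) j
      simp only [Matrix.mulVec, dotProduct, Pi.smul_apply, smul_eq_mul] at h
      calc c i * θ i ^ (p + 1) * v i j = c i * θ i ^ p * (θ i * v i j) := by ring
        _ = _ := by
          rw [← h, Finset.mul_sum]
          exact Finset.sum_congr rfl fun l _ => by ring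
    simp_rw [h]
    rw [Finset.sum_comm]
    refine Finset.sum_eq_zero fun l _ => ?_
    rw [← Finset.mul_sum]
    rcases Nat.lt_or_ge p l with hl | hl
    · rw [ih l hl, mul_zero]
    · rw [htri j l (by omega), zero_mul]

theorem stmt_8 (D : ℕ) (hD : 3 ≤ D) (B : Matrix (Fin (D+1)) (Fin (D+1)) ℝ) (κ : ℝ)
    (hnonneg : ∀ i j, 0 ≤ B i j)
    (htri : ∀ i j : Fin (D+1), ((i : ℕ) + 1 < (j : ℕ) ∨ (j : ℕ) + 1 < (i : ℕ)) → B i j = 0)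
    (hsuper : ∀ i : Fin D, 0 < B i.castSucc i.succ)
    (hsub : ∀ i : Fin D, 0 < B i.succ i.castSucc)
    (hα0 : B 0 0 = 0)
    (hγ1 : B 1 0 = 1)
    (hrow : ∀ i, ∑ j, B i j = κ)
    (θ : Fin (D+1) → ℝ) (hθ : StrictAnti θ) (hθ0 : θ 0 = κ)
    (hchar : B.charpoly = ∏ i, (X - C (θ i)))
    (hcond : B 2 3 + B 3 2 ≤ κ + 1) :
    (θ 1 + 1) * (θ 2 + 1) * (θ (Fin.last D) + 1) ≤
      - B 1 2 * (κ + 1 - B 2 3 - B 3 2) := by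
  obtain ⟨n, rfl⟩ : ∃ n, D = n + 3 := ⟨D - 3, by omega⟩
  obtain ⟨v, c, hv0, hBv, hcpos, hc⟩ :=
    exists_eigenvectors_of_tridiagonal htri hsuper hsub hθ.injective hchar
  have val1 : ((1 : Fin (n + 3 + 1)) : ℕ) = 1 := by simp
  have val2 : ((2 : Fin (n + 3 + 1)) : ℕ) = 2 := by simp [Nat.mod_eq_of_lt]
  have val3 : ((3 : Fin (n + 3 + 1)) : ℕ) = 3 := by simp [Nat.mod_eq_of_lt]
  have val0 : ((0 : Fin (n + 3 + 1)) : ℕ) = 0 := by simp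
  have n01 : (0 : Fin (n + 3 + 1)) ≠ 1 := fun h => by rw [Fin.ext_iff] at h; omega
  have n02 : (0 : Fin (n + 3 + 1)) ≠ 2 := fun h => by rw [Fin.ext_iff] at h; omega
  have n03 : (0 : Fin (n + 3 + 1)) ≠ 3 := fun h => by rw [Fin.ext_iff] at h; omega
  have n12 : (1 : Fin (n + 3 + 1)) ≠ 2 := fun h => by rw [Fin.ext_iff] at h; omega
  have n13 : (1 : Fin (n + 3 + 1)) ≠ 3 := fun h => by rw [Fin.ext_iff] at h; omega
  have n23 : (2 : Fin (n + 3 + 1)) ≠ 3 := fun h => by rw [Fin.ext_iff] at h; omega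
  have row0 : ∀ f : Fin (n + 3 + 1) → ℝ, ∑ j, B 0 j * f j = B 0 1 * f 1 := by
    intro f
    refine Finset.sum_eq_single 1 (fun j _ hj => ?_) (by simp)
    rcases eq_or_ne j 0 with rfl | hj0
    · rw [hα0, zero_mul]
    · have h0 := Fin.val_ne_of_ne hj0
      have h1 := Fin.val_ne_of_ne hj
      rw [htri 0 j (Or.inl (by omega)), zero_mul]
  have row1 : ∀ f : Fin (n + 3 + 1) → ℝ, ∑ j, B 1 j * f j = f 0 + B 1 1 * f 1 + B 1 2 * f 2 := by
    intro f
    rw [← Finset.sum_subset (Finset.subset_univ {0, 1, 2}),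
      Finset.sum_insert (by simp [n01, n02]), Finset.sum_pair n12, hγ1]
    · ring
    · intro j _ hj
      simp only [Finset.mem_insert, Finset.mem_singleton, not_or, Fin.ext_iff] at hj
      rw [htri 1 j (Or.inl (by omega)), zero_mul]
  have row2 : ∀ f : Fin (n + 3 + 1) → ℝ,
      ∑ j, B 2 j * f j = B 2 1 * f 1 + B 2 2 * f 2 + B 2 3 * f 3 := by
    intro f
    rw [← Finset.sum_subset (Finset.subset_univ {1, 2, 3}),
      Finset.sum_insert (by simp [n12, n13]), Finset.sum_pair n23]
    · ring
    · intro j _ hj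
      simp only [Finset.mem_insert, Finset.mem_singleton, not_or, Fin.ext_iff] at hj
      rw [htri 2 j (by omega), zero_mul]
  have sum0 : B 0 1 = κ := by
    have h := row0 1
    simp only [Pi.one_apply, mul_one] at h
    rw [← h, hrow]
  have sum1 : 1 + B 1 1 + B 1 2 = κ := by
    have h := row1 1
    simp only [Pi.one_apply, mul_one] at h
    rw [← h, hrow]
  have sum2 : B 2 1 + B 2 2 + B 2 3 = κ := by
    have h := row2 1
    simp only [Pi.one_apply, mul_one] at h
    rw [← h, hrow]
  have β1pos : 0 < B 1 2 := by
    convert hsuper ⟨1, by omega⟩ using 2 <;> ext <;> simp [Nat.mod_eq_of_lt]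
  have β2pos : 0 < B 2 3 := by
    convert hsuper ⟨2, by omega⟩ using 2 <;> ext <;> simp [Nat.mod_eq_of_lt]
  have γ2pos : 0 < B 2 1 := by
    convert hsub ⟨1, by omega⟩ using 2 <;> ext <;> simp [Nat.mod_eq_of_lt]
  obtain ⟨a₂, ha₂⟩ : ∃ a, a = κ + 1 - B 1 2 - B 2 1 := ⟨_, rfl⟩
  obtain ⟨a₃, ha₃⟩ : ∃ a, a = κ + 1 - B 2 3 - B 3 2 := ⟨_, rfl⟩
  obtain ⟨x, y, z, hx, hy, hyz, hz, hroots⟩ := exists_roots_tridiagonal_three (a₂ := a₂)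
    (by linarith : 0 ≤ a₃) β1pos (mul_pos β2pos γ2pos)
  obtain ⟨Z, hZ⟩ : ∃ Z : Fin (n + 3 + 1) → ℝ, Z = fun j => B 1 2 * B 2 3 *
      (B 2 j - B 3 j + (1 - a₃) * ((Pi.single 2 1 : Fin (n + 3 + 1) → ℝ) j
        - (Pi.single 3 1 : Fin (n + 3 + 1) → ℝ) j)
        - B 2 1 * ((Pi.single 1 1 : Fin (n + 3 + 1) → ℝ) j
          - (Pi.single 2 1 : Fin (n + 3 + 1) → ℝ) j)) := ⟨_, rfl⟩
  have hZsupp : ∀ j : Fin (n + 3 + 1), (j : ℕ) < 3 → Z j = 0 := by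
    intro j hj
    rw [hZ]
    obtain rfl | rfl | rfl : j = 0 ∨ j = 1 ∨ j = 2 := by
      simp only [Fin.ext_iff, val0, val1, val2]; omega
    · simp [n01, n02, n03, htri 2 0 (by omega), htri 3 0 (by omega)]
    · simp [n12, n13, htri 3 1 (by omega)]
    · simp only [Pi.single_eq_same, Pi.single_eq_of_ne n23, Pi.single_eq_of_ne n12.symm]
      rw [ha₃]
      linear_combination B 1 2 * B 2 3 * sum2
  have hZv : ∀ i, (κ - θ i) * ((θ i + 1 - x) * (θ i + 1 - y) * (θ i + 1 - z))
      = κ * ∑ j, Z j * v i j := by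
    intro i
    have e0 := congrFun (hBv i) 0
    have e1 := congrFun (hBv i) 1
    have e2 := congrFun (hBv i) 2
    have e3 := congrFun (hBv i) 3
    simp only [Matrix.mulVec, dotProduct, Pi.smul_apply, smul_eq_mul] at e0 e1 e2 e3
    have hsum : ∑ j, Z j * v i j = B 1 2 * B 2 3 * (∑ j, B 2 j * v i j - ∑ j, B 3 j * v i j
        + (1 - a₃) * (v i 2 - v i 3) - B 2 1 * (v i 1 - v i 2)) := by
      have hs : ∀ a : Fin (n + 3 + 1),
          v i a = ∑ j, (Pi.single a 1 : Fin (n + 3 + 1) → ℝ) j * v i j := fun a => by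
        simp [Pi.single_apply]
      rw [hs 1, hs 2, hs 3, ← Finset.sum_sub_distrib, ← Finset.sum_sub_distrib,
        ← Finset.sum_sub_distrib, Finset.mul_sum, Finset.mul_sum, ← Finset.sum_add_distrib,
        ← Finset.sum_sub_distrib, Finset.mul_sum]
      refine Finset.sum_congr rfl fun j _ => ?_
      rw [hZ]; ring
    rw [hsum, e2, e3, ← hroots]
    rw [row0, hv0, sum0] at e0
    rw [row1, hv0] at e1
    rw [row2] at e2
    have w0 : (κ - θ i) = κ * (1 - v i 1) := by linear_combination e0
    have w1 : (θ i + 1) * (1 - v i 1) = B 1 2 * (v i 1 - v i 2) := by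
      linear_combination e1 - e0 - v i 1 * sum1
    have w2 : (θ i + 1) * (v i 1 - v i 2)
        = (1 - v i 1) + a₂ * (v i 1 - v i 2) + B 2 3 * (v i 2 - v i 3) := by
      rw [ha₂]
      linear_combination e2 - e1 + v i 1 * sum1 - v i 2 * sum2
    rw [w0]
    linear_combination κ * ((θ i + 1 - a₃) * (θ i + 1 - a₂) - B 2 3 * B 2 1) * w1
      + κ * B 1 2 * (θ i + 1 - a₃) * w2
  have horth : ∀ e f g : ℝ, ∑ i, c i * (((θ 0 + 1) - (θ i + 1)) *
      ((θ i + 1 - x) * (θ i + 1 - y) * (θ i + 1 - z))) *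
      (e * (θ i + 1) ^ 2 + f * (θ i + 1) + g) = 0 := by
    intro e f g
    have hterm : ∀ i, c i * (((θ 0 + 1) - (θ i + 1)) *
        ((θ i + 1 - x) * (θ i + 1 - y) * (θ i + 1 - z))) *
        (e * (θ i + 1) ^ 2 + f * (θ i + 1) + g) = ∑ j, κ * Z j *
          (e * (c i * θ i ^ 2 * v i j) + (2 * e + f) * (c i * θ i ^ 1 * v i j)
            + (e + f + g) * (c i * θ i ^ 0 * v i j)) := by
      intro i
      rw [hθ0, add_sub_add_right_eq_sub, hZv, Finset.mul_sum, Finset.mul_sum, Finset.sum_mul]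
      exact Finset.sum_congr rfl fun j _ => by ring
    simp_rw [hterm]
    rw [Finset.sum_comm]
    refine Finset.sum_eq_zero fun j _ => ?_
    rcases Nat.lt_or_ge (j : ℕ) 3 with hj | hj
    · simp [hZsupp j hj]
    · have hmom := fun p hp => sum_pow_eigenvalue_eq_zero_of_lt
        (fun i j h => htri i j (Or.inr h)) hBv hc p j hp
      rw [← Finset.mul_sum, Finset.sum_add_distrib, Finset.sum_add_distrib, ← Finset.mul_sum,
        ← Finset.mul_sum, ← Finset.mul_sum, hmom 2 (by omega), hmom 1 (by omega),
        hmom 0 (by omega)]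
      ring
  obtain ⟨h1, h2, h3⟩ := interlacing_of_orthogonal (φ := fun i => θ i + 1)
    (fun i j h => by have := hθ h; simp only; linarith) hcpos hyz horth
  have hprod : x * y * z = - B 1 2 * a₃ := by linear_combination hroots 0
  rw [← ha₃, ← hprod]
  have hyz' : y * z ≤ (θ 1 + 1) * (θ 2 + 1) := by
    rw [mul_comm y z]
    exact mul_le_mul h1 h2 hy (by linarith)
  have hyz0 : 0 ≤ y * z := mul_nonneg hy hz.le
  nlinarith [mul_nonneg (sub_nonneg.2 hyz') (by linarith : 0 ≤ -(θ (Fin.last (n + 3)) + 1)),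
    mul_nonneg hyz0 (sub_nonneg.2 h3)]
end

section
/- Let Γ be a connected k-regular graph that is neither complete nor empty, with distinct adjacency eigenvalues θ₀ = k > θ₁ > ⋯ > θ_D. For any vertex x, let β₁(x) be the (1,2)-entry of the quotient matrix of the distance partition with respect to x. Then (θ₁ + 1)(θ_D + 1) ≤ −β₁(x). -/
/-- The `(1,2)`-entry of the quotient matrix of the distance partition with respect to `x`:
the average, over the neighbours `y` of `x`, of the number of neighbours of `y`
at distance `2` from `x`. -/
noncomputable def quotientBeta1 {V : Type*} [Fintype V] (G : SimpleGraph V)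
    [DecidableRel G.Adj] (x : V) : ℝ :=
  (∑ y ∈ G.neighborFinset x, ({z | G.Adj y z ∧ G.dist x z = 2}.ncard : ℝ)) /
    (G.neighborFinset x).card

/-- A nonnegative binary quadratic form has nonnegative diagonal coefficients and determinant. -/
lemma det_nonneg_of_forall_quadratic_nonneg {u v w : ℝ}
    (h : ∀ s t : ℝ, 0 ≤ u * s ^ 2 + 2 * v * s * t + w * t ^ 2) :
    0 ≤ u ∧ 0 ≤ w ∧ v ^ 2 ≤ u * w := by
  have hu : 0 ≤ u := by simpa using h 1 0
  have hw : 0 ≤ w := by simpa using h 0 1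
  refine ⟨hu, hw, ?_⟩
  have hd := discrim_le_zero (a := u) (b := 2 * v) (c := w)
    (fun s ↦ by have := h s 1; nlinarith)
  unfold discrim at hd
  nlinarith

/-- If a binary quadratic form with matrix `!![q₁, q₂; q₂, q₃]` lies between `b` and `a` times the
positive definite diagonal form `diag(g₁, g₂)`, and its determinant is nonpositive, then the
determinant is at least `a * b * g₁ * g₂`. -/
lemma mul_le_det_of_quadratic_bounds {a b g₁ g₂ q₁ q₂ q₃ : ℝ} (hab : b < a)
    (hg₁ : 0 < g₁) (hg₂ : 0 < g₂) (hdet : q₁ * q₃ - q₂ ^ 2 ≤ 0)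
    (hlow : ∀ s t : ℝ, b * (g₁ * s ^ 2 + g₂ * t ^ 2) ≤ q₁ * s ^ 2 + 2 * q₂ * s * t + q₃ * t ^ 2)
    (hup : ∀ s t : ℝ, q₁ * s ^ 2 + 2 * q₂ * s * t + q₃ * t ^ 2 ≤ a * (g₁ * s ^ 2 + g₂ * t ^ 2)) :
    a * b * (g₁ * g₂) ≤ q₁ * q₃ - q₂ ^ 2 := by
  obtain ⟨hu₁, hu₃, hu⟩ := det_nonneg_of_forall_quadratic_nonneg
    (u := a * g₁ - q₁) (v := -q₂) (w := a * g₂ - q₃) (fun s t ↦ by linarith [hup s t])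
  obtain ⟨hl₁, hl₃, hl⟩ := det_nonneg_of_forall_quadratic_nonneg
    (u := q₁ - b * g₁) (v := q₂) (w := q₃ - b * g₂) (fun s t ↦ by linarith [hlow s t])
  have hg : 0 < g₁ * g₂ := mul_pos hg₁ hg₂
  have ha : 0 ≤ a := by
    by_contra! ha
    have h₁ : 0 < -q₁ := by nlinarith
    have h₃ : 0 ≤ (-q₃) - (-(a * g₂)) := by linarith
    have h₄ : 0 ≤ (-q₁) - (-(a * g₁)) := by linarith
    have h₅ : 0 < -(a * g₁) := by nlinarith
    have h₆ : 0 < -(a * g₂) := by nlinarith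
    nlinarith [mul_nonneg h₃ h₅.le, mul_nonneg h₄ h₆.le, mul_pos h₅ h₆]
  have hb : b ≤ 0 := by
    by_contra! hb
    have h₅ : 0 < b * g₁ := mul_pos hb hg₁
    have h₆ : 0 < b * g₂ := mul_pos hb hg₂
    nlinarith [mul_nonneg hl₁ h₆.le, mul_nonneg hl₃ h₅.le, mul_pos h₅ h₆]
  have key : (a - b) * (a * b * (g₁ * g₂)) ≤ (a - b) * (q₁ * q₃ - q₂ ^ 2) := by
    nlinarith [mul_le_mul_of_nonneg_left hu (neg_nonneg.2 hb), mul_le_mul_of_nonneg_left hl ha]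
  exact le_of_mul_le_mul_left key (sub_pos.2 hab)

open Matrix in
/-- If all eigenvectors of a real symmetric matrix with eigenvalue outside `[b, a]` are orthogonal
to `v`, then the Rayleigh quotient of `v` lies in `[b, a]`. -/
lemma Matrix.IsHermitian.rayleigh_bounds {n : Type*} [Fintype n] [DecidableEq n]
    {A : Matrix n n ℝ} (hA : A.IsHermitian) {a b : ℝ} {v : n → ℝ}
    (h : ∀ (μ : ℝ) (w : n → ℝ), μ ∈ spectrum ℝ A → A *ᵥ w = μ • w → w ⬝ᵥ v ≠ 0 → b ≤ μ ∧ μ ≤ a) :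
    b * (v ⬝ᵥ v) ≤ v ⬝ᵥ A *ᵥ v ∧ v ⬝ᵥ A *ᵥ v ≤ a * (v ⬝ᵥ v) := by
  have hsum (u w : n → ℝ) : u ⬝ᵥ w =
      ∑ i, ((hA.eigenvectorBasis i).ofLp ⬝ᵥ u) * ((hA.eigenvectorBasis i).ofLp ⬝ᵥ w) := by
    have := hA.eigenvectorBasis.sum_inner_mul_inner (WithLp.toLp 2 u) (WithLp.toLp 2 w)
    simp only [EuclideanSpace.inner_eq_star_dotProduct, star_trivial] at this
    rw [dotProduct_comm, ← this]
    exact Finset.sum_congr rfl fun i _ ↦ by rw [dotProduct_comm w]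
  have hAv (i : n) : (hA.eigenvectorBasis i).ofLp ⬝ᵥ A *ᵥ v =
      hA.eigenvalues i * ((hA.eigenvectorBasis i).ofLp ⬝ᵥ v) := by
    have hT : Aᵀ = A := by simpa [conjTranspose_eq_transpose_of_trivial] using hA.eq
    rw [dotProduct_mulVec, ← mulVec_transpose, hT, hA.mulVec_eigenvectorBasis, smul_dotProduct,
      smul_eq_mul]
  have hterm (i : n) :
      b * (((hA.eigenvectorBasis i).ofLp ⬝ᵥ v) * ((hA.eigenvectorBasis i).ofLp ⬝ᵥ v)) ≤
        ((hA.eigenvectorBasis i).ofLp ⬝ᵥ v) *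
          (hA.eigenvalues i * ((hA.eigenvectorBasis i).ofLp ⬝ᵥ v)) ∧
      ((hA.eigenvectorBasis i).ofLp ⬝ᵥ v) *
          (hA.eigenvalues i * ((hA.eigenvectorBasis i).ofLp ⬝ᵥ v)) ≤
        a * (((hA.eigenvectorBasis i).ofLp ⬝ᵥ v) * ((hA.eigenvectorBasis i).ofLp ⬝ᵥ v)) := by
    by_cases h0 : (hA.eigenvectorBasis i).ofLp ⬝ᵥ v = 0
    · simp [h0]
    · obtain ⟨hb, ha⟩ := h _ _ (hA.eigenvalues_mem_spectrum_real i)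
        (hA.mulVec_eigenvectorBasis i) h0
      have := mul_self_nonneg ((hA.eigenvectorBasis i).ofLp ⬝ᵥ v)
      constructor <;> nlinarith
  rw [hsum v v, hsum v (A *ᵥ v), Finset.mul_sum, Finset.mul_sum]
  simp only [hAv]
  exact ⟨Finset.sum_le_sum fun i _ ↦ (hterm i).1, Finset.sum_le_sum fun i _ ↦ (hterm i).2⟩

namespace SimpleGraph

variable {V : Type*} [Fintype V] [DecidableEq V] {G : SimpleGraph V} [DecidableRel G.Adj]

open Matrix in
lemma IsRegularOfDegree.eq_of_adjMatrix_mulVec_eq {k : ℕ} (hreg : G.IsRegularOfDegree k)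
    (hconn : G.Connected) {w : V → ℝ} (hw : G.adjMatrix ℝ *ᵥ w = (k : ℝ) • w) (i j : V) :
    w i = w j := by
  refine (G.lapMatrix_mulVec_eq_zero_iff_forall_reachable (x := w)).1 ?_ i j (hconn i j)
  ext y
  have := congrFun hw y
  simp [lapMatrix, sub_mulVec, degMatrix, mulVec_diagonal, hreg.degree_eq y, this]

lemma IsRegularOfDegree.add_one_lt_card {k : ℕ} (hreg : G.IsRegularOfDegree k) {x y : V}
    (hxy : x ≠ y) (h : ¬ G.Adj x y) : k + 1 < Fintype.card V := by
  have hsub : insert x (insert y (G.neighborFinset x)) ⊆ Finset.univ := Finset.subset_univ _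
  have := Finset.card_le_card hsub
  rw [Finset.card_insert_of_notMem (by simp [hxy]), Finset.card_insert_of_notMem (by simpa),
    card_neighborFinset_eq_degree, hreg.degree_eq, Finset.card_univ] at this
  omega

/-- The neighbours of a neighbour `y` of `x` are `x`, the common neighbours, and the neighbours
at distance two from `x`. -/
lemma degree_eq_one_add_card_inter_add_ncard {x y : V} (hxy : G.Adj x y) :
    G.degree y = 1 + (G.neighborFinset y ∩ G.neighborFinset x).card +
      {z | G.Adj y z ∧ G.dist x z = 2}.ncard := by
  have hset : {z | G.Adj y z ∧ G.dist x z = 2} =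
      (((G.neighborFinset y \ G.neighborFinset x).erase x : Finset V) : Set V) := by
    ext z
    simp only [Set.mem_ofPred_eq, Finset.coe_erase, Finset.coe_sdiff, Set.mem_sdiff, Finset.mem_coe,
      mem_neighborFinset, Set.mem_singleton_iff]
    constructor
    · rintro ⟨hyz, hd⟩
      refine ⟨⟨hyz, fun h ↦ ?_⟩, ?_⟩
      · rw [dist_eq_one_iff_adj.2 h] at hd
        omega
      · rintro rfl
        simp at hd
    · rintro ⟨⟨hyz, hn⟩, hne⟩
      refine ⟨hyz, ?_⟩
      let p : G.Walk x z := .cons hxy (.cons hyz .nil)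
      have hle : G.dist x z ≤ 2 := dist_le p
      have h0 : G.dist x z ≠ 0 := fun h ↦ hne (p.reachable.dist_eq_zero_iff.1 h).symm
      have h1 : G.dist x z ≠ 1 := fun h ↦ hn (dist_eq_one_iff_adj.1 h)
      omega
  rw [hset, Set.ncard_coe_finset, Finset.card_erase_of_mem (by simp [hxy.symm]),
    ← card_neighborFinset_eq_degree, ← Finset.card_sdiff_add_card_inter _ (G.neighborFinset x)]
  have : 0 < (G.neighborFinset y \ G.neighborFinset x).card :=
    Finset.card_pos.2 ⟨x, by simp [hxy.symm]⟩
  omega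

open Matrix in
lemma IsRegularOfDegree.dotProduct_adjMatrix_neighbor {k : ℕ} (hreg : G.IsRegularOfDegree k)
    (hk : 0 < k) (x : V) :
    G.adjMatrix ℝ x ⬝ᵥ G.adjMatrix ℝ *ᵥ G.adjMatrix ℝ x =
      k * (k - 1 - quotientBeta1 G x) := by
  have hβ : k * quotientBeta1 G x =
      ∑ y ∈ G.neighborFinset x, ({z | G.Adj y z ∧ G.dist x z = 2}.ncard : ℝ) := by
    rw [quotientBeta1, card_neighborFinset_eq_degree, hreg.degree_eq]
    field_simp
  have hsum : G.adjMatrix ℝ x ⬝ᵥ G.adjMatrix ℝ *ᵥ G.adjMatrix ℝ x =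
      ∑ y ∈ G.neighborFinset x, ((G.neighborFinset y ∩ G.neighborFinset x).card : ℝ) := by
    rw [adjMatrix_dotProduct]
    refine Finset.sum_congr rfl fun y _ ↦ ?_
    rw [adjMatrix_mulVec_apply]
    simp [adjMatrix_apply, ← mem_neighborFinset]
  have hdeg : ∑ y ∈ G.neighborFinset x, (k : ℝ) =
      ∑ y ∈ G.neighborFinset x, (1 + ((G.neighborFinset y ∩ G.neighborFinset x).card : ℝ) +
        ({z | G.Adj y z ∧ G.dist x z = 2}.ncard : ℝ)) :=
    Finset.sum_congr rfl fun y hy ↦ by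
      have := degree_eq_one_add_card_inter_add_ncard ((mem_neighborFinset ..).1 hy)
      rw [hreg.degree_eq] at this
      exact_mod_cast this
  rw [Finset.sum_add_distrib, Finset.sum_add_distrib, ← hsum, ← hβ] at hdeg
  simp only [Finset.sum_const, card_neighborFinset_eq_degree, hreg.degree_eq, nsmul_eq_mul,
    mul_one] at hdeg
  linarith

open Matrix in
/-- The quadratic forms of the identity and of the adjacency matrix on the span of the indicator
functions of `x`, of its neighbourhood, and of the whole vertex set. -/
lemma IsRegularOfDegree.quadratic_forms {k : ℕ} (hreg : G.IsRegularOfDegree k)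
    (hk : 0 < k) (x : V) (α γ δ : ℝ) {v : V → ℝ}
    (hv : v = α • Pi.single x 1 + γ • G.adjMatrix ℝ x + δ • (fun _ ↦ 1)) :
    (∑ y, v y = α + k * γ + Fintype.card V * δ) ∧
    (v ⬝ᵥ v = α ^ 2 + k * γ ^ 2 + Fintype.card V * δ ^ 2 + 2 * α * δ + 2 * k * γ * δ) ∧
    v ⬝ᵥ G.adjMatrix ℝ *ᵥ v = 2 * k * α * γ + 2 * k * α * δ +
      k * (k - 1 - quotientBeta1 G x) * γ ^ 2 + 2 * k ^ 2 * γ * δ + Fintype.card V * k * δ ^ 2 := by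
  set f : V → ℝ := G.adjMatrix ℝ x with hf
  set e : V → ℝ := Pi.single x 1 with he
  set o : V → ℝ := fun _ ↦ 1 with ho
  have hAe : G.adjMatrix ℝ *ᵥ e = f := by
    ext y
    simp [he, hf, adjMatrix_apply, adj_comm]
  have hAo : G.adjMatrix ℝ *ᵥ o = (k : ℝ) • o := by
    ext y
    simp [ho, adjMatrix_mulVec_apply, hreg.degree_eq]
  have hfo : f ⬝ᵥ o = k := by simp [hf, ho, adjMatrix_dotProduct, hreg.degree_eq]
  have hff : f ⬝ᵥ f = k := by
    rw [hf, adjMatrix_dotProduct, ← hfo, hf, adjMatrix_dotProduct]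
    exact Finset.sum_congr rfl fun y hy ↦ by simpa [adjMatrix_apply, ho] using hy
  have hee : e ⬝ᵥ e = 1 := by simp [he]
  have hef : e ⬝ᵥ f = 0 := by simp [he, hf]
  have heo : e ⬝ᵥ o = 1 := by simp [he, ho]
  have hoo : o ⬝ᵥ o = Fintype.card V := by simp [ho, dotProduct]
  have hfAf := hreg.dotProduct_adjMatrix_neighbor hk x
  rw [← hf] at hfAf
  have hsymm (u w : V → ℝ) : u ⬝ᵥ G.adjMatrix ℝ *ᵥ w = (G.adjMatrix ℝ *ᵥ u) ⬝ᵥ w := by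
    rw [dotProduct_mulVec, ← mulVec_transpose, transpose_adjMatrix]
  have heAf : e ⬝ᵥ G.adjMatrix ℝ *ᵥ f = k := by rw [hsymm, hAe, hff]
  have hoAf : o ⬝ᵥ G.adjMatrix ℝ *ᵥ f = k ^ 2 := by
    rw [hsymm, hAo, smul_dotProduct, dotProduct_comm, hfo, smul_eq_mul, sq]
  have hvo : ∑ y, v y = v ⬝ᵥ o := by simp [ho, dotProduct]
  have hfe : f ⬝ᵥ e = 0 := by rw [dotProduct_comm, hef]
  have hoe : o ⬝ᵥ e = 1 := by rw [dotProduct_comm, heo]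
  have hof : o ⬝ᵥ f = k := by rw [dotProduct_comm, hfo]
  rw [hvo, hv]
  simp only [mulVec_add, mulVec_smul, add_dotProduct, dotProduct_add, smul_dotProduct,
    dotProduct_smul, smul_eq_mul, hAe, hAo, hfo, hff, hee, hef, heo, hoo, hfAf, heAf, hoAf,
    hfe, hoe, hof]
  refine ⟨by ring, by ring, by ring⟩

end SimpleGraph

theorem stmt_10 {V : Type*} [Fintype V] [DecidableEq V] (G : SimpleGraph V) [DecidableRel G.Adj]
    (k D : ℕ) (hD : 2 ≤ D)
    (hconn : G.Connected) (hreg : G.IsRegularOfDegree k)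
    (hnotempty : ∃ x y : V, G.Adj x y)
    (hnotcomplete : ∃ x y : V, x ≠ y ∧ ¬ G.Adj x y)
    (θ : Fin (D+1) → ℝ) (hθ : StrictAnti θ) (hθ0 : θ 0 = k)
    (hspec : ∀ μ : ℝ, (∃ i, θ i = μ) ↔ μ ∈ spectrum ℝ (G.adjMatrix ℝ))
    (x : V) :
    (θ 1 + 1) * (θ (Fin.last D) + 1) ≤ - quotientBeta1 G x := by
  obtain ⟨x₀, y₀, hne, hnadj⟩ := hnotcomplete
  have hcard := hreg.add_one_lt_card hne hnadj
  have hk : 0 < k := by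
    obtain ⟨a, b, hab⟩ := hnotempty
    rw [← hreg.degree_eq a]
    exact (G.degree_pos_iff_exists_adj a).2 ⟨b, hab⟩
  have hval1 : ((1 : Fin (D + 1)) : ℕ) = 1 := by
    rw [Fin.val_one']
    exact Nat.mod_eq_of_lt (by omega)
  have hlt : θ (Fin.last D) < θ 1 := hθ (by rw [Fin.lt_def, hval1, Fin.val_last]; omega)
  have hray {v : V → ℝ} (hv : ∑ y, v y = 0) := Matrix.IsHermitian.rayleigh_bounds
    (A := G.adjMatrix ℝ) (a := θ 1) (b := θ (Fin.last D)) (v := v)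
    (by simp [Matrix.IsHermitian, Matrix.conjTranspose_eq_transpose_of_trivial])
    (fun μ w hμ hw h0 ↦ by
      obtain ⟨i, rfl⟩ := (hspec μ).2 hμ
      refine ⟨hθ.antitone (Fin.le_last i), hθ.antitone ?_⟩
      rw [Fin.le_def, hval1, Nat.one_le_iff_ne_zero]
      intro hi
      obtain rfl : i = 0 := Fin.ext hi
      rw [hθ0] at hw
      refine h0 ?_
      have hconst := hreg.eq_of_adjMatrix_mulVec_eq hconn hw
      simp only [dotProduct, fun y ↦ hconst y x]
      rw [← Finset.mul_sum, hv, mul_zero])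
  set β := quotientBeta1 G x with hβdef
  have hβ : 0 ≤ β := by
    rw [hβdef, quotientBeta1]
    positivity
  obtain ⟨n, hn⟩ : ∃ n : ℝ, n = Fintype.card V := ⟨_, rfl⟩
  have hkn : (k : ℝ) + 1 < n := by rw [hn]; exact_mod_cast hcard
  have hk' : (0 : ℝ) < k := by exact_mod_cast hk
  have hbound (s t : ℝ) := by
    obtain ⟨h₁, h₂, h₃⟩ := hreg.quadratic_forms hk x (n * s + k * t) ((n - 1) * t) (-s - k * t) rfl
    have := hray (h₁.trans (by rw [← hn]; ring))
    rw [h₂, h₃, ← hn, ← hβdef] at this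
    exact this
  have hdet : n * (n - (k + 1)) * ((n - 1) ^ 2 * k * (k - β) + 2 * (n - 1) * k ^ 2 + k ^ 2 -
      n * k ^ 2 * (k + 1)) - (n * k * (n - 1 - k)) ^ 2 =
      -β * (n * (n - 1) * (k * (n - 1) * (n - 1 - k))) := by ring
  have hg₁ : 0 < n * (n - 1) := by apply mul_pos <;> linarith
  have hg₂ : 0 < k * (n - 1) * (n - 1 - k) :=
    mul_pos (mul_pos hk' (by linarith)) (by linarith)
  have key := mul_le_det_of_quadratic_bounds (a := θ 1 + 1) (b := θ (Fin.last D) + 1)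
    (by linarith) hg₁ hg₂
    (by rw [hdet]; nlinarith [mul_nonneg hβ (mul_pos hg₁ hg₂).le])
    (fun s t ↦ by linear_combination (hbound s t).1)
    (fun s t ↦ by linear_combination (hbound s t).2)
  rw [hdet] at key
  exact le_of_mul_le_mul_right key (mul_pos hg₁ hg₂)
end

section
/- Let Γ be a connected k-regular graph with distinct adjacency eigenvalues θ₀ = k > θ₁ > ⋯ > θ_D. If for every vertex x the equality (θ₁+1)(θ_D+1) = −β₁(x) holds in the quotient-matrix bound, then Γ is strongly regular. -/
open Matrix

namespace Matrix

/-- If a polynomial with roots `a`, `b`, `c` is nonpositive on the spectrum of a symmetric matrix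
`A` and its value at `A` has trace zero, then it annihilates `A`. -/
theorem IsHermitian.mul_mul_eq_zero_of_trace_eq_zero {n : Type*} [Fintype n] [DecidableEq n]
    {A : Matrix n n ℝ} (hA : A.IsHermitian) (a b c : ℝ)
    (hp : ∀ μ ∈ spectrum ℝ A, (μ - a) * (μ - b) * (c - μ) ≤ 0)
    (htr : ((A - a • 1) * (A - b • 1) * (c • 1 - A)).trace = 0) :
    (A - a • 1) * (A - b • 1) * (c • 1 - A) = 0 := by
  have hP : (A - a • 1) * (A - b • 1) * (c • 1 - A) =
      Unitary.conjStarAlgAut ℝ _ hA.eigenvectorUnitary (diagonal fun i =>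
        (hA.eigenvalues i - a) * (hA.eigenvalues i - b) * (c - hA.eigenvalues i)) := by
    have hs (t : ℝ) : diagonal (fun _ : n => t) = t • (1 : Matrix n n ℝ) := by
      rw [smul_one_eq_diagonal]
    conv_lhs => rw [hA.spectral_theorem]
    simp only [← diagonal_mul_diagonal, ← diagonal_sub, map_mul, map_sub, hs, map_smul, map_one]
    rfl
  have hs : ∑ i, (hA.eigenvalues i - a) * (hA.eigenvalues i - b) * (c - hA.eigenvalues i) = 0 := by
    rw [hP, Unitary.conjStarAlgAut_apply, trace_mul_cycle, Unitary.coe_star_mul_self,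
      one_mul, trace_diagonal] at htr
    exact htr
  rw [Finset.sum_eq_zero_iff_of_nonpos fun i _ => hp _ (hA.eigenvalues_mem_spectrum_real i)] at hs
  simp [hP, hs]

end Matrix

namespace SimpleGraph

variable {V : Type*} [Fintype V] {G : SimpleGraph V} [DecidableRel G.Adj]

/-- The square of the adjacency matrix counts common neighbours. -/
theorem adjMatrix_mul_self_apply (x y : V) :
    (G.adjMatrix ℝ * G.adjMatrix ℝ) x y = Fintype.card (G.commonNeighbors x y) := by
  rw [adjMatrix_mul_apply, ← Set.toFinset_card]
  simp only [adjMatrix_apply, Finset.sum_boole]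
  congr 2
  ext z
  simp [mem_commonNeighbors, adj_comm]

theorem Adj.degree_eq_commonNeighbors_add_ncard {x y : V} (h : G.Adj x y) :
    G.degree y = 1 + Fintype.card (G.commonNeighbors x y) +
      {z | G.Adj y z ∧ G.dist x z = 2}.ncard := by
  have hset : G.neighborSet y =
      ({x} ∪ G.commonNeighbors x y) ∪ {z | G.Adj y z ∧ G.dist x z = 2} := by
    ext z
    simp only [mem_neighborSet, Set.mem_union, Set.mem_singleton_iff, mem_commonNeighbors,
      Set.mem_ofPred_eq]
    constructor
    · intro hz
      have hle : G.dist x z ≤ 2 := dist_le (.cons h hz.toWalk)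
      have hreach : G.Reachable x z := h.reachable.trans hz.reachable
      have h0 := hreach.dist_eq_zero_iff
      have h1 := dist_eq_one_iff_adj (G := G) (u := x) (v := z)
      grind
    · rintro ((rfl | hz) | hz)
      exacts [h.symm, hz.2, hz.1]
  rw [← card_neighborSet_eq_degree, Fintype.card_eq_nat_card, Nat.card_coe_set_eq, hset,
    Set.ncard_union_eq, Set.ncard_union_eq, Set.ncard_singleton, Fintype.card_eq_nat_card,
    Nat.card_coe_set_eq]
  · simp [mem_commonNeighbors]
  · rw [Set.disjoint_left]
    rintro z (rfl | hz) ⟨-, hz2⟩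
    · simp at hz2
    · rw [dist_eq_one_iff_adj.2 hz.1] at hz2
      lia

theorem IsRegularOfDegree.adjMatrix_mul_mul_self_apply_self {k : ℕ}
    (hreg : G.IsRegularOfDegree k) (x : V) :
    (G.adjMatrix ℝ * G.adjMatrix ℝ * G.adjMatrix ℝ) x x = k * (k - 1 - quotientBeta1 G x) := by
  have hsum : (G.adjMatrix ℝ * G.adjMatrix ℝ * G.adjMatrix ℝ) x x =
      ∑ y ∈ G.neighborFinset x, ((k : ℝ) - 1 - {z | G.Adj y z ∧ G.dist x z = 2}.ncard) := by
    rw [mul_adjMatrix_apply]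
    refine Finset.sum_congr rfl fun y hy => ?_
    rw [mem_neighborFinset] at hy
    have h := hy.degree_eq_commonNeighbors_add_ncard
    rw [hreg y] at h
    rw [adjMatrix_mul_self_apply, h]
    push_cast
    ring
  rw [hsum, Finset.sum_sub_distrib, Finset.sum_const, card_neighborFinset_eq_degree, hreg x,
    quotientBeta1, card_neighborFinset_eq_degree, hreg x, nsmul_eq_mul]
  obtain rfl | hk := k.eq_zero_or_pos
  · have : G.neighborFinset x = ∅ := by
      rw [← Finset.card_eq_zero, card_neighborFinset_eq_degree, hreg x]
    simp [this]
  · field_simp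

/-- If the columns of `B` are all killed by the Laplacian of a connected graph, then the
columns of `B` are constant. -/
theorem Connected.apply_eq_of_lapMatrix_mul_eq_zero [DecidableEq V] (hconn : G.Connected)
    {B : Matrix V V ℝ} (hB : G.lapMatrix ℝ * B = 0) (x y z : V) : B x z = B y z := by
  refine G.lapMatrix_mulVec_eq_zero_iff_forall_reachable (x := fun w => B w z) |>.1 ?_ x y
    (hconn.preconnected x y)
  ext w
  exact congr_fun₂ hB w z

theorem IsRegularOfDegree.lapMatrix_eq [DecidableEq V] {k : ℕ} (hreg : G.IsRegularOfDegree k) :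
    G.lapMatrix ℝ = (k : ℝ) • 1 - G.adjMatrix ℝ := by
  rw [lapMatrix, degMatrix, smul_one_eq_diagonal]
  simp only [hreg.degree_eq]

theorem Connected.exists_isSRGWith_of_mul_eq_zero [DecidableEq V] (hconn : G.Connected) {k : ℕ}
    (hreg : G.IsRegularOfDegree k) {a c : ℝ}
    (h : (G.adjMatrix ℝ - a • 1) * (G.adjMatrix ℝ - c • 1) * ((k : ℝ) • 1 - G.adjMatrix ℝ) = 0) :
    ∃ ℓ μ : ℕ, G.IsSRGWith (Fintype.card V) k ℓ μ := by
  set A := G.adjMatrix ℝ with hA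
  set B := (A - a • 1) * (A - c • 1) with hB
  have hBA : B = A * A - (a + c) • A + (a * c) • 1 := by
    simp only [hB, sub_mul, mul_sub, smul_mul_assoc, mul_smul_comm, one_mul, mul_one,
      smul_sub]
    module
  have hBT : Bᵀ = B := by
    simp [hBA, hA, transpose_mul]
  have hcol := hconn.apply_eq_of_lapMatrix_mul_eq_zero (B := B) <| by
    rw [hreg.lapMatrix_eq, ← transpose_inj, transpose_mul, hBT]
    simpa using h
  have hrow (x y z : V) : B z x = B z y := by
    have := hcol x y z
    rwa [← hBT, transpose_apply, transpose_apply] at this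
  obtain ⟨v⟩ := hconn.nonempty
  have hcard (x y : V) (hxy : x ≠ y) : (Fintype.card (G.commonNeighbors x y) : ℝ) =
      B v v + if G.Adj x y then a + c else 0 := by
    have h1 : B x y = B v v := (hcol x v y).trans (hrow y v v)
    rw [← h1, hBA, ← adjMatrix_mul_self_apply, Matrix.add_apply, Matrix.sub_apply,
      Matrix.smul_apply, Matrix.smul_apply, one_apply_ne hxy, hA, adjMatrix_apply]
    simp
  have hexists (P : V → V → Prop) (hP : ∀ x y x' y', P x y → P x' y' →
      (Fintype.card (G.commonNeighbors x y) : ℝ) = Fintype.card (G.commonNeighbors x' y')) :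
      ∃ m, ∀ x y, P x y → Fintype.card (G.commonNeighbors x y) = m := by
    by_cases hne : ∃ x y, P x y
    · obtain ⟨x, y, hxy⟩ := hne
      exact ⟨_, fun x' y' h' => by exact_mod_cast hP x' y' x y h' hxy⟩
    · exact ⟨0, fun x y hxy => absurd ⟨x, y, hxy⟩ hne⟩
  obtain ⟨ℓ, hℓ⟩ := hexists G.Adj fun x y x' y' h1 h2 => by
    rw [hcard x y h1.ne, hcard x' y' h2.ne, if_pos h1, if_pos h2]
  obtain ⟨μ, hμ⟩ := hexists (fun x y => x ≠ y ∧ ¬ G.Adj x y) fun x y x' y' h1 h2 => by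
    rw [hcard x y h1.1, hcard x' y' h2.1, if_neg h1.2, if_neg h2.2]
  exact ⟨ℓ, μ, rfl, hreg, hℓ, fun x y hne hadj => hμ x y ⟨hne, hadj⟩⟩

end SimpleGraph

theorem stmt_11 {V : Type*} [Fintype V] [DecidableEq V] (G : SimpleGraph V)
    [DecidableRel G.Adj]
    (k D : ℕ) (hD : 2 ≤ D)
    (hconn : G.Connected) (hreg : G.IsRegularOfDegree k)
    (hnotempty : ∃ x y : V, G.Adj x y)
    (hnotcomplete : ∃ x y : V, x ≠ y ∧ ¬ G.Adj x y)
    (θ : Fin (D+1) → ℝ) (hθ : StrictAnti θ) (hθ0 : θ 0 = k)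
    (hspec : ∀ μ : ℝ, (∃ i, θ i = μ) ↔ μ ∈ spectrum ℝ (G.adjMatrix ℝ))
    (heq : ∀ x : V, (θ 1 + 1) * (θ (Fin.last D) + 1) = - quotientBeta1 G x) :
    ∃ ℓ μ : ℕ, G.IsSRGWith (Fintype.card V) k ℓ μ := by
  refine hconn.exists_isSRGWith_of_mul_eq_zero hreg (a := θ 1) (c := θ (Fin.last D)) <|
    (G.isHermitian_adjMatrix ℝ).mul_mul_eq_zero_of_trace_eq_zero _ _ _ ?_ ?_
  · intro μ hμ
    obtain ⟨i, rfl⟩ := (hspec μ).2 hμ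
    obtain rfl | hi := eq_or_ne i 0
    · simp [hθ0]
    have h0 : θ i ≤ k := hθ0 ▸ hθ.antitone (Fin.zero_le i)
    have h1 : θ i ≤ θ 1 := hθ.antitone (Fin.one_le_of_ne_zero hi)
    have h2 : θ (Fin.last D) ≤ θ i := hθ.antitone (Fin.le_last i)
    exact mul_nonpos_of_nonpos_of_nonneg
      (mul_nonpos_of_nonpos_of_nonneg (sub_nonpos.2 h1) (sub_nonneg.2 h2)) (sub_nonneg.2 h0)
  · refine Finset.sum_eq_zero fun x _ => ?_
    have hexp (A : Matrix V V ℝ) (a c t : ℝ) : (A - a • 1) * (A - c • 1) * (t • 1 - A) =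
        (t + a + c) • (A * A) - A * A * A - (t * (a + c) + a * c) • A + (a * c * t) • 1 := by
      simp only [sub_mul, mul_sub, smul_mul_assoc, mul_smul_comm, one_mul, mul_one, smul_smul,
        smul_sub]
      module
    rw [diag_apply, hexp]
    simp only [Matrix.add_apply, Matrix.sub_apply, Matrix.smul_apply,
      hreg.adjMatrix_mul_mul_self_apply_self x,
      SimpleGraph.adjMatrix_mul_self_apply_self, hreg x, SimpleGraph.adjMatrix_apply,
      SimpleGraph.irrefl, one_apply_eq, smul_eq_mul, if_false]
    linear_combination (k : ℝ) * heq x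
end

section
/- Let Γ be a distance-regular graph of diameter D ≥ 3 with valency k, intersection numbers b_i, c_i, and distinct eigenvalues k = θ₀ > θ₁ > ⋯ > θ_D. If b₂ + c₃ ≥ k + 1, then (θ₁+1)(θ_{D−1}+1)(θ_D+1) ≥ −b₁(k + 1 − b₂ − c₃), with equality if and only if D = 3. -/
open Polynomial

/-- `G` is a distance-regular graph of diameter `D` with intersection numbers
`b i` and `c i`. -/
def SimpleGraph.IsDRGWith {V : Type*} (G : SimpleGraph V) (D : ℕ) (b c : ℕ → ℕ) : Prop :=
  G.Connected ∧ (∀ x y : V, G.dist x y ≤ D) ∧ (∃ x y : V, G.dist x y = D) ∧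
    ∀ (i : ℕ) (x y : V), i ≤ D → G.dist x y = i →
      {z | G.Adj y z ∧ G.dist x z = i + 1}.ncard = b i ∧
      {z | G.Adj y z ∧ G.dist x z = i - 1}.ncard = c i

/-- The tridiagonal intersection matrix `B₁` of a distance-regular graph with valency `k`,
with rows determined by `(c_i, a_i, b_i)` where `a_i = k - b_i - c_i`. -/
noncomputable def intersectionMatrix (D k : ℕ) (b c : ℕ → ℕ) :
    Matrix (Fin (D+1)) (Fin (D+1)) ℝ :=
  fun i j =>
    if (j : ℕ) = (i : ℕ) + 1 then (b (i : ℕ) : ℝ)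
    else if (j : ℕ) + 1 = (i : ℕ) then (c (i : ℕ) : ℝ)
    else if j = i then (k : ℝ) - b (i : ℕ) - c (i : ℕ)
    else 0

namespace Polynomial

theorem Monic.eq_prod_X_sub_C_of_isRoot {ι : Type*} (s : Finset ι) {p : ℝ[X]} (hp : p.Monic)
    (hdeg : p.natDegree = s.card) (t : ι → ℝ) (ht : Set.InjOn t s)
    (hroot : ∀ i ∈ s, p.IsRoot (t i)) : p = ∏ i ∈ s, (X - C (t i)) := by
  refine (eq_of_monic_of_dvd_of_natDegree_le (monic_prod_X_sub_C t s) hp ?_ ?_)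
  · refine Finset.prod_dvd_of_coprime ?_ fun i hi => dvd_iff_isRoot.2 (hroot i hi)
    intro i hi j hj hij
    refine isCoprime_X_sub_C_of_isUnit_sub (sub_ne_zero.2 ?_).isUnit
    exact fun h => hij (ht hi hj h)
  · rw [hdeg, natDegree_finsetProd_X_sub_C_eq_card]

theorem exists_isRoot_mem_Ioo {p : ℝ[X]} {a b : ℝ} (hab : a < b)
    (h : p.eval a * p.eval b < 0) : ∃ x ∈ Set.Ioo a b, p.IsRoot x := by
  rcases mul_neg_iff.1 h with ⟨ha, hb⟩ | ⟨ha, hb⟩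
  · exact intermediate_value_Ioo' hab.le p.continuous.continuousOn ⟨hb, ha⟩
  · exact intermediate_value_Ioo hab.le p.continuous.continuousOn ⟨ha, hb⟩

theorem exists_isRoot_gt {p : ℝ[X]} {a : ℝ} (hdeg : 0 < p.natDegree) (hlead : 0 ≤ p.leadingCoeff)
    (h : p.eval a < 0) : ∃ x, a < x ∧ p.IsRoot x := by
  have htop := p.tendsto_atTop_of_leadingCoeff_nonneg (natDegree_pos_iff_degree_pos.1 hdeg) hlead
  obtain ⟨b, hb, hab⟩ :=
    ((htop.eventually_gt_atTop 0).and (Filter.eventually_gt_atTop a)).exists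
  obtain ⟨x, hx, hroot⟩ := exists_isRoot_mem_Ioo hab (mul_neg_of_neg_of_pos h hb)
  exact ⟨x, hx.1, hroot⟩

theorem Monic.exists_isRoot_lt {p : ℝ[X]} {a : ℝ} (hp : p.Monic) (hdeg : 0 < p.natDegree)
    (h : (-1) ^ p.natDegree * p.eval a < 0) : ∃ x, x < a ∧ p.IsRoot x := by
  have hd : (C ((-1 : ℝ) ^ p.natDegree) * p.comp (-X)).natDegree = p.natDegree := by
    rw [natDegree_C_mul (by simp), natDegree_comp]
    simp
  have hl : (C ((-1 : ℝ) ^ p.natDegree) * p.comp (-X)).leadingCoeff = 1 := by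
    rw [leadingCoeff_mul, leadingCoeff_comp (by simp), hp.leadingCoeff]
    simp [← mul_pow]
  obtain ⟨x, hx, hroot⟩ := exists_isRoot_gt (p := C ((-1 : ℝ) ^ p.natDegree) * p.comp (-X))
    (a := -a) (by omega) (zero_le_one.trans_eq hl.symm) (by simpa using h)
  exact ⟨-x, by linarith, by simpa [IsRoot] using hroot⟩

end Polynomial

/-- The zeros `r 0, …, r (n - 1)` of one polynomial strictly separate the zeros `s 0, …, s n` of
the next one. -/
def Interlaces (n : ℕ) (r s : ℕ → ℝ) : Prop :=
  ∀ i < n, s i < r i ∧ r i < s (i + 1)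

theorem Interlaces.le {n : ℕ} {r s : ℕ → ℝ} (h : Interlaces n r s) {i j : ℕ} (hij : i ≤ j)
    (hj : j ≤ n) : s i ≤ s j := by
  induction j, hij using Nat.le_induction with
  | base => exact le_rfl
  | succ j _ ih =>
    have := h j (by omega)
    linarith [ih (by omega)]

theorem Interlaces.sign_eval {n : ℕ} {r s : ℕ → ℝ} (h : Interlaces n r s) {i : ℕ} (hi : i ≤ n) :
    0 < (-1) ^ (n - i) * (∏ j ∈ Finset.range n, (X - C (r j))).eval (s i) := by
  have hlow : 0 < ∏ j ∈ Finset.range i, (s i - r j) := by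
    refine Finset.prod_pos fun j hj => ?_
    have hj' := Finset.mem_range.1 hj
    linarith [(h j (by omega)).2, h.le (show j + 1 ≤ i by omega) hi]
  have hhigh : 0 < ∏ j ∈ Finset.Ico i n, -(s i - r j) := by
    refine Finset.prod_pos fun j hj => ?_
    have hj' := Finset.mem_Ico.1 hj
    linarith [(h j hj'.2).1, h.le hj'.1 (by omega)]
  rw [Finset.prod_neg, Nat.card_Ico] at hhigh
  have := mul_pos hlow hhigh
  rw [eval_prod]
  simp only [eval_sub, eval_X, eval_C]
  rw [← Finset.prod_range_mul_prod_Ico _ hi]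
  linarith

theorem Interlaces.exists_succ {n : ℕ} {r s : ℕ → ℝ} (h : Interlaces n r s) {p q u : ℝ[X]}
    {a β : ℝ} (hβ : 0 < β) (hp : p = ∏ i ∈ Finset.range n, (X - C (r i)))
    (hq : q = ∏ i ∈ Finset.range (n + 1), (X - C (s i)))
    (hu : u = (X - C a) * q - C β * p) :
    ∃ t, Interlaces (n + 1) s t ∧ u = ∏ i ∈ Finset.range (n + 2), (X - C (t i)) := by
  have hqm : q.Monic := hq ▸ monic_prod_X_sub_C _ _
  have hpd : p.natDegree = n := by rw [hp, natDegree_finsetProd_X_sub_C_eq_card, Finset.card_range]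
  have hqd : q.natDegree = n + 1 := by
    rw [hq, natDegree_finsetProd_X_sub_C_eq_card, Finset.card_range]
  have hmm : ((X - C a) * q).Monic := (monic_X_sub_C a).mul hqm
  have hmd : ((X - C a) * q).natDegree = n + 2 := by
    rw [(monic_X_sub_C a).natDegree_mul hqm, natDegree_X_sub_C, hqd]; omega
  have hlt : (C β * p).degree < ((X - C a) * q).degree := by
    refine degree_lt_degree ?_
    rw [hmd]
    exact (natDegree_C_mul_le β p).trans_lt (by omega)
  have hum : u.Monic := hu ▸ hmm.sub_of_left hlt
  have hud : u.natDegree = n + 2 := by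
    rw [hu, natDegree_sub_eq_left_of_natDegree_lt, hmd]
    rw [hmd]
    exact (natDegree_C_mul_le β p).trans_lt (by omega)
  have hsign : ∀ i ≤ n, (-1) ^ (n - i) * u.eval (s i) < 0 := by
    intro i hi
    have hq0 : q.eval (s i) = 0 := by
      rw [hq, eval_prod]
      exact Finset.prod_eq_zero (Finset.mem_range.2 (by omega : i < n + 1)) (by simp)
    have hpos := h.sign_eval hi
    rw [← hp] at hpos
    rw [hu, eval_sub, eval_mul, eval_mul, hq0, eval_C]
    nlinarith [mul_pos hβ hpos]
  have hex : ∀ i, ∃ x, i ≤ n + 1 → u.IsRoot x ∧ (i ≤ n → x < s i) ∧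
      ∀ j, i = j + 1 → s j < x := by
    intro i
    rcases Nat.lt_or_ge (n + 1) i with hi | hi
    · exact ⟨0, fun h => by omega⟩
    rcases i with _ | j
    · obtain ⟨x, hx, hroot⟩ := hum.exists_isRoot_lt (a := s 0) (by omega) (by
        rw [hud, pow_add]
        simpa using hsign 0 (by omega))
      exact ⟨x, fun _ => ⟨hroot, fun _ => hx, fun j hj => by omega⟩⟩
    · rcases Nat.lt_or_ge j n with hj | hj
      · obtain ⟨x, hx, hroot⟩ := exists_isRoot_mem_Ioo (p := u)
          ((h j hj).1.trans (h j hj).2) (by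
            have h1 := hsign j hj.le
            have h2 := hsign (j + 1) hj
            rw [show n - j = n - (j + 1) + 1 by omega, pow_succ] at h1
            have hsq : ((-1 : ℝ) ^ (n - (j + 1))) * (-1) ^ (n - (j + 1)) = 1 := by
              rw [← mul_pow]; simp
            have := mul_pos_of_neg_of_neg h1 h2
            linear_combination this - (u.eval (s j) * u.eval (s (j + 1))) * hsq)
        refine ⟨x, fun _ => ⟨hroot, fun _ => hx.2, fun l hl => ?_⟩⟩
        obtain rfl : j = l := by omega
        exact hx.1
      · obtain ⟨x, hx, hroot⟩ := exists_isRoot_gt (p := u) (a := s n) (by omega)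
          (by simp [hum.leadingCoeff]) (by simpa using hsign n le_rfl)
        refine ⟨x, fun _ => ⟨hroot, fun _ => by omega, fun l hl => ?_⟩⟩
        obtain rfl : n = l := by omega
        exact hx
  choose t ht using hex
  have hint : Interlaces (n + 1) s t := fun i hi =>
    ⟨(ht i hi.le).2.1 (by omega), (ht (i + 1) hi).2.2 i rfl⟩
  refine ⟨t, hint, hum.eq_prod_X_sub_C_of_isRoot _ (by simpa using hud) t ?_ ?_⟩
  · have hlt' : ∀ i j, i < j → j < n + 2 → t i < t j := fun i j hij hj =>
      ((hint i (by omega)).1.trans (hint i (by omega)).2).trans_le (hint.le hij (by omega))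
    intro i hi j hj hij
    have hi' := Finset.mem_range.1 hi
    have hj' := Finset.mem_range.1 hj
    rcases lt_trichotomy i j with hlt | heq | hlt
    · exact absurd hij (hlt' i j hlt hj').ne
    · exact heq
    · exact absurd hij (hlt' j i hlt hi').ne'
  · intro i hi
    exact (ht i (by have := Finset.mem_range.1 hi; omega)).1

/-- The characteristic polynomials of the leading principal submatrices of a tridiagonal matrix
with diagonal entries `α i` and products of off-diagonal entries `β i`. -/
noncomputable def jacobiPoly (α β : ℕ → ℝ) : ℕ → ℝ[X]
  | 0 => 1
  | 1 => X - C (α 0)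
  | n + 2 => (X - C (α (n + 1))) * jacobiPoly α β (n + 1) - C (β (n + 1)) * jacobiPoly α β n

theorem jacobiPoly_interlaces_extend {α β : ℕ → ℝ} {N n : ℕ}
    (hβ : ∀ i, 1 ≤ i → i < N → 0 < β i) {r s : ℕ → ℝ} (h : Interlaces n r s)
    (hp : jacobiPoly α β n = ∏ i ∈ Finset.range n, (X - C (r i)))
    (hq : jacobiPoly α β (n + 1) = ∏ i ∈ Finset.range (n + 1), (X - C (s i)))
    (hn : n + 2 ≤ N) :
    ∃ t, Interlaces (n + 1) s t ∧
      jacobiPoly α β (n + 2) = ∏ i ∈ Finset.range (n + 2), (X - C (t i)) :=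
  h.exists_succ (hβ (n + 1) (by omega) (by omega)) hp hq rfl

theorem exists_jacobiPoly_interlaces {α β : ℕ → ℝ} {N : ℕ} (hβ : ∀ i, 1 ≤ i → i < N → 0 < β i)
    (n : ℕ) (hn : n + 1 ≤ N) :
    ∃ r s, Interlaces n r s ∧ jacobiPoly α β n = ∏ i ∈ Finset.range n, (X - C (r i)) ∧
      jacobiPoly α β (n + 1) = ∏ i ∈ Finset.range (n + 1), (X - C (s i)) := by
  induction n with
  | zero => exact ⟨0, fun _ => α 0, fun i hi => by omega, by simp [jacobiPoly], by simp [jacobiPoly]⟩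
  | succ n ih =>
    obtain ⟨r, s, h, hp, hq⟩ := ih (by omega)
    obtain ⟨t, ht, hu⟩ := jacobiPoly_interlaces_extend hβ h hp hq hn
    exact ⟨s, t, ht, hq, hu⟩

theorem jacobiPoly_roots_spread {α β : ℕ → ℝ} {N n : ℕ} (hn1 : 1 ≤ n)
    (hβ : ∀ i, 1 ≤ i → i < N → 0 < β i) {r s : ℕ → ℝ} (h : Interlaces n r s)
    (hp : jacobiPoly α β n = ∏ i ∈ Finset.range n, (X - C (r i)))
    (hq : jacobiPoly α β (n + 1) = ∏ i ∈ Finset.range (n + 1), (X - C (s i)))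
    (m : ℕ) (hm : n + 2 ≤ m) (hmN : m ≤ N) :
    ∃ x y z, (jacobiPoly α β m).IsRoot x ∧ (jacobiPoly α β m).IsRoot y ∧
      (jacobiPoly α β m).IsRoot z ∧ x < s 0 ∧ x < y ∧ y < s 1 ∧ s n < z := by
  have key : ∀ l, n + l + 2 ≤ N → ∃ s' t, Interlaces (n + l + 1) s' t ∧
      jacobiPoly α β (n + l + 1) = ∏ i ∈ Finset.range (n + l + 1), (X - C (s' i)) ∧
      jacobiPoly α β (n + l + 2) = ∏ i ∈ Finset.range (n + l + 2), (X - C (t i)) ∧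
      t 0 < s 0 ∧ t 1 < s 1 ∧ s n < t (n + l + 1) := by
    intro l hl
    induction l with
    | zero =>
      obtain ⟨t, ht, hu⟩ := jacobiPoly_interlaces_extend hβ h hp hq hl
      exact ⟨s, t, ht, hq, hu, (ht 0 (by omega)).1, (ht 1 (by omega)).1, (ht n (by omega)).2⟩
    | succ l ih =>
      obtain ⟨s', t, hst, hp', hq', h0, h1, h2⟩ := ih (by omega)
      obtain ⟨u, hu, hr⟩ := jacobiPoly_interlaces_extend hβ hst hp' hq' (by omega)
      exact ⟨t, u, hu, hq', hr, (hu 0 (by omega)).1.trans h0, (hu 1 (by omega)).1.trans h1,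
        h2.trans (hu (n + l + 1) (by omega)).2⟩
  obtain ⟨l, rfl⟩ := Nat.exists_eq_add_of_le hm
  obtain ⟨s', t, hst, -, hq', h0, h1, h2⟩ := key l (by omega)
  rw [show n + 2 + l = n + l + 2 by omega, hq']
  have hroot : ∀ i < n + l + 2, (∏ i ∈ Finset.range (n + l + 2), (X - C (t i))).IsRoot (t i) := by
    intro i hi
    rw [IsRoot, eval_prod]
    exact Finset.prod_eq_zero (Finset.mem_range.2 hi) (by simp)
  exact ⟨t 0, t 1, t (n + l + 1), hroot _ (by omega), hroot _ (by omega), hroot _ (by omega), h0,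
    (hst 0 (by omega)).1.trans (hst 0 (by omega)).2, h1, h2⟩

theorem jacobiPoly_eval_mul {α β b c w : ℕ → ℝ} {y : ℝ} {D : ℕ}
    (hβ : ∀ i, β i = b i * c i)
    (h0 : b 1 * w 1 = (y - α 0) * w 0)
    (hw : ∀ i, i + 2 ≤ D → b (i + 2) * w (i + 2) = (y - α (i + 1)) * w (i + 1) - c (i + 1) * w i)
    (i : ℕ) (hi : i ≤ D) :
    (∏ j ∈ Finset.range i, b (j + 1)) * w i = (jacobiPoly α β i).eval y * w 0 := by
  induction i using Nat.twoStepInduction with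
  | zero => simp [jacobiPoly]
  | one => simpa [jacobiPoly] using h0
  | more i ih1 ih2 =>
    have e1 := ih1 (by omega)
    have e2 := ih2 (by omega)
    have e3 := hw i hi
    rw [Finset.prod_range_succ] at e2
    rw [Finset.prod_range_succ, Finset.prod_range_succ, jacobiPoly, eval_sub, eval_mul, eval_mul,
      hβ]
    simp only [eval_sub, eval_X, eval_C]
    linear_combination (∏ j ∈ Finset.range i, b (j + 1)) * b (i + 1) * e3 +
      (y - α (i + 1)) * e2 - b (i + 1) * c (i + 1) * e1

theorem exists_recurrence_of_isRoot_charpoly {D k : ℕ} {b c : ℕ → ℕ} {θ : ℝ}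
    (hc0 : c 0 = 0) (hbD : b D = 0)
    (h : (intersectionMatrix D k b c).charpoly.IsRoot θ) :
    ∃ v : ℕ → ℝ, (∃ i ≤ D, v i ≠ 0) ∧ b 0 * (v 1 - v 0) = (θ - k) * v 0 ∧
      ∀ i, i + 1 ≤ D →
        b (i + 1) * (v (i + 2) - v (i + 1)) - c (i + 1) * (v (i + 1) - v i) =
          (θ - k) * v (i + 1) := by
  rw [IsRoot, Matrix.eval_charpoly] at h
  obtain ⟨v, hv0, hv⟩ := Matrix.exists_mulVec_eq_zero_iff.2 h
  rw [Matrix.sub_mulVec, sub_eq_zero] at hv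
  obtain ⟨u, hu⟩ : ∃ u : ℕ → ℝ, ∀ i : Fin (D + 1), u i = v i :=
    ⟨fun i => if hi : i < D + 1 then v ⟨i, hi⟩ else 0, fun i => dif_pos i.isLt⟩
  have hrow : ∀ i, i ≤ D → θ * u i = (∑ j ∈ Finset.range (D + 1),
      if j = i + 1 then (b i : ℝ) * u j else 0) + (∑ j ∈ Finset.range (D + 1),
      if j + 1 = i then (c i : ℝ) * u j else 0) + ∑ j ∈ Finset.range (D + 1),
      if j = i then ((k : ℝ) - b i - c i) * u j else 0 := by
    intro i hi
    have := congrFun hv ⟨i, by omega⟩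
    rw [Matrix.mulVec, Matrix.mulVec, dotProduct, dotProduct] at this
    rw [← Finset.sum_add_distrib, ← Finset.sum_add_distrib, Finset.sum_range]
    simp only [Matrix.scalar_apply, Matrix.diagonal_apply, ite_mul, zero_mul, Finset.sum_ite_eq,
      Finset.mem_univ, if_true] at this
    rw [← hu] at this
    rw [this]
    refine Finset.sum_congr rfl fun j _ => ?_
    rw [← hu, intersectionMatrix]
    simp only [Fin.ext_iff]
    split_ifs <;> first | omega | simp
  refine ⟨u, ?_, ?_, ?_⟩
  · obtain ⟨i, hi⟩ := Function.ne_iff.1 hv0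
    exact ⟨i, by omega, by rw [hu]; exact hi⟩
  · have := hrow 0 (by omega)
    simp only [Finset.sum_ite_eq', Finset.mem_range, hc0] at this
    rcases Nat.eq_zero_or_pos D with rfl | hD
    · simpa [hbD, sub_eq_zero] using this
    · simp [hD] at this; linarith
  · intro i hi
    have := hrow (i + 1) hi
    simp only [Finset.sum_ite_eq', Finset.mem_range, Nat.add_right_cancel_iff] at this
    rw [if_pos (show i < D + 1 by omega), if_pos (show i + 1 < D + 1 by omega)] at this
    rcases Nat.lt_or_ge (i + 1) D with hlt | hge
    · rw [if_pos (by omega)] at this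
      linarith
    · obtain rfl : i + 1 = D := by omega
      simp [hbD] at this ⊢
      linarith

theorem jacobiPoly_isRoot_of_isRoot_charpoly {D k : ℕ} {b c : ℕ → ℕ} {θ : ℝ} (hD : 1 ≤ D)
    (hc0 : c 0 = 0) (hc1 : c 1 = 1) (hb0 : b 0 = k) (hbD : b D = 0)
    (hb : ∀ i < D, 0 < b i) (hθ : θ ≠ k)
    (h : (intersectionMatrix D k b c).charpoly.IsRoot θ) :
    (jacobiPoly (fun i => (k : ℝ) + 1 - b i - c (i + 1)) (fun i => (b i : ℝ) * c i) D).IsRoot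
      (θ + 1) := by
  obtain ⟨v, ⟨m, hmD, hm⟩, h0, hrec⟩ := exists_recurrence_of_isRoot_charpoly hc0 hbD h
  have hk : (0 : ℝ) < k := by exact_mod_cast hb0 ▸ hb 0 (by omega)
  have hv0 : v 0 ≠ 0 := by
    intro hz
    have hall : ∀ i, (i ≤ D → v i = 0) ∧ (i + 1 ≤ D → v (i + 1) = 0) := by
      intro i
      induction i with
      | zero =>
        refine ⟨fun _ => hz, fun _ => ?_⟩
        rw [hz, hb0] at h0
        have : (k : ℝ) * v 1 = 0 := by linarith
        exact (mul_eq_zero.1 this).resolve_left hk.ne'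
      | succ i ih =>
        refine ⟨ih.2, fun hi => ?_⟩
        have e := hrec i (by omega)
        rw [ih.1 (by omega), ih.2 (by omega)] at e
        have hbi : ((b (i + 1) : ℕ) : ℝ) ≠ 0 := by exact_mod_cast (hb (i + 1) (by omega)).ne'
        have : (b (i + 1) : ℝ) * v (i + 2) = 0 := by linarith
        exact (mul_eq_zero.1 this).resolve_left hbi
    exact hm ((hall m).1 hmD)
  have hw0 : v 1 - v 0 ≠ 0 := by
    intro hz
    rw [hz, mul_zero] at h0
    exact mul_ne_zero (sub_ne_zero.2 hθ) hv0 h0.symm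
  have key := jacobiPoly_eval_mul (α := fun i => (k : ℝ) + 1 - b i - c (i + 1))
    (β := fun i => (b i : ℝ) * c i) (b := fun i => (b i : ℝ)) (c := fun i => (c i : ℝ))
    (w := fun i => v (i + 1) - v i) (y := θ + 1) (D := D) (fun _ => rfl)
    (by
      have := hrec 0 (by omega)
      simp only [hc1, hb0, zero_add, Nat.cast_one] at this h0 ⊢
      linear_combination this - h0)
    (by
      intro i hi
      have e1 := hrec i (by omega)
      have e2 := hrec (i + 1) (by omega)
      simp only [add_assoc, Nat.reduceAdd] at e1 e2 ⊢
      linear_combination e2 - e1) D le_rfl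
  have hprod : ∏ j ∈ Finset.range D, (b (j + 1) : ℝ) = 0 :=
    Finset.prod_eq_zero (Finset.mem_range.2 (by omega : D - 1 < D))
      (by rw [Nat.sub_add_cancel hD, hbD, Nat.cast_zero])
  simp only [hprod, zero_mul, zero_add] at key
  exact (mul_eq_zero.1 key.symm).resolve_right hw0

theorem jacobiPoly_eq_prod {D k : ℕ} {b c : ℕ → ℕ} (hD : 1 ≤ D)
    (hc0 : c 0 = 0) (hc1 : c 1 = 1) (hb0 : b 0 = k) (hbD : b D = 0) (hb : ∀ i < D, 0 < b i)
    (hc : ∀ i, 1 ≤ i → i ≤ D → 0 < c i)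
    {θ : Fin (D + 1) → ℝ} (hθ : StrictAnti θ) (hθ0 : θ 0 = k)
    (hchar : (intersectionMatrix D k b c).charpoly = ∏ i, (X - C (θ i))) :
    jacobiPoly (fun i => (k : ℝ) + 1 - b i - c (i + 1)) (fun i => (b i : ℝ) * c i) D =
      ∏ i : Fin D, (X - C (θ i.succ + 1)) := by
  obtain ⟨n, rfl⟩ : ∃ n, D = n + 1 := ⟨D - 1, by omega⟩
  obtain ⟨-, s, -, -, hs⟩ := exists_jacobiPoly_interlaces
    (α := fun i => (k : ℝ) + 1 - b i - c (i + 1)) (β := fun i => (b i : ℝ) * c i) (N := n + 1)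
    (fun i h1 h2 => mul_pos (by exact_mod_cast hb i h2) (by exact_mod_cast hc i h1 h2.le)) n le_rfl
  refine Monic.eq_prod_X_sub_C_of_isRoot _ (hs ▸ monic_prod_X_sub_C _ _) ?_ _ ?_ ?_
  · rw [hs, natDegree_finsetProd_X_sub_C_eq_card]
    simp
  · intro i _ j _ hij
    exact Fin.succ_injective _ (hθ.injective (by simpa using hij))
  · intro i _
    refine jacobiPoly_isRoot_of_isRoot_charpoly hD hc0 hc1 hb0 hbD hb ?_ ?_
    · rw [← hθ0]
      exact (hθ (Fin.succ_pos i)).ne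
    · rw [hchar, IsRoot, eval_prod]
      exact Finset.prod_eq_zero (Finset.mem_univ i.succ) (by simp)

namespace SimpleGraph

theorem Connected.exists_adj_dist_eq {V : Type*} {G : SimpleGraph V} (hG : G.Connected) {x y : V}
    {n : ℕ} (h : G.dist x y = n + 1) : ∃ z, G.Adj y z ∧ G.dist x z = n := by
  obtain ⟨p, hp⟩ := hG.exists_walk_length_eq_dist y x
  rw [dist_comm, h] at hp
  cases p with
  | nil => simp at hp
  | @cons _ z _ hadj q =>
    refine ⟨z, hadj, ?_⟩
    have h1 : G.dist x z ≤ n := by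
      rw [dist_comm]
      exact (dist_le q).trans (by simp at hp; omega)
    have h2 := hG.dist_triangle (u := x) (v := z) (w := y)
    rw [dist_eq_one_iff_adj.2 hadj.symm] at h2
    omega

variable {V : Type*} {G : SimpleGraph V} {D : ℕ} {b c : ℕ → ℕ}

theorem IsDRGWith.exists_dist_eq (h : G.IsDRGWith D b c) {i : ℕ} (hi : i ≤ D) :
    ∃ x y, G.dist x y = i := by
  obtain ⟨x, y, hxy⟩ := h.2.2.1
  induction hi using Nat.decreasingInduction with
  | self => exact ⟨x, y, hxy⟩
  | of_succ i _ ih =>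
    obtain ⟨x, y, hxy⟩ := ih
    obtain ⟨z, -, hz⟩ := h.1.exists_adj_dist_eq hxy
    exact ⟨x, z, hz⟩

theorem IsDRGWith.c_pos [Finite V] (h : G.IsDRGWith D b c) {i : ℕ} (h1 : 1 ≤ i) (hi : i ≤ D) :
    0 < c i := by
  obtain ⟨x, y, hxy⟩ := h.exists_dist_eq hi
  obtain ⟨j, rfl⟩ : ∃ j, i = j + 1 := ⟨i - 1, by omega⟩
  obtain ⟨z, hz⟩ := h.1.exists_adj_dist_eq hxy
  rw [← (h.2.2.2 _ x y hi hxy).2, Set.ncard_pos]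
  exact ⟨z, by simpa using hz⟩

theorem IsDRGWith.b_pos [Finite V] (h : G.IsDRGWith D b c) {i : ℕ} (hi : i < D) : 0 < b i := by
  obtain ⟨x, y, hxy⟩ := h.exists_dist_eq hi
  obtain ⟨z, hyz, hz⟩ := h.1.exists_adj_dist_eq hxy
  rw [← (h.2.2.2 _ x z hi.le hz).1, Set.ncard_pos]
  exact ⟨y, hyz.symm, hxy⟩

theorem IsDRGWith.b_diam [Finite V] (h : G.IsDRGWith D b c) : b D = 0 := by
  obtain ⟨x, y, hxy⟩ := h.2.2.1
  rw [← (h.2.2.2 _ x y le_rfl hxy).1, Set.ncard_eq_zero, Set.eq_empty_iff_forall_notMem]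
  rintro z ⟨-, hz⟩
  have := h.2.1 x z
  omega

theorem IsDRGWith.c_zero [Finite V] (h : G.IsDRGWith D b c) : c 0 = 0 := by
  obtain ⟨x, -⟩ := h.2.2.1
  rw [← (h.2.2.2 0 x x (Nat.zero_le _) dist_self).2, Set.ncard_eq_zero,
    Set.eq_empty_iff_forall_notMem]
  rintro z ⟨hadj, hz⟩
  rw [dist_eq_one_iff_adj.2 hadj] at hz
  omega

end SimpleGraph

theorem stmt_12 {V : Type*} [Fintype V] (G : SimpleGraph V) [DecidableRel G.Adj] (D k : ℕ) (hD : 3 ≤ D)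
    (b c : ℕ → ℕ) (hdrg : G.IsDRGWith D b c)
    (hreg : G.IsRegularOfDegree k) (hb0 : b 0 = k) (hc1 : c 1 = 1)
    (θ : Fin (D+1) → ℝ) (hθ : StrictAnti θ) (hθ0 : θ 0 = k)
    (hchar : (intersectionMatrix D k b c).charpoly = ∏ i, (X - C (θ i)))
    (hcond : (k : ℝ) + 1 ≤ (b 2 : ℝ) + (c 3 : ℝ)) :
    (θ 1 + 1) * (θ ⟨D - 1, by omega⟩ + 1) * (θ (Fin.last D) + 1) ≥
        -(b 1 : ℝ) * ((k : ℝ) + 1 - (b 2 : ℝ) - (c 3 : ℝ)) ∧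
      ((θ 1 + 1) * (θ ⟨D - 1, by omega⟩ + 1) * (θ (Fin.last D) + 1) =
        -(b 1 : ℝ) * ((k : ℝ) + 1 - (b 2 : ℝ) - (c 3 : ℝ)) ↔ D = 3) := by
  have hc0 := hdrg.c_zero
  have hbD := hdrg.b_diam
  have hb : ∀ i < D, 0 < b i := fun i hi => hdrg.b_pos hi
  have hc : ∀ i, 1 ≤ i → i ≤ D → 0 < c i := fun i h1 hi => hdrg.c_pos h1 hi
  have hfact := jacobiPoly_eq_prod (by omega) hc0 hc1 hb0 hbD hb hc hθ hθ0 hchar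
  set α : ℕ → ℝ := fun i => (k : ℝ) + 1 - b i - c (i + 1) with hα
  set β : ℕ → ℝ := fun i => (b i : ℝ) * c i with hβ
  have hα0 : α 0 = 0 := by simp [hα, hb0, hc1]
  have hα2 : α 2 = k + 1 - b 2 - c 3 := rfl
  have hβ1 : β 1 = b 1 := by simp [hβ, hc1]
  have hβpos : ∀ i, 1 ≤ i → i < D → 0 < β i := fun i h1 h2 =>
    mul_pos (by exact_mod_cast hb i h2) (by exact_mod_cast hc i h1 h2.le)
  have hp2 : (jacobiPoly α β 2).eval 0 = -b 1 := by
    simp [jacobiPoly, hα0, hβ1]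
  have hp3 : (jacobiPoly α β 3).eval 0 = α 2 * b 1 := by
    simp [jacobiPoly, hα0, hβ1]
  rcases Nat.lt_or_ge 3 D with hlt | hge
  · obtain ⟨r, s, hrs, hp, hq⟩ := exists_jacobiPoly_interlaces (α := α) hβpos 2 hD
    obtain ⟨x, y, z, hx, hy, hz, hx0, hxy, hy1, hz2⟩ :=
      jacobiPoly_roots_spread (by omega) hβpos hrs hp hq D hlt le_rfl
    have hroot : ∀ x, (jacobiPoly α β D).IsRoot x → ∃ i : Fin D, x = θ i.succ + 1 := by
      intro x hx
      rw [hfact, IsRoot, eval_prod, Finset.prod_eq_zero_iff] at hx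
      obtain ⟨i, -, hi⟩ := hx
      exact ⟨i, by simpa [sub_eq_zero] using hi⟩
    obtain ⟨ix, rfl⟩ := hroot x hx
    obtain ⟨iy, rfl⟩ := hroot y hy
    obtain ⟨iz, rfl⟩ := hroot z hz
    have hlast : θ (Fin.last D) ≤ θ ix.succ := hθ.antitone (Fin.le_last _)
    have hpen : θ ⟨D - 1, by omega⟩ ≤ θ iy.succ := by
      refine hθ.antitone ?_
      have hyx : iy < ix := Fin.succ_lt_succ_iff.1 (hθ.lt_iff_gt.1 (by linarith))
      have := ix.isLt
      rw [Fin.lt_def] at hyx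
      rw [Fin.le_def, Fin.val_succ]
      simp only
      omega
    have hone : θ iz.succ ≤ θ 1 := by
      refine hθ.antitone ?_
      rw [Fin.le_def, Fin.val_succ, Fin.val_one', Nat.mod_eq_of_lt (by omega)]
      omega
    have hb1 : (0 : ℝ) < b 1 := by exact_mod_cast hb 1 (by omega)
    have hr : r 0 * r 1 = -b 1 := by
      rw [← hp2, hp]; simp [Finset.prod_range_succ]
    have hs : s 0 * s 1 * s 2 = -b 1 * α 2 := by
      have : (jacobiPoly α β 3).eval 0 = -(s 0 * s 1 * s 2) := by
        rw [hq]; simp [Finset.prod_range_succ]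
      linarith
    have h0 := hrs 0 (by omega)
    have h1 := hrs 1 (by omega)
    have hr0 : r 0 < 0 := by nlinarith
    have hr1 : 0 < r 1 := by nlinarith
    have hs1 : s 1 ≤ 0 := by
      by_contra! hpos
      have : s 0 * (s 1 * s 2) < 0 :=
        mul_neg_of_neg_of_pos (by linarith) (mul_pos hpos (by linarith))
      nlinarith
    have hstrict : -(b 1 : ℝ) * α 2 <
        (θ 1 + 1) * (θ ⟨D - 1, by omega⟩ + 1) * (θ (Fin.last D) + 1) := by
      set A := θ 1 + 1
      set B := θ ⟨D - 1, by omega⟩ + 1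
      set E := θ (Fin.last D) + 1
      have hA : s 2 < A := by linarith
      have hB : B < s 1 := by linarith
      have hE : E < s 0 := by linarith
      have e1 : (-s 0) * (-s 1) < (-E) * (-B) :=
        mul_lt_mul'' (by linarith) (by linarith) (by linarith) (by linarith)
      have e2 : s 2 * ((-s 0) * (-s 1)) < A * ((-E) * (-B)) :=
        mul_lt_mul'' hA e1 (by linarith) (mul_nonneg (by linarith) (by linarith))
      linarith
    rw [← hα2]
    exact ⟨hstrict.le, fun h => absurd h hstrict.ne', fun h => by omega⟩
  · obtain rfl : D = 3 := by omega
    have heq : (θ 1 + 1) * (θ 2 + 1) * (θ 3 + 1) = -(b 1 : ℝ) * α 2 := by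
      have : (jacobiPoly α β 3).eval 0 = -((θ 1 + 1) * (θ 2 + 1) * (θ 3 + 1)) := by
        rw [hfact, eval_prod, Fin.prod_univ_three]
        simp only [eval_sub, eval_X, eval_C]
        have : (1 : Fin 3).succ = 2 := rfl
        have : (2 : Fin 3).succ = 3 := rfl
        have : (0 : Fin 3).succ = 1 := rfl
        simp only [*]
        ring
      linarith
    rw [← hα2]
    exact ⟨heq.ge, fun _ => rfl, fun _ => heq⟩
end

section
/- Let Γ be a distance-regular graph of diameter D ≥ 3 with valency k, intersection numbers b_i, c_i, and distinct eigenvalues k = θ₀ > θ₁ > ⋯ > θ_D. If b₂ + c₃ ≤ k + 1, then (θ₁+1)(θ₂+1)(θ_D+1) ≤ −b₁(k + 1 − b₂ − c₃), with equality if and only if D = 3. -/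
open Polynomial

/-- In a distance-regular graph, `b i > 0` below the diameter and `c i > 0` for positive `i` up to
the diameter. -/
theorem SimpleGraph.IsDRGWith.pos {V : Type*} [Fintype V] {G : SimpleGraph V} {D : ℕ}
    {b c : ℕ → ℕ} (h : G.IsDRGWith D b c) {i : ℕ} (hi : i < D) : 0 < b i ∧ 0 < c (i + 1) := by
  obtain ⟨hconn, -, ⟨x, y, hxy⟩, hreg⟩ := h
  obtain ⟨p, hp⟩ := hconn.exists_walk_length_eq_dist x y
  have hdist : ∀ j ≤ D, G.dist x (p.getVert j) = j := by
    intro j hj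
    have h1 := SimpleGraph.dist_le (p.take j)
    have h2 := SimpleGraph.dist_le (p.drop j)
    have h3 := hconn.dist_triangle (u := x) (v := p.getVert j) (w := y)
    rw [SimpleGraph.Walk.take_length] at h1
    rw [SimpleGraph.Walk.drop_length] at h2
    omega
  have hadj : G.Adj (p.getVert i) (p.getVert (i + 1)) := p.adj_getVert_succ (by omega)
  constructor
  · rw [← (hreg i x _ hi.le (hdist i hi.le)).1, Set.ncard_pos]
    exact ⟨_, hadj, hdist _ hi⟩
  · rw [← (hreg (i + 1) x _ hi (hdist _ hi)).2, Set.ncard_pos]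
    exact ⟨_, hadj.symm, hdist _ hi.le⟩

theorem SimpleGraph.IsDRGWith.b_diam_s13 {V : Type*} {G : SimpleGraph V} {D : ℕ}
    {b c : ℕ → ℕ} (h : G.IsDRGWith D b c) : b D = 0 := by
  obtain ⟨-, hle, ⟨x, y, hxy⟩, hreg⟩ := h
  rw [← (hreg D x y le_rfl hxy).1]
  convert Set.ncard_empty V
  ext z
  have := hle x z
  simp only [Set.mem_ofPred_eq, Set.mem_empty_iff_false, iff_false]
  omega

theorem SimpleGraph.IsDRGWith.c_zero_s13 {V : Type*} {G : SimpleGraph V} {D : ℕ}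
    {b c : ℕ → ℕ} (h : G.IsDRGWith D b c) : c 0 = 0 := by
  obtain ⟨hconn, -, ⟨x, -⟩, hreg⟩ := h
  rw [← (hreg 0 x x (Nat.zero_le _) SimpleGraph.dist_self).2]
  convert Set.ncard_empty V
  ext z
  simp only [Set.mem_ofPred_eq, Set.mem_empty_iff_false, iff_false, not_and]
  intro hz h0
  exact hz.ne (hconn.dist_eq_zero_iff.1 h0)

/-- The rows of the eigenvalue equation of the intersection matrix. -/
theorem intersectionMatrix_mulVec (D k : ℕ) (b c : ℕ → ℕ) (hbD : b D = 0) (hc0 : c 0 = 0)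
    (U : ℕ → ℝ) (i : Fin (D + 1)) :
    (intersectionMatrix D k b c).mulVec (fun j => U j) i =
      c i * U (i - 1) + ((k : ℝ) - b i - c i) * U i + b i * U (i + 1) := by
  obtain ⟨i, hi⟩ := i
  have hsplit : ∀ j : Fin (D + 1), intersectionMatrix D k b c ⟨i, hi⟩ j * U j =
      (if (j : ℕ) = i + 1 then (b i : ℝ) * U (i + 1) else 0) +
      (if (j : ℕ) = i - 1 then (c i : ℝ) * U (i - 1) else 0) +
      (if (j : ℕ) = i then ((k : ℝ) - b i - c i) * U i else 0) := by
    intro j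
    simp only [intersectionMatrix, Fin.ext_iff]
    rcases Nat.eq_zero_or_pos i with rfl | hpos
    · simp only [hc0]
      split_ifs <;> first | omega | simp_all
    · split_ifs <;> first | omega | simp_all
  simp only [Matrix.mulVec, dotProduct, hsplit, Finset.sum_add_distrib]
  rw [Fin.sum_univ_eq_sum_range (fun j => if j = i + 1 then (b i : ℝ) * U (i + 1) else 0),
    Fin.sum_univ_eq_sum_range (fun j => if j = i - 1 then (c i : ℝ) * U (i - 1) else 0),
    Fin.sum_univ_eq_sum_range (fun j => if j = i then ((k : ℝ) - b i - c i) * U i else 0)]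
  simp only [Finset.sum_ite_eq', Finset.mem_range]
  rw [if_pos hi, if_pos (show i - 1 < D + 1 by omega)]
  split_ifs with h
  · ring
  · obtain rfl : i = D := by omega
    simp only [hbD]
    push_cast
    ring

/-- The differences of consecutive entries of an eigenvector of the intersection matrix for an
eigenvalue other than the valency form an eigenvector of a smaller tridiagonal matrix. -/
theorem exists_reduced_eigenvector {D k : ℕ} (hD : 0 < D) {b c : ℕ → ℕ} (hb : ∀ i < D, 0 < b i)
    (hbD : b D = 0) (hc0 : c 0 = 0) (hb0 : b 0 = k) {t : ℝ} (htk : t ≠ k)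
    (ht : (intersectionMatrix D k b c).charpoly.eval t = 0) :
    ∃ d : ℕ → ℝ, d 0 = 0 ∧ d 1 = 1 ∧ ∀ n < D,
      c n * d n + ((k : ℝ) - b n - c (n + 1)) * d (n + 1) + b (n + 1) * d (n + 2) =
        t * d (n + 1) := by
  rw [Matrix.eval_charpoly] at ht
  obtain ⟨u, hu0, hu⟩ := Matrix.exists_mulVec_eq_zero_iff.2 ht
  obtain ⟨U, hU⟩ : ∃ U : ℕ → ℝ, u = fun j : Fin (D + 1) => U j :=
    ⟨fun n => if h : n < D + 1 then u ⟨n, h⟩ else 0, by ext j; simp [j.2]⟩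
  have hrow : ∀ i ≤ D, c i * U (i - 1) + ((k : ℝ) - b i - c i) * U i + b i * U (i + 1) =
      t * U i := by
    intro i hi
    have h := congrFun hu ⟨i, Nat.lt_succ_of_le hi⟩
    rw [Matrix.sub_mulVec, Pi.sub_apply, hU, intersectionMatrix_mulVec D k b c hbD hc0] at h
    simp only [Matrix.scalar_apply, Matrix.mulVec_diagonal, Pi.zero_apply] at h
    linarith
  let d : ℕ → ℝ := fun n => if n = 0 then 0 else U n - U (n - 1)
  have hdS : ∀ n, d (n + 1) = U (n + 1) - U n := fun n => by simp [d]
  have hrec : ∀ n < D,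
      c n * d n + ((k : ℝ) - b n - c (n + 1)) * d (n + 1) + b (n + 1) * d (n + 2) =
        t * d (n + 1) := by
    intro n hn
    have h1 := hrow n hn.le
    have h2 := hrow (n + 1) hn
    rw [Nat.add_sub_cancel] at h2
    rw [hdS, hdS]
    cases n with
    | zero =>
      simp only [hc0, Nat.cast_zero, zero_mul, zero_add] at h1 h2 ⊢
      linear_combination h2 - h1
    | succ m =>
      rw [Nat.add_sub_cancel] at h1
      rw [hdS]
      linear_combination h2 - h1
  have hd0 : d 0 = 0 := by simp [d]
  have hd1 : d 1 ≠ 0 := by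
    intro h1
    have hzero : ∀ n < D, d n = 0 ∧ d (n + 1) = 0 := by
      intro n
      induction n with
      | zero => exact fun _ => ⟨hd0, h1⟩
      | succ n ih =>
        intro hn
        obtain ⟨ha, hb'⟩ := ih (by omega)
        refine ⟨hb', ?_⟩
        have h := hrec n (by omega)
        rw [ha, hb'] at h
        have hpos : (b (n + 1) : ℝ) ≠ 0 := by exact_mod_cast (hb _ hn).ne'
        simpa [hpos] using h
    have hconst : ∀ n ≤ D, U n = U 0 := by
      intro n
      induction n with
      | zero => exact fun _ => rfl
      | succ n ih =>
        intro hn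
        have h := (hzero n hn).2
        rw [hdS] at h
        linarith [ih (by omega)]
    have h0 := hrow 0 (Nat.zero_le _)
    rw [hconst (0 + 1) hD, hc0, hb0] at h0
    have : (t - k) * U 0 = 0 := by
      push_cast at h0
      linear_combination -h0
    have hU0 : U 0 = 0 := by
      rcases mul_eq_zero.1 this with h | h
      · exact absurd (sub_eq_zero.1 h) htk
      · exact h
    apply hu0
    ext j
    rw [hU]
    simpa [hU0] using hconst j (Nat.le_of_lt_succ j.2)
  refine ⟨fun n => d n / d 1, by simp [hd0], div_self hd1, fun n hn => ?_⟩
  have h := hrec n hn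
  field_simp
  linear_combination h

/-- Eigenvectors of a tridiagonal matrix for distinct eigenvalues are orthogonal for the weights
that symmetrize it. -/
theorem sum_weighted_mul_eigenvector_eq_zero {D : ℕ} {a b c ρ : ℕ → ℝ} (hbD : b D = 0)
    (hρ : ∀ n, n + 1 < D → ρ (n + 1) * c (n + 1) = ρ n * b (n + 1)) {s t : ℝ} (hst : s ≠ t)
    {d e : ℕ → ℝ} (hd0 : d 0 = 0) (he0 : e 0 = 0)
    (hd : ∀ n < D, c n * d n + a n * d (n + 1) + b (n + 1) * d (n + 2) = s * d (n + 1))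
    (he : ∀ n < D, c n * e n + a n * e (n + 1) + b (n + 1) * e (n + 2) = t * e (n + 1)) :
    ∑ n ∈ Finset.range D, ρ n * (d (n + 1) * e (n + 1)) = 0 := by
  have key : ∀ m < D, (s - t) * ∑ n ∈ Finset.range (m + 1), ρ n * (d (n + 1) * e (n + 1)) =
      ρ m * b (m + 1) * (d (m + 2) * e (m + 1) - d (m + 1) * e (m + 2)) := by
    intro m
    induction m with
    | zero =>
      intro hm
      have h1 := hd 0 hm
      have h2 := he 0 hm
      rw [hd0] at h1
      rw [he0] at h2
      simp only [Finset.sum_range_one, zero_add] at h1 h2 ⊢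
      linear_combination ρ 0 * d 1 * h2 - ρ 0 * e 1 * h1
    | succ m ih =>
      intro hm
      rw [Finset.sum_range_succ, mul_add, ih (by omega)]
      have h1 := hd (m + 1) hm
      have h2 := he (m + 1) hm
      linear_combination ρ (m + 1) * d (m + 2) * h2 - ρ (m + 1) * e (m + 2) * h1 -
        (d (m + 2) * e (m + 1) - d (m + 1) * e (m + 2)) * hρ m hm
  cases D with
  | zero => simp
  | succ D =>
    have h := key D (by omega)
    rw [hbD] at h
    simpa [sub_ne_zero.2 hst] using h

/-- A complete family of eigenvectors, orthogonal for a positive weight, is also orthogonal in the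
dual sense. -/
theorem exists_dual_orthogonal {D : ℕ} {ρ : ℕ → ℝ} (hρ : ∀ n < D, 0 < ρ n) {d : Fin D → ℕ → ℝ}
    (hd1 : ∀ i, d i 1 = 1)
    (horth : ∀ i j, i ≠ j →
      ∑ n ∈ Finset.range D, ρ n * (d i (n + 1) * d j (n + 1)) = 0) :
    ∃ w : Fin D → ℝ, (∀ i, 0 < w i) ∧
      ∀ n < D, ∀ m < D, n ≠ m → ∑ i, w i * (d i (n + 1) * d i (m + 1)) = 0 := by
  let N : Fin D → ℝ := fun i => ∑ n ∈ Finset.range D, ρ n * (d i (n + 1) * d i (n + 1))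
  have hN : ∀ i, 0 < N i := by
    intro i
    have hD : 0 < D := i.pos
    refine Finset.sum_pos' (fun n hn => ?_) ⟨0, Finset.mem_range.2 hD, ?_⟩
    · exact mul_nonneg (hρ n (Finset.mem_range.1 hn)).le (mul_self_nonneg _)
    · simpa [hd1] using hρ 0 hD
  let A : Matrix (Fin D) (Fin D) ℝ := fun i n => d i (n + 1)
  let E : Matrix (Fin D) (Fin D) ℝ := fun n i => ρ n * d i (n + 1) * (N i)⁻¹
  have hAE : A * E = 1 := by
    ext i j
    have hsum : (A * E) i j =
        (∑ n ∈ Finset.range D, ρ n * (d i (n + 1) * d j (n + 1))) * (N j)⁻¹ := by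
      rw [Matrix.mul_apply, Finset.sum_mul,
        ← Fin.sum_univ_eq_sum_range
          (fun n => ρ n * (d i (n + 1) * d j (n + 1)) * (N j)⁻¹)]
      refine Finset.sum_congr rfl fun n _ => ?_
      simp only [A, E]
      ring
    rw [hsum]
    by_cases hij : i = j
    · subst hij
      rw [Matrix.one_apply_eq]
      exact mul_inv_cancel₀ (hN i).ne'
    · rw [horth i j hij, Matrix.one_apply_ne hij, zero_mul]
  have hEA : E * A = 1 := mul_eq_one_comm.1 hAE
  refine ⟨fun i => (N i)⁻¹, fun i => inv_pos.2 (hN i), fun n hn m hm hnm => ?_⟩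
  have h := congrFun (congrFun hEA ⟨n, hn⟩) ⟨m, hm⟩
  rw [Matrix.one_apply_ne (by simpa using hnm), Matrix.mul_apply] at h
  have h' : ρ n * ∑ i, (N i)⁻¹ * (d i (n + 1) * d i (m + 1)) = 0 := by
    rw [← h, Finset.mul_sum]
    refine Finset.sum_congr rfl fun i _ => ?_
    simp only [A, E]
    ring
  exact (mul_eq_zero.1 h').resolve_left (hρ n hn).ne'

/-- A cubic orthogonal to all quadratics for a positive measure with at least four atoms: its roots
interlace with the extreme atoms. -/
theorem roots_lt_of_orthogonal {m : ℕ} {Y w : Fin (m + 4) → ℝ} (hY : StrictAnti Y)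
    (hw : ∀ i, 0 < w i) {p q r : ℝ} (hpq : q < p) (hqr : r < q)
    (horth : ∀ x y z : ℝ, ∑ i, w i * (((Y i - p) * (Y i - q) * (Y i - r)) *
      (x * Y i ^ 2 + y * Y i + z)) = 0) :
    p < Y 0 ∧ q < Y 1 ∧ Y (Fin.last _) < r := by
  have h01 : Y 1 < Y 0 := hY (by simp)
  have h12 : Y 2 < Y 1 := hY (by
    simp [Fin.lt_def, Nat.mod_eq_of_lt (show 2 < m + 4 by omega)])
  have h23 : Y 3 < Y 2 := hY (by
    simp [Fin.lt_def, Nat.mod_eq_of_lt (show 2 < m + 4 by omega),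
      Nat.mod_eq_of_lt (show 3 < m + 4 by omega)])
  have vanish : ∀ x y z : ℝ,
      (∀ i, ((Y i - p) * (Y i - q) * (Y i - r)) * (x * Y i ^ 2 + y * Y i + z) ≤ 0) →
      ∀ i, ((Y i - p) * (Y i - q) * (Y i - r)) * (x * Y i ^ 2 + y * Y i + z) = 0 := by
    intro x y z hle i
    have h := (Finset.sum_eq_zero_iff_of_nonpos
      (fun i _ => mul_nonpos_of_nonneg_of_nonpos (hw i).le (hle i))).1 (horth x y z) i
      (Finset.mem_univ i)
    exact (mul_eq_zero.1 h).resolve_left (hw i).ne'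
  have hp : p < Y 0 := by
    by_contra! hcon
    have hz := vanish 1 (-(q + r)) (q * r) (fun i => by
      have h0 : Y i ≤ Y 0 := hY.antitone (Fin.zero_le i)
      have : (Y i - p) * ((Y i - q) * (Y i - r)) ^ 2 ≤ 0 :=
        mul_nonpos_of_nonpos_of_nonneg (by linarith) (sq_nonneg _)
      linarith)
    have hroot : ∀ i, Y i = p ∨ Y i = q ∨ Y i = r := by
      intro i
      have h : (Y i - p) * (Y i - q) ^ 2 * (Y i - r) ^ 2 = 0 := by linear_combination hz i
      simpa [sub_eq_zero, or_assoc] using h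
    rcases hroot 0 with h | h | h <;> rcases hroot 1 with h' | h' | h' <;>
      rcases hroot 2 with h'' | h'' | h'' <;> rcases hroot 3 with h3 | h3 | h3 <;> linarith
  refine ⟨hp, ?_, ?_⟩
  · by_contra! hcon
    have hi : ∀ i, i ≠ 0 → Y i ≤ Y 1 := fun i h =>
      hY.antitone (Fin.one_le_of_ne_zero h)
    have hz := vanish 1 (-(r + Y 0)) (r * Y 0) (fun i => by
      by_cases h : i = 0
      · subst h
        apply le_of_eq
        ring
      · have h1 := hi i h
        have : (Y i - p) * ((Y i - q) * (Y i - Y 0)) * (Y i - r) ^ 2 ≤ 0 :=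
          mul_nonpos_of_nonpos_of_nonneg (mul_nonpos_of_nonpos_of_nonneg (by linarith)
            (mul_nonneg_of_nonpos_of_nonpos (by linarith) (by linarith))) (sq_nonneg _)
        linarith)
    have hroot : ∀ i, Y i ≤ Y 1 → Y i = q ∨ Y i = r := by
      intro i h1
      have h : (Y i - p) * (Y i - Y 0) * ((Y i - q) * (Y i - r) ^ 2) = 0 := by
        linear_combination hz i
      have h2 : (Y i - p) * (Y i - Y 0) ≠ 0 :=
        mul_ne_zero (by intro; linarith) (by intro; linarith)
      simpa [sub_eq_zero] using (mul_eq_zero.1 h).resolve_left h2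
    rcases hroot 1 le_rfl with h' | h' <;> rcases hroot 2 h12.le with h'' | h'' <;>
      rcases hroot 3 (by linarith) with h3 | h3 <;> linarith
  · by_contra! hcon
    have hz := vanish (-1) (p + q) (-(p * q)) (fun i => by
      have h0 : Y (Fin.last _) ≤ Y i := hY.antitone (Fin.le_last i)
      have : 0 ≤ (Y i - r) * ((Y i - p) * (Y i - q)) ^ 2 :=
        mul_nonneg (by linarith) (sq_nonneg _)
      linarith)
    have hroot : ∀ i, Y i = p ∨ Y i = q ∨ Y i = r := by
      intro i
      have h : (Y i - p) ^ 2 * (Y i - q) ^ 2 * (Y i - r) = 0 := by linear_combination -hz i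
      simpa [sub_eq_zero, or_assoc] using h
    rcases hroot 0 with h | h | h <;> rcases hroot 1 with h' | h' | h' <;>
      rcases hroot 2 with h'' | h'' | h'' <;> rcases hroot 3 with h3 | h3 | h3 <;> linarith

/-- A monic cubic with three distinct roots is the product of its linear factors. -/
theorem cubic_eq_of_roots {u v w p q r : ℝ} (hpq : p ≠ q) (hqr : q ≠ r) (hpr : p ≠ r)
    (hp : p ^ 3 + u * p ^ 2 + v * p + w = 0) (hq : q ^ 3 + u * q ^ 2 + v * q + w = 0)
    (hr : r ^ 3 + u * r ^ 2 + v * r + w = 0) :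
    u = -(p + q + r) ∧ v = p * q + q * r + p * r ∧ w = -(p * q * r) := by
  have h1 : p ^ 2 + p * q + q ^ 2 + u * (p + q) + v = 0 := by
    apply mul_left_cancel₀ (sub_ne_zero.2 hpq)
    linear_combination hp - hq
  have h2 : r ^ 2 + r * q + q ^ 2 + u * (r + q) + v = 0 := by
    apply mul_left_cancel₀ (sub_ne_zero.2 hqr)
    linear_combination hq - hr
  have hu : p + q + r + u = 0 := by
    apply mul_left_cancel₀ (sub_ne_zero.2 hpr)
    linear_combination h1 - h2
  have hu' : u = -(p + q + r) := by linarith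
  have hv : v = p * q + q * r + p * r := by
    subst hu'
    linear_combination h1
  refine ⟨hu', hv, ?_⟩
  subst hu' hv
  linear_combination hp

/-- The characteristic polynomial of a tridiagonal `3 × 3` matrix with vanishing corner entry and
nonnegative last diagonal entry has one negative, one nonnegative and one positive root. -/
theorem exists_roots_cubic {a e β μ : ℝ} (he : 0 ≤ e) (hβ : 0 < β) (hμ : 0 < μ) :
    ∃ p q r : ℝ, r < 0 ∧ 0 ≤ q ∧ q < p ∧
      ∀ y, (y - e) * (y ^ 2 - a * y - β) - μ * y = (y - p) * (y - q) * (y - r) := by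
  obtain ⟨s, t, hs, ht, rfl, hst⟩ : ∃ s t : ℝ, 0 < s ∧ t < 0 ∧ a = s + t ∧ β = s * -t := by
    have hsq : √(a ^ 2 + 4 * β) ^ 2 = a ^ 2 + 4 * β := Real.sq_sqrt (by positivity)
    have habs : |a| < √(a ^ 2 + 4 * β) := by
      apply abs_lt_of_sq_lt_sq _ (Real.sqrt_nonneg _)
      linarith
    obtain ⟨h1, h2⟩ := abs_lt.1 habs
    refine ⟨(a + √(a ^ 2 + 4 * β)) / 2, (a - √(a ^ 2 + 4 * β)) / 2, by linarith, by linarith,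
      by ring, ?_⟩
    linear_combination -hsq / 4
  subst hst
  let f : ℝ → ℝ := fun y => (y - e) * (y - s) * (y - t) - μ * y
  have hf : Continuous f := by fun_prop
  have hfs : f s < 0 := by
    have : f s = -(μ * s) := by simp only [f]; ring
    linarith [mul_pos hμ hs]
  have hft : 0 < f t := by
    have : f t = μ * -t := by simp only [f]; ring
    rw [this]
    exact mul_pos hμ (by linarith)
  have hf0 : 0 ≤ f 0 := by
    have : f 0 = e * (s * -t) := by simp only [f]; ring
    rw [this]
    positivity
  have htop : 0 < f (s + e + μ + 1) := by
    have h1 : μ < (s + μ + 1) * (e + μ + 1) := by nlinarith [mul_nonneg hs.le he]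
    have h2 : 0 < (s + e + μ + 1) * ((s + μ + 1) * (e + μ + 1) - μ) :=
      mul_pos (by positivity) (by linarith)
    have h3 : 0 < (s + μ + 1) * (e + μ + 1) * -t := mul_pos (by positivity) (by linarith)
    simp only [f]
    linarith
  have hbot : f (t - μ - 1) < 0 := by
    have h1 : μ < (μ + 1 - t + s) * (μ + 1) := by nlinarith
    have h2 : 0 < (μ + 1 - t) * ((μ + 1 - t + s) * (μ + 1) - μ) :=
      mul_pos (by linarith) (by linarith)
    have h3 : 0 ≤ e * ((μ + 1 - t + s) * (μ + 1)) :=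
      mul_nonneg he (mul_nonneg (by linarith) (by linarith))
    simp only [f]
    linarith
  obtain ⟨r, ⟨-, hrt⟩, hr⟩ := intermediate_value_Icc (show t - μ - 1 ≤ t by linarith)
    hf.continuousOn ⟨hbot.le, hft.le⟩
  obtain ⟨q, ⟨hq0, hqs⟩, hq⟩ := intermediate_value_Icc' hs.le hf.continuousOn ⟨hfs.le, hf0⟩
  obtain ⟨p, ⟨hsp, -⟩, hp⟩ := intermediate_value_Icc (show s ≤ s + e + μ + 1 by linarith)
    hf.continuousOn ⟨hfs.le, htop.le⟩
  have hqs' : q < s := hqs.lt_of_ne (by rintro rfl; linarith)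
  have hqp : q < p := by linarith
  refine ⟨p, q, r, by linarith, hq0, hqp, fun y => ?_⟩
  simp only [f] at hp hq hr
  obtain ⟨h1, h2, h3⟩ := cubic_eq_of_roots (u := -(e + s + t))
    (v := e * s + e * t + s * t - μ) (w := -(e * s * t)) hqp.ne' (by linarith : r < q).ne'
    (by linarith : r < p).ne' (by linear_combination hp) (by linear_combination hq)
    (by linear_combination hr)
  linear_combination y ^ 2 * h1 + y * h2 + h3

theorem stmt_13 {V : Type*} [Fintype V] (G : SimpleGraph V) [DecidableRel G.Adj] (D k : ℕ) (hD : 3 ≤ D)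
    (b c : ℕ → ℕ) (hdrg : G.IsDRGWith D b c)
    (hreg : G.IsRegularOfDegree k) (hb0 : b 0 = k) (hc1 : c 1 = 1)
    (θ : Fin (D+1) → ℝ) (hθ : StrictAnti θ) (hθ0 : θ 0 = k)
    (hchar : (intersectionMatrix D k b c).charpoly = ∏ i, (X - C (θ i)))
    (hcond : (b 2 : ℝ) + (c 3 : ℝ) ≤ (k : ℝ) + 1) :
    (θ 1 + 1) * (θ 2 + 1) * (θ (Fin.last D) + 1) ≤
        -(b 1 : ℝ) * ((k : ℝ) + 1 - (b 2 : ℝ) - (c 3 : ℝ)) ∧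
      ((θ 1 + 1) * (θ 2 + 1) * (θ (Fin.last D) + 1) =
        -(b 1 : ℝ) * ((k : ℝ) + 1 - (b 2 : ℝ) - (c 3 : ℝ)) ↔ D = 3) := by
  have hb : ∀ i < D, 0 < b i := fun i hi => (hdrg.pos hi).1
  have hc : ∀ i < D, 0 < c (i + 1) := fun i hi => (hdrg.pos hi).2
  have hbD := hdrg.b_diam_s13
  have hc0 := hdrg.c_zero_s13
  have hex : ∀ i : Fin D, ∃ d : ℕ → ℝ, d 0 = 0 ∧ d 1 = 1 ∧ ∀ n < D,
      c n * d n + ((k : ℝ) - b n - c (n + 1)) * d (n + 1) + b (n + 1) * d (n + 2) =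
        θ i.succ * d (n + 1) := by
    intro i
    apply exists_reduced_eigenvector (by omega) hb hbD hc0 hb0
    · rw [← hθ0]
      exact (hθ i.succ_pos).ne
    · rw [hchar, eval_prod]
      exact Finset.prod_eq_zero (Finset.mem_univ i.succ) (by simp)
  choose d hd0 hd1 hd using hex
  have hb1 : (0 : ℝ) < b 1 := by exact_mod_cast hb 1 (by omega)
  have hb2 : (0 : ℝ) < b 2 := by exact_mod_cast hb 2 (by omega)
  have hc2 : (0 : ℝ) < c 2 := by exact_mod_cast hc 1 (by omega)
  let Y : Fin D → ℝ := fun i => θ i.succ + 1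
  have hY : StrictAnti Y := fun i j hij => by
    have := hθ (Fin.succ_lt_succ_iff.2 hij)
    simp only [Y]
    linarith
  have hd2 : ∀ i, b 1 * d i 2 = Y i := by
    intro i
    have h := hd i 0 (by omega)
    simp only [zero_add, hd0, hd1, hb0, hc1] at h
    push_cast at h
    simp only [Y]
    linear_combination h
  have hd3 : ∀ i, b 1 * b 2 * d i 3 = Y i ^ 2 - (k + 1 - b 1 - c 2) * Y i - b 1 := by
    intro i
    have h := hd i 1 (by omega)
    simp only [hd1, hc1, Nat.reduceAdd] at h
    have h2 := hd2 i
    simp only [Y] at h2 ⊢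
    push_cast at h
    linear_combination b 1 * h + (θ i.succ - k + b 1 + c 2) * h2
  have hd4 : ∀ i, b 1 * b 2 * b 3 * d i 4 = (Y i - (k + 1 - b 2 - c 3)) *
      (Y i ^ 2 - (k + 1 - b 1 - c 2) * Y i - b 1) - b 2 * c 2 * Y i := by
    intro i
    have h := hd i 2 (by omega)
    simp only [Nat.reduceAdd] at h
    have h2 := hd2 i
    have h3 := hd3 i
    simp only [Y] at h2 h3 ⊢
    linear_combination b 1 * b 2 * h + (θ i.succ - k + b 2 + c 3) * h3 - b 2 * c 2 * h2
  obtain ⟨m, rfl | rfl⟩ : ∃ m, D = 3 ∨ D = m + 4 := ⟨D - 4, by omega⟩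
  · have hroot : ∀ i, (Y i - (k + 1 - b 2 - c 3)) *
        (Y i ^ 2 - (k + 1 - b 1 - c 2) * Y i - b 1) - b 2 * c 2 * Y i = 0 := by
      intro i
      rw [← hd4 i, hbD]
      simp
    have h01 : Y 1 < Y 0 := hY (by decide)
    have h12 : Y 2 < Y 1 := hY (by decide)
    have h := (cubic_eq_of_roots (u := -((k + 1 - b 1 - c 2) + (k + 1 - b 2 - c 3)))
      (v := (k + 1 - b 1 - c 2) * (k + 1 - b 2 - c 3) - b 1 - b 2 * c 2)
      (w := b 1 * (k + 1 - b 2 - c 3)) h01.ne' h12.ne' (h12.trans h01).ne'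
      (by linear_combination hroot 0) (by linear_combination hroot 1)
      (by linear_combination hroot 2)).2.2
    have heq : (θ 1 + 1) * (θ 2 + 1) * (θ (Fin.last 3) + 1) =
        -(b 1 : ℝ) * ((k : ℝ) + 1 - (b 2 : ℝ) - (c 3 : ℝ)) := by
      have h' : Y 0 * Y 1 * Y 2 = (θ 1 + 1) * (θ 2 + 1) * (θ (Fin.last 3) + 1) := rfl
      linarith
    exact ⟨heq.le, fun _ => rfl, fun _ => heq⟩
  · let ρ : ℕ → ℝ := fun n => ∏ j ∈ Finset.range n, ((b (j + 1) : ℝ) / c (j + 1))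
    have hcpos : ∀ j < m + 4, (0 : ℝ) < c (j + 1) := fun j hj => by exact_mod_cast hc j hj
    have hbpos : ∀ j < m + 4, (0 : ℝ) < b j := fun j hj => by exact_mod_cast hb j hj
    have hρpos : ∀ n < m + 4, 0 < ρ n := fun n hn => Finset.prod_pos fun j hj => by
      rw [Finset.mem_range] at hj
      exact div_pos (hbpos _ (by omega)) (hcpos _ (by omega))
    have hρ : ∀ n, n + 1 < m + 4 → ρ (n + 1) * c (n + 1) = ρ n * b (n + 1) := by
      intro n hn
      have := (hcpos n (by omega)).ne'
      simp only [ρ, Finset.prod_range_succ]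
      field_simp
    obtain ⟨w, hw, hdual⟩ := exists_dual_orthogonal hρpos hd1 fun i j hij =>
      sum_weighted_mul_eigenvector_eq_zero
        (a := fun n => (k : ℝ) - b n - c (n + 1)) (b := fun n => b n) (c := fun n => c n)
        (by simp [hbD]) hρ (fun h => hij (Fin.succ_injective _ (hθ.injective h)))
        (hd0 i) (hd0 j) (hd i) (hd j)
    obtain ⟨p, q, r, hr0, hq0, hqp, hfac⟩ := exists_roots_cubic
      (a := (k : ℝ) + 1 - b 1 - c 2) (show (0 : ℝ) ≤ k + 1 - b 2 - c 3 by linarith) hb1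
      (mul_pos hb2 hc2)
    obtain ⟨h0, h1, h2⟩ := roots_lt_of_orthogonal hY hw hqp (hr0.trans_le hq0) (by
      intro x y z
      have e1 := hdual 3 (by omega) 0 (by omega) (by omega)
      have e2 := hdual 3 (by omega) 1 (by omega) (by omega)
      have e3 := hdual 3 (by omega) 2 (by omega) (by omega)
      have hcomb : ∀ i, w i * (((Y i - p) * (Y i - q) * (Y i - r)) *
          (x * Y i ^ 2 + y * Y i + z)) =
          (b 1 * b 2 * b 3 * (z + x * b 1)) * (w i * (d i (3 + 1) * d i (0 + 1))) +
          (b 1 * b 2 * b 3 * (y + x * (k + 1 - b 1 - c 2)) * b 1) *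
            (w i * (d i (3 + 1) * d i (1 + 1))) +
          (b 1 * b 2 * b 3 * x * (b 1 * b 2)) * (w i * (d i (3 + 1) * d i (2 + 1))) := by
        intro i
        have h2 := hd2 i
        have h3 := hd3 i
        rw [← hfac, ← hd4]
        simp only [Nat.reduceAdd, hd1]
        linear_combination (-(w i * (b 1 * b 2 * b 3 * d i 4)) *
          (x * h3 + (y + x * (k + 1 - b 1 - c 2)) * h2))
      simp only [hcomb, Finset.sum_add_distrib, ← Finset.mul_sum, e1, e2, e3, mul_zero,
        add_zero])
    have hpqr : p * q * r = -(b 1 : ℝ) * ((k : ℝ) + 1 - (b 2 : ℝ) - (c 3 : ℝ)) := by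
      linear_combination hfac 0
    have hlt : Y 0 * Y 1 * Y (Fin.last _) < p * q * r := by
      have hp0 : 0 < p := by linarith
      have i1 : p * q < Y 0 * Y 1 := mul_lt_mul'' h0 h1 hp0.le hq0
      have i2 : Y 0 * Y 1 * Y (Fin.last _) < Y 0 * Y 1 * r :=
        mul_lt_mul_of_pos_left h2 ((mul_nonneg hp0.le hq0).trans_lt i1)
      exact i2.trans (mul_lt_mul_of_neg_right i1 hr0)
    rw [hpqr] at hlt
    have h' : Y 0 * Y 1 * Y (Fin.last _) =
        (θ 1 + 1) * (θ 2 + 1) * (θ (Fin.last (m + 4)) + 1) := rfl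
    rw [h'] at hlt
    exact ⟨hlt.le, fun h => absurd h hlt.ne, fun h => by omega⟩
end
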